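/- Let (R,m,k) be a regular local ring of dimension n and assume that the order ideal conjecture holds for every regular local ring of dimension n−1. Let I be an ideal of height d with minimal set of generators x_1,…,x_s, where s > d, and suppose R/I satisfies Serre's condition S_2. If I contains an element of m ∖ m², or if depth R/I > 0, then for every i ≥ 0 the natural map K_{d+i}(x;R) ⊗_R k → Tor_{d+i}^R(R/I, k) is the zero map. -/

import Mathlib

open IsLocalRing

universe u

variable (R : Type u) [CommRing R]

/-- Index type for the degree-`n` part of the Koszul complex on `s` generators:
`n`-element subsets of `Fin s` (i.e. strictly increasing `n`-tuples). -/
abbrev KIdx (s n : ℕ) : Type := {T : Finset (Fin s) // T.card = n}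

/-- The degree-`n` part of the Koszul complex `K_•(x₁,…,x_s; R)`:
the free `R`-module on `KIdx s n`. -/
abbrev KMod (s n : ℕ) : Type u := KIdx s n →₀ R

/-- The Koszul differential `K_{n+1}(x;R) → K_n(x;R)`,
`e_T ↦ ∑_{j ∈ T} (-1)^{#{i ∈ T : i < j}} x_j e_{T∖{j}}`. -/
noncomputable def koszulD {s : ℕ} (x : Fin s → R) (n : ℕ) :
    KMod R s (n + 1) →ₗ[R] KMod R s n :=
  Finsupp.lsum R fun T => LinearMap.toSpanSingleton R (KMod R s n)
    (∑ j ∈ T.1.attach,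
      ((-1 : R) ^ (T.1.filter (fun i => i < j.1)).card * x j.1) •
        Finsupp.single ⟨T.1.erase j.1, by
          simp [Finset.card_erase_of_mem j.2, T.2]⟩ (1 : R))

/-- A projective resolution `⋯ → F 1 → F 0 → M → 0` of an `R`-module `M`. -/
structure ProjRes (M : Type u) [AddCommGroup M] [Module R M] where
  F : ℕ → ModuleCat.{u} R
  d : ∀ n, F (n + 1) →ₗ[R] F n
  ε : F 0 →ₗ[R] M
  projective : ∀ n, Module.Projective R (F n)
  surj : Function.Surjective ε
  exact0 : LinearMap.ker ε = LinearMap.range (d 0)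
  exact : ∀ n, LinearMap.ker (d n) = LinearMap.range (d (n + 1))

/-- A chain map `ψ : K_•(x;R) → F_•` lifting the natural surjection
`R/(x₁,…,x_s) → R/I` (for `(x) ⊆ I`), where `F_•` is a projective resolution of
`R/I`.  The condition `aug` says that on `K_0 = R·e_∅` the augmentations are
compatible: `ε(ψ₀(r·e_∅)) = r mod I`. -/
structure KoszulLift {s : ℕ} (x : Fin s → R) (I : Ideal R)
    (P : ProjRes R (R ⧸ I)) where
  ψ : ∀ n, KMod R s n →ₗ[R] P.F n
  comm : ∀ n, (ψ n).comp (koszulD R x n) = (P.d n).comp (ψ (n + 1))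
  aug : ∀ v : KMod R s 0, P.ε (ψ 0 v) = Ideal.Quotient.mk I (v ⟨∅, rfl⟩)

/-- The natural map `K_i(x;R) ⊗ k → Tor_i^R(R/I, k)` is the zero map: for every
projective resolution `F_•` of `R/I` and every chain map `ψ : K_•(x;R) → F_•`
lifting the natural surjection `R/(x) → R/I`, every element of `ψ_i(K_i)` lies in
`im(d_{i+1}) + m·F_i`.  (As every element of `K_i ⊗ k` is a cycle, the induced
map on `i`-th homology `K_i ⊗ k → H_i(F_• ⊗ k) = Tor_i^R(R/I,k)` is zero exactly
when `ψ_i(K_i) ⊆ im(d_{i+1}) + m·F_i`.) -/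
def KoszulTorMapZero [IsLocalRing R] {s : ℕ} (x : Fin s → R) (I : Ideal R)
    (i : ℕ) : Prop :=
  ∀ (P : ProjRes R (R ⧸ I)) (L : KoszulLift R x I P) (v : KMod R s i),
    L.ψ i v ∈ LinearMap.range (P.d i) ⊔ (maximalIdeal R) • (⊤ : Submodule R (P.F i))

/-- The grade of the ideal `J` is at least `k`: either `J = R` (grade `+∞` by
convention), or `J` contains a weakly `R`-regular sequence of length `k`. -/
def GradeGE (J : Ideal R) (k : ℕ) : Prop :=
  J = ⊤ ∨ ∃ rs : List R, rs.length = k ∧ (∀ r ∈ rs, r ∈ J) ∧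
    RingTheory.Sequence.IsWeaklyRegular R rs

/-- The order ideal `O_M(y) = {f(y) : f ∈ Hom_R(M, R)}` of `y : M`. -/
def orderIdeal {M : Type u} [AddCommGroup M] [Module R M] (y : M) : Ideal R :=
  LinearMap.range (LinearMap.applyₗ (R := R) (M := M) (M₂ := R) y)

/-- `M` has a finite resolution by finitely generated free modules; for a
finitely generated module over a Noetherian local ring this says exactly that
`M` has finite projective dimension. -/
def HasFiniteFreeResolution (M : Type u) [AddCommGroup M] [Module R M] : Prop :=
  ∃ (P : ProjRes R M) (n : ℕ),
    (∀ j, Module.Free R (P.F j) ∧ Module.Finite R (P.F j)) ∧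
    ∀ j, n ≤ j → Subsingleton (P.F j)

/-- `M` is a `k`-th syzygy: there is an exact sequence
`0 → M → F_{k-1} → ⋯ → F_0 → N → 0` with the `F_j` finitely generated free;
equivalently (continuing the resolution), `M` is isomorphic to the `k`-th syzygy
module `im(d_{k-1})` of some resolution of `N` by finitely generated free
modules. -/
def IsSyzygy (k : ℕ) (M : Type u) [AddCommGroup M] [Module R M] : Prop :=
  match k with
  | 0 => True
  | (j + 1) => ∃ (N : Type u) (_ : AddCommGroup N) (_ : Module R N)
      (P : ProjRes R N),
        (∀ n, Module.Free R (P.F n) ∧ Module.Finite R (P.F n)) ∧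
        Nonempty (M ≃ₗ[R] ↥(LinearMap.range (P.d j)))

/-- The order ideal conjecture holds for the local ring `R`: for every finitely
generated `R`-module `M` of finite projective dimension which is a `k`-th syzygy
and every minimal generator `y` of `M` (i.e. `y ∉ mM`), the order ideal `O_M(y)`
has grade at least `k`. -/
def OrderIdealConjecture [IsLocalRing R] : Prop :=
  ∀ (M : Type u) (_ : AddCommGroup M) (_ : Module R M),
    Module.Finite R M → HasFiniteFreeResolution R M →
      ∀ k : ℕ, IsSyzygy R k M →
        ∀ y : M, y ∉ (maximalIdeal R) • (⊤ : Submodule R M) →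
          GradeGE R (orderIdeal R y) k

/-- `R` is a regular local ring: a Noetherian local ring whose maximal ideal is
generated by `dim R` elements. -/
def IsRegularLocal [IsLocalRing R] : Prop :=
  IsNoetherianRing R ∧ ∃ (n : ℕ) (x : Fin n → R),
    Ideal.span (Set.range x) = maximalIdeal R ∧ ringKrullDim R = n

/-- The ideal `I` has height `d`: `d` is the minimum of the heights of the primes
containing `I`, the height of a prime `P` being `dim R_P`. -/
def HeightEq (I : Ideal R) (d : ℕ) : Prop :=
  (∃ (P : Ideal R) (h : P.IsPrime), I ≤ P ∧
      ringKrullDim (@Localization.AtPrime R _ P h) = d) ∧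
    ∀ (P : Ideal R) (h : P.IsPrime), I ≤ P →
      (d : WithBot ℕ∞) ≤ ringKrullDim (@Localization.AtPrime R _ P h)

/-- Serre's condition `S_n` for the ring `A`: for every prime `P` of `A`,
`depth A_P ≥ min(n, dim A_P)`, expressed by the existence of regular sequences
in the maximal ideal of `A_P` of every length `j ≤ min(n, dim A_P)`. -/
def SerreS (A : Type u) [CommRing A] (n : ℕ) : Prop :=
  ∀ (P : Ideal A) (h : P.IsPrime) (j : ℕ), j ≤ n →
    (j : WithBot ℕ∞) ≤ ringKrullDim (@Localization.AtPrime A _ P h) →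
      ∃ rs : List (@Localization.AtPrime A _ P h), rs.length = j ∧
        (∀ r ∈ rs, r ∈ maximalIdeal (@Localization.AtPrime A _ P h)) ∧
        RingTheory.Sequence.IsWeaklyRegular (@Localization.AtPrime A _ P h) rs

/-- `x₁, …, x_s` is a minimal set of generators of `I`: the `x_j` generate `I`
and no `x_j` is redundant (over a local ring this says exactly that
`s = dim_k I/mI`). -/
def MinimalGenerators {s : ℕ} (x : Fin s → R) (I : Ideal R) : Prop :=
  Ideal.span (Set.range x) = I ∧
    ∀ j, x j ∉ Ideal.span (x '' ({j}ᶜ : Set (Fin s)))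

namespace KoszulTor

open RingTheory.Sequence Ideal CategoryTheory Abelian Limits Pointwise IsSMulRegular

section Grade

variable {R : Type u} [CommRing R]

theorem exists_quotient_ext_vanishing (N : ModuleCat.{u} R) (l : ℕ) (zs : List R) :
    ∀ M : ModuleCat.{u} R, IsWeaklyRegular M zs →
      (∀ i < l + zs.length, Subsingleton (Ext N M i)) →
      ∃ M' : ModuleCat.{u} R,
        Nonempty (M' ≃ₗ[R] (M ⧸ (Ideal.ofList zs • ⊤ : Submodule R M))) ∧
        ∀ i < l, Subsingleton (Ext N M' i) := by
  induction zs with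
  | nil =>
    intro M _ h
    refine ⟨M, ⟨(Submodule.quotEquivOfEqBot _ ?_).symm⟩, by simpa using h⟩
    simp
  | cons x xs ih =>
    intro M hr h
    rw [isWeaklyRegular_cons_iff] at hr
    obtain ⟨M', ⟨e⟩, hM'⟩ := ih (ModuleCat.of R (QuotSMulTop x M)) hr.2 (by
      intro i hi
      have zero1 := AddCommGrpCat.isZero_of_iff_subsingleton.mpr
        (h i (by simp only [List.length_cons]; omega))
      have zero2 := AddCommGrpCat.isZero_of_iff_subsingleton.mpr
        (h (i + 1) (by simp only [List.length_cons]; omega))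
      exact AddCommGrpCat.subsingleton_of_isZero <| ShortComplex.Exact.isZero_of_both_zeros
        ((Ext.covariant_sequence_exact₃' N hr.1.smulShortComplex_shortExact) i (i + 1) rfl)
        (zero1.eq_zero_of_src _) (zero2.eq_zero_of_tgt _))
    exact ⟨M', ⟨e.trans (Submodule.quotOfListConsSMulTopEquivQuotSMulTopInner M x xs).symm⟩, hM'⟩

/-- A regular sequence inside an ideal that kills a nonzero element modulo a regular sequence `zs`
is at most as long as `zs`. -/
theorem length_le_of_smul_mem [IsNoetherianRing R] {zs rs : List R} (hz : IsWeaklyRegular R zs)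
    {g : R} (hg : g ∉ Ideal.ofList zs) {𝔞 : Ideal R} (h𝔞 : ∀ a ∈ 𝔞, a * g ∈ Ideal.ofList zs)
    (hrs : ∀ r ∈ rs, r ∈ 𝔞) (hr : IsWeaklyRegular R rs) : rs.length ≤ zs.length := by
  by_contra hlt
  push Not at hlt
  have h1 : 𝔞 ≠ ⊤ := by
    rintro rfl
    exact hg (by simpa using h𝔞 1 trivial)
  have hreg : IsRegular R rs := ⟨hr, by
    intro h
    apply h1
    rw [eq_top_iff]
    calc (⊤ : Ideal R) = Ideal.ofList rs • ⊤ := h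
      _ ≤ 𝔞 := by
        rw [smul_eq_mul, Ideal.mul_top]
        exact Ideal.span_le.2 hrs⟩
  have hext := ModuleCat.subsingleton_ext_of_exists_isRegular 𝔞 (ModuleCat.of R (R ⧸ 𝔞))
    (by rw [Module.support_eq_zeroLocus, Ideal.annihilator_quotient])
    (ModuleCat.of R R) (by simpa using h1.lt_top) rs hrs hreg
  obtain ⟨M', ⟨e⟩, hM'⟩ := exists_quotient_ext_vanishing (ModuleCat.of R (R ⧸ 𝔞)) 1 zs
    (ModuleCat.of R R) hz (fun i hi => hext i (by omega))
  have hs : Subsingleton ((R ⧸ 𝔞) →ₗ[R] M') :=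
    (Ext.addEquiv₀.trans ModuleCat.homAddEquiv).symm.subsingleton_congr.2 (hM' 0 one_pos)
  let f : R →ₗ[R] (R ⧸ (Ideal.ofList zs • ⊤ : Submodule R R)) :=
    LinearMap.toSpanSingleton R _ (Submodule.Quotient.mk g)
  let φ : (R ⧸ 𝔞) →ₗ[R] M' := e.symm.toLinearMap ∘ₗ Submodule.liftQ 𝔞 f (by
    intro a ha
    simp only [LinearMap.mem_ker, f, LinearMap.toSpanSingleton_apply]
    rw [← Submodule.Quotient.mk_smul, Submodule.Quotient.mk_eq_zero]
    simpa using h𝔞 a ha)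
  have h0 : φ (Submodule.Quotient.mk 1) = 0 := by
    rw [Subsingleton.elim φ 0]; rfl
  simp only [φ, LinearMap.comp_apply, LinearEquiv.coe_coe, LinearEquiv.map_eq_zero_iff,
    Submodule.liftQ_apply, f, LinearMap.toSpanSingleton_apply, one_smul,
    Submodule.Quotient.mk_eq_zero] at h0
  exact hg (by simpa using h0)

end Grade

section Ischebeck

variable {R : Type u} [CommRing R] {M : Type u} [AddCommGroup M] [Module R M]

theorem mem_associatedPrimes_iff [IsNoetherianRing R] {p : Ideal R} :
    p ∈ associatedPrimes R M ↔ p.IsPrime ∧ ∃ m : M, ∀ r, r ∈ p ↔ r • m = 0 := by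
  rw [AssociatedPrimes.mem_iff, isAssociatedPrime_iff]
  refine and_congr_right fun _ => exists_congr fun m => ?_
  simp [SetLike.ext_iff, Submodule.mem_colon_singleton]

theorem exists_associatedPrimes_between [IsNoetherianRing R] {Q : Ideal R} [Q.IsPrime] (m : M)
    (hm : ∀ u, u • m = 0 → u ∈ Q) :
    ∃ p ∈ associatedPrimes R M, p ≤ Q ∧ ∀ b, b • m = 0 → b ∈ p := by
  have hann : Module.annihilator R (Submodule.span R {m}) ≤ Q := by
    intro u hu
    exact hm u (Submodule.mem_annihilator_span_singleton m u |>.1 hu)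
  obtain ⟨p, hp, hpQ⟩ := Ideal.exists_minimalPrimes_le hann
  refine ⟨p, ?_, hpQ, ?_⟩
  · have h1 := Module.associatedPrimes.minimalPrimes_annihilator_subset_associatedPrimes R
      (Submodule.span R {m}) hp
    exact associatedPrimes.subset_of_injective
      (f := (Submodule.span R {m}).subtype) Subtype.val_injective h1
  · intro b hb
    exact hp.1.2 ((Submodule.mem_annihilator_span_singleton m b).2 hb)

theorem exists_associatedPrimes_quotSMulTop [IsNoetherianRing R] [Module.Finite R M]
    {Q : Ideal R} [Q.IsPrime] {x : R} (hxQ : x ∈ Q) (hx : IsSMulRegular M x)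
    {p : Ideal R} (hp : p ∈ associatedPrimes R M) (hpQ : p ≤ Q) :
    ∃ p' ∈ associatedPrimes R (QuotSMulTop x M), p ≤ p' ∧ x ∈ p' ∧ p' ≤ Q := by
  obtain ⟨hpp, m₀, hm₀⟩ := mem_associatedPrimes_iff.1 hp
  let N : Submodule R M := Submodule.torsionBySet R M (p : Set R)
  have hN : ∀ m, m ∈ N ↔ ∀ a ∈ p, a • m = 0 := fun m => by
    simp [N, Submodule.mem_torsionBySet_iff]
  by_cases hcase : ∃ m ∈ N, ∀ u, u • m ∈ x • (⊤ : Submodule R M) → u ∈ Q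
  · obtain ⟨m, hm, hu⟩ := hcase
    obtain ⟨p', hp', hp'Q, hb⟩ := exists_associatedPrimes_between (M := QuotSMulTop x M) (Q := Q)
      (Submodule.Quotient.mk m) (by
        intro u hu'
        rw [← Submodule.Quotient.mk_smul, Submodule.Quotient.mk_eq_zero] at hu'
        exact hu u hu')
    refine ⟨p', hp', fun a ha => hb a ?_, hb x ?_, hp'Q⟩
    · rw [← Submodule.Quotient.mk_smul, (hN m).1 hm a ha, Submodule.Quotient.mk_zero]
    · rw [← Submodule.Quotient.mk_smul, Submodule.Quotient.mk_eq_zero]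
      exact Submodule.smul_mem_pointwise_smul m x ⊤ trivial
  · exfalso
    push Not at hcase
    have hfg : N.FG := IsNoetherian.noetherian N
    obtain ⟨s, hs⟩ := hfg
    have hsN : ∀ m ∈ s, m ∈ N := fun m hm => hs ▸ Submodule.subset_span hm
    choose! u hu using hcase
    let U := ∏ m ∈ s, u m
    have hUQ : U ∉ Q := by
      intro h
      obtain ⟨m, hm, hmQ⟩ := (Ideal.IsPrime.prod_mem_iff).1 h
      exact (hu m (hsN m hm)).2 hmQ
    have hU : ∀ m ∈ N, U • m ∈ x • (⊤ : Submodule R M) := by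
      intro m hm
      rw [← hs] at hm
      induction hm using Submodule.span_induction with
      | mem m hm =>
        obtain ⟨c, hc⟩ := Finset.dvd_prod_of_mem u hm
        simp only [U, hc]
        rw [mul_comm, mul_smul]
        exact Submodule.smul_mem _ _ (hu m (hsN m hm)).1
      | zero => simp
      | add a b _ _ ha hb => rw [smul_add]; exact Submodule.add_mem _ ha hb
      | smul r a _ ha => rw [smul_comm]; exact Submodule.smul_mem _ _ ha
    have hrange : LinearMap.range (U • (LinearMap.id : N →ₗ[R] N)) ≤
        Ideal.span {x} • (⊤ : Submodule R N) := by
      rintro _ ⟨m, rfl⟩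
      obtain ⟨m', -, hm'⟩ := hU m m.2
      have hm'N : m' ∈ N := (hN m').2 fun a ha => hx (by
        have h1 : a • U • (m : M) = 0 := by rw [smul_comm, (hN _).1 m.2 a ha, smul_zero]
        have h2 : x • m' = U • (m : M) := hm'
        change x • a • m' = x • (0 : M)
        rw [smul_comm, h2, h1, smul_zero])
      have : (U • (LinearMap.id : N →ₗ[R] N)) m = x • (⟨m', hm'N⟩ : N) := by
        ext; exact hm'.symm
      rw [this]
      exact Submodule.smul_mem_smul (Ideal.mem_span_singleton_self x) trivial
    obtain ⟨χ, hmon, -, hco, haev⟩ :=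
      LinearMap.exists_monic_and_natDegree_eq_and_coeff_mem_pow_and_aeval_eq_zero _ _ _ hrange
    have h3 : (χ.eval U) • m₀ = 0 := by
      have h4 := congrArg (fun f : Module.End R N => ((f ⟨m₀, (hN m₀).2 fun a ha =>
        (hm₀ a).1 ha⟩ : N) : M)) haev
      simp only [LinearMap.zero_apply, ZeroMemClass.coe_zero] at h4
      have h5 : (U • (LinearMap.id : N →ₗ[R] N)) = algebraMap R (Module.End R N) U := by
        ext; simp
      rw [h5, Polynomial.aeval_algebraMap_apply] at h4
      simpa using h4
    have h6 : χ.eval U ∈ Q := hpQ ((hm₀ _).2 h3)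
    rw [Polynomial.eval_eq_sum_range, Finset.sum_range_succ, hmon.coeff_natDegree, one_mul] at h6
    have h7 : ∑ i ∈ Finset.range χ.natDegree, χ.coeff i * U ^ i ∈ Q := by
      refine Ideal.sum_mem _ fun i hi => Ideal.mul_mem_right _ _ ?_
      have h8 := hco i
      have : Ideal.span {x} ^ (χ.natDegree - i) ≤ Q :=
        (Ideal.pow_le_self (by have := Finset.mem_range.1 hi; omega)).trans
          ((Ideal.span_singleton_le_iff_mem Q).2 hxQ)
      exact this h8
    exact hUQ (Ideal.IsPrime.mem_of_pow_mem inferInstance _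
      ((Submodule.add_mem_iff_right _ h7).1 h6))

end Ischebeck

section Regular

/-- A regular local ring of dimension `n`. -/
structure RegLocal (R : Type u) [CommRing R] [IsLocalRing R] (n : ℕ) : Prop where
  noeth : IsNoetherianRing R
  gens : ∃ S : Finset R, S.card ≤ n ∧ Ideal.span (S : Set R) = maximalIdeal R
  dim : ringKrullDim R = n

variable {R : Type u} [CommRing R]

theorem exists_mem_notMem_of_finite {I J : Ideal R} (hIJ : ¬ I ≤ J) {s : Set (Ideal R)}
    (hs : s.Finite) (hp : ∀ p ∈ s, p.IsPrime) (hI : ∀ p ∈ s, ¬ I ≤ p) :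
    ∃ w ∈ I, w ∉ J ∧ ∀ p ∈ s, w ∉ p := by
  classical
  by_contra! h
  have h1 : (I : Set R) ⊆ ⋃ i ∈ insert J s, (id i : Ideal R) := by
    intro w hw
    by_cases hwJ : w ∈ J
    · exact Set.mem_biUnion (Set.mem_insert _ _) hwJ
    · obtain ⟨p, hp, hwp⟩ := h w hw hwJ
      exact Set.mem_biUnion (Set.mem_insert_of_mem _ hp) hwp
  rw [Ideal.subset_union_prime_finite (hs.insert J) J J] at h1
  · obtain ⟨p, hp, hp'⟩ := h1
    rcases hp with rfl | hp
    · exact hIJ hp'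
    · exact hI p hp hp'
  · intro i hi hiJ _
    exact hp i (hi.resolve_left hiJ)

theorem RegLocal.isRegularLocal [IsLocalRing R] {n : ℕ} (h : RegLocal R n) : IsRegularLocal R := by
  have := h.noeth
  obtain ⟨S, hS, hspan⟩ := h.gens
  have h1 : n ≤ S.card := by
    have h2 := ringKrullDim_le_spanFinrank_maximalIdeal R
    rw [h.dim, ← hspan] at h2
    have h3 := Submodule.spanFinrank_span_le_ncard_of_finite (R := R) (S.finite_toSet)
    rw [Set.ncard_coe_finset] at h3
    exact (by exact_mod_cast h2 : n ≤ _).trans h3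
  have hc : S.card = n := le_antisymm hS h1
  refine ⟨h.noeth, n, fun i => (S.equivFinOfCardEq hc).symm i, ?_, h.dim⟩
  rw [← hspan]
  congr 1
  ext y
  constructor
  · rintro ⟨i, rfl⟩
    exact ((S.equivFinOfCardEq hc).symm i).2
  · intro hy
    exact ⟨S.equivFinOfCardEq hc ⟨y, hy⟩, by simp⟩

theorem RegLocal.of_isRegularLocal [IsLocalRing R] {n : ℕ} (h : IsRegularLocal R)
    (hn : ringKrullDim R = n) : RegLocal R n := by
  classical
  obtain ⟨hN, k, x, hx, hk⟩ := h
  have : k = n := by rw [hn] at hk; exact_mod_cast hk.symm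
  subst this
  exact ⟨hN, ⟨Finset.univ.image x, Finset.card_image_le.trans (by simp), by simpa using hx⟩, hn⟩

theorem RegLocal.quotient [IsLocalRing R] {n : ℕ} (h : RegLocal R (n + 1)) {w : R}
    (hw : w ∈ maximalIdeal R) (hw2 : w ∉ maximalIdeal R ^ 2) [IsLocalRing (R ⧸ Ideal.span {w})] :
    RegLocal (R ⧸ Ideal.span {w}) n := by
  classical
  have := h.noeth
  obtain ⟨S, hS, hspan⟩ := h.gens
  have hw' : w ∈ Ideal.span (S : Set R) := hspan ▸ hw
  obtain ⟨c, hc⟩ := (Submodule.mem_span_finset' (R := R)).1 hw'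
  have hmS : ∀ y ∈ S, y ∈ maximalIdeal R := fun y hy => hspan ▸ Ideal.subset_span hy
  have : ∃ y : S, c y ∉ maximalIdeal R := by
    by_contra! hall
    apply hw2
    rw [← hc, pow_two]
    exact Ideal.sum_mem _ fun y _ => Ideal.mul_mem_mul (hall y) (hmS y y.2)
  obtain ⟨y, hy⟩ := this
  have hu : IsUnit (c y) := by simpa using hy
  obtain ⟨u, hu⟩ := hu
  let q := Ideal.Quotient.mk (Ideal.span {w})
  have hmap : (maximalIdeal R).map q = maximalIdeal (R ⧸ Ideal.span {w}) :=
    IsLocalRing.map_maximalIdeal_of_surjective q Ideal.Quotient.mk_surjective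
  let T := (S.erase (y : R)).image q
  have hT : T.card ≤ n := by
    refine Finset.card_image_le.trans ?_
    rw [Finset.card_erase_of_mem y.2]
    omega
  have hgen : Ideal.span (T : Set (R ⧸ Ideal.span {w})) = maximalIdeal (R ⧸ Ideal.span {w}) := by
    apply le_antisymm
    · rw [Ideal.span_le]
      intro z hz
      obtain ⟨z', hz', rfl⟩ := Finset.mem_image.1 (Finset.mem_coe.1 hz)
      rw [← hmap]
      exact Ideal.mem_map_of_mem _ (hmS z' (Finset.mem_of_mem_erase hz'))
    · rw [← hmap, ← hspan, Ideal.map_span, Ideal.span_le]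
      rintro _ ⟨z, hz, rfl⟩
      by_cases hzy : z = y
      · subst hzy
        have h1 : q (c y) * q y = - ∑ z ∈ Finset.univ.erase y, q (c z) * q z := by
          have h2 : q (∑ z : S, c z • (z : R)) = 0 := by
            rw [hc]; exact Ideal.Quotient.eq_zero_iff_mem.2 (Ideal.mem_span_singleton_self w)
          rw [map_sum, ← Finset.add_sum_erase _ _ (Finset.mem_univ y)] at h2
          simp only [smul_eq_mul, map_mul] at h2
          linear_combination h2
        have h2 : q y = q ((u⁻¹ : Rˣ) : R) * (q (c y) * q y) := by
          rw [← hu, ← mul_assoc, ← map_mul]; simp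
        change q y ∈ _
        rw [h2, h1]
        refine Ideal.mul_mem_left _ _ (neg_mem (Ideal.sum_mem _ fun z hz => Ideal.mul_mem_left _ _
          (Ideal.subset_span ?_)))
        exact Finset.mem_coe.2 (Finset.mem_image_of_mem _ (Finset.mem_erase.2
          ⟨fun h => (Finset.mem_erase.1 hz).1 (Subtype.ext h), z.2⟩))
      · exact Ideal.subset_span (Finset.mem_coe.2 (Finset.mem_image_of_mem _
          (Finset.mem_erase.2 ⟨hzy, hz⟩)))
  refine ⟨inferInstance, ⟨T, hT, hgen⟩, le_antisymm ?_ ?_⟩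
  · refine (ringKrullDim_le_spanFinrank_maximalIdeal _).trans ?_
    rw [← hgen]
    have h3 := Submodule.spanFinrank_span_le_ncard_of_finite (R := R ⧸ Ideal.span {w})
      (T.finite_toSet)
    rw [Set.ncard_coe_finset] at h3
    exact_mod_cast h3.trans hT
  · have h1 := ringKrullDim_le_ringKrullDim_quotient_add_card ({w} : Finset R) (by
      simpa [IsLocalRing.ringJacobson_eq_maximalIdeal] using hw)
    rw [h.dim, Finset.coe_singleton, Finset.card_singleton] at h1
    push_cast at h1
    generalize ringKrullDim (R ⧸ Ideal.span {w}) = D at h1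
    induction D using WithBot.recBotCoe with
    | bot => simp at h1
    | coe D =>
      have h2 : (n : ℕ∞) + 1 ≤ D + 1 := by exact_mod_cast h1
      exact_mod_cast (ENat.add_le_add_iff_right ENat.one_ne_top).1 h2

theorem isLocalRing_quotient [IsLocalRing R] {I : Ideal R} (hI : I ≤ maximalIdeal R) :
    IsLocalRing (R ⧸ I) := by
  have : Nontrivial (R ⧸ I) := Ideal.Quotient.nontrivial_iff.2 fun h =>
    (IsLocalRing.maximalIdeal.isMaximal R).ne_top (top_le_iff.1 (h ▸ hI))
  exact IsLocalRing.of_surjective' _ Ideal.Quotient.mk_surjective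

theorem RegLocal.exists_notMem [IsLocalRing R] {n : ℕ} (h : RegLocal R (n + 1)) {s : Set (Ideal R)}
    (hs : s.Finite) (hp : ∀ p ∈ s, p.IsPrime) (hI : ∀ p ∈ s, p ≠ maximalIdeal R) :
    ∃ w ∈ maximalIdeal R, w ∉ maximalIdeal R ^ 2 ∧ ∀ p ∈ s, w ∉ p := by
  have := h.noeth
  refine exists_mem_notMem_of_finite ?_ hs hp ?_
  · intro hle
    have h1 : maximalIdeal R = ⊥ := by
      refine Submodule.eq_bot_of_le_smul_of_le_jacobson_bot (maximalIdeal R) _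
        (IsNoetherian.noetherian _) ?_ (IsLocalRing.maximalIdeal_le_jacobson _)
      rwa [smul_eq_mul, ← pow_two]
    have h2 := IsLocalRing.isField_iff_maximalIdeal_eq.2 h1
    have h3 := h.dim
    rw [ringKrullDim_eq_zero_of_isField h2] at h3
    norm_cast at h3
  · intro p hps hle
    have := hp p hps
    exact hI p hps ((IsLocalRing.maximalIdeal.isMaximal R).eq_of_le this.ne_top hle).symm

theorem RegLocal.isDomain : ∀ {n : ℕ} {R : Type u} [CommRing R] [IsLocalRing R],
    RegLocal R n → IsDomain R
  | 0, R, _, _, h => by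
    obtain ⟨S, hS, hspan⟩ := h.gens
    have : S = ∅ := Finset.card_eq_zero.1 (Nat.le_zero.1 hS)
    subst this
    have : IsField R := IsLocalRing.isField_iff_maximalIdeal_eq.2 (by rw [← hspan]; simp)
    exact this.isDomain
  | n + 1, R, _, _, h => by
    have := h.noeth
    obtain ⟨w, hw, hw2, hwp⟩ := h.exists_notMem (minimalPrimes.finite_of_isNoetherianRing R)
      (fun p hp => hp.1.1) (by
        rintro p hp rfl
        have h1 : (maximalIdeal R).height = 0 := by
          have := hp.1.1
          exact Ideal.height_eq_zero_iff.2 hp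
        have h2 := IsLocalRing.maximalIdeal_height_eq_ringKrullDim (R := R)
        rw [h.dim, h1] at h2
        norm_cast at h2)
    have hle : Ideal.span {w} ≤ maximalIdeal R := (Ideal.span_singleton_le_iff_mem _).2 hw
    have := isLocalRing_quotient hle
    have hdom := RegLocal.isDomain (h.quotient hw hw2)
    have hprime : (Ideal.span {w}).IsPrime := Ideal.Quotient.isDomain_iff_prime _ |>.1 hdom
    obtain ⟨p, hp, hpw⟩ := Ideal.exists_minimalPrimes_le (I := ⊥) (bot_le : ⊥ ≤ Ideal.span {w})
    have hpp := hp.1.1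
    have h0 : p = ⊥ := by
      refine Submodule.eq_bot_of_le_smul_of_le_jacobson_bot (maximalIdeal R) _
        (IsNoetherian.noetherian _) ?_ (IsLocalRing.maximalIdeal_le_jacobson _)
      intro a ha
      obtain ⟨b, rfl⟩ := Ideal.mem_span_singleton'.1 (hpw ha)
      rw [mul_comm]
      exact Submodule.smul_mem_smul hw ((hpp.mem_or_mem ha).resolve_right (hwp p hp))
    subst h0
    exact (IsDomain.of_bot_isPrime R)

end Regular

section Chains

variable {R : Type u} [CommRing R]

theorem span_singleton_eq_smul_top (w : R) :
    (w • (⊤ : Submodule R R)) = (Ideal.span {w} : Ideal R) := by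
  rw [← Submodule.ideal_span_singleton_smul, smul_eq_mul, Ideal.mul_top]

/-- `R/wR` as a quotient by an ideal. -/
noncomputable def quotSMulTopEquivQuotient (w : R) : QuotSMulTop w R ≃ₗ[R] (R ⧸ Ideal.span {w}) :=
  Submodule.quotEquivOfEq _ _ (span_singleton_eq_smul_top w)

theorem isWeaklyRegular_cons_of_map {w : R} (hw : IsSMulRegular R w) {rs : List R}
    (h : IsWeaklyRegular (R ⧸ Ideal.span {w}) (rs.map (Ideal.Quotient.mk (Ideal.span {w})))) :
    IsWeaklyRegular R (w :: rs) := by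
  rw [isWeaklyRegular_cons_iff]
  refine ⟨hw, ?_⟩
  rw [(quotSMulTopEquivQuotient w).isWeaklyRegular_congr]
  exact (isWeaklyRegular_map_algebraMap_iff (R ⧸ Ideal.span {w}) (R ⧸ Ideal.span {w}) rs).1 h

theorem exists_isWeaklyRegular_of_regLocal : ∀ {n : ℕ} {R : Type u} [CommRing R] [IsLocalRing R],
    RegLocal R n → ∃ rs : List R, rs.length = n ∧ (∀ r ∈ rs, r ∈ maximalIdeal R) ∧
      IsWeaklyRegular R rs
  | 0, R, _, _, _ => ⟨[], rfl, by simp, by simp⟩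
  | n + 1, R, _, _, h => by
    have := h.noeth
    have := h.isDomain
    obtain ⟨w, hw, hw2, hwp⟩ := h.exists_notMem Set.finite_empty (by simp) (by simp)
    have hle : Ideal.span {w} ≤ maximalIdeal R := (Ideal.span_singleton_le_iff_mem _).2 hw
    have := isLocalRing_quotient hle
    obtain ⟨rs', hlen, hmem, hreg⟩ := exists_isWeaklyRegular_of_regLocal (h.quotient hw hw2)
    obtain ⟨rs, rfl⟩ := List.map_surjective_iff.2
      (Ideal.Quotient.mk_surjective (I := Ideal.span {w})) rs'
    have hw0 : w ≠ 0 := by rintro rfl; exact hw2 (zero_mem _)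
    refine ⟨w :: rs, by simpa using hlen, ?_, isWeaklyRegular_cons_of_map
      (fun a b hab => mul_left_cancel₀ hw0 hab) hreg⟩
    intro r hr
    rcases List.mem_cons.1 hr with rfl | hr
    · exact hw
    · have h1 := hmem _ (List.mem_map_of_mem hr)
      have := IsLocalHom.of_surjective (Ideal.Quotient.mk (Ideal.span {w}))
        Ideal.Quotient.mk_surjective
      rwa [← IsLocalRing.maximalIdeal_comap (Ideal.Quotient.mk (Ideal.span {w}))]

theorem height_add_length_le [IsNoetherianRing R] {Q : Ideal R} [Q.IsPrime] (rs : List R) :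
    ∀ {M : Type u} [AddCommGroup M] [Module R M] [Module.Finite R M] {p : Ideal R},
      (∀ r ∈ rs, r ∈ Q) → IsWeaklyRegular M rs → p ∈ associatedPrimes R M → p ≤ Q →
      p.height + rs.length ≤ Q.height := by
  induction rs with
  | nil => intro M _ _ _ p _ _ _ hpQ; simpa using Ideal.height_mono hpQ
  | cons x xs ih =>
    intro M _ _ _ p hmem hreg hp hpQ
    rw [isWeaklyRegular_cons_iff] at hreg
    obtain ⟨p', hp', hle, hxp', hp'Q⟩ := exists_associatedPrimes_quotSMulTop
      (hmem x (by simp)) hreg.1 hp hpQ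
    have h1 := ih (fun r hr => hmem r (by simp [hr])) hreg.2 hp' hp'Q
    obtain ⟨hpp, m, hm⟩ := mem_associatedPrimes_iff.1 hp
    have hxp : x ∉ p := by
      intro hx
      have hm0 : m = 0 := hreg.1 (by simpa using (hm x).1 hx)
      exact hpp.ne_top ((Ideal.eq_top_iff_one _).2 ((hm 1).2 (by simp [hm0])))
    have hlt : p < p' := lt_of_le_of_ne hle (by rintro rfl; exact hxp hxp')
    have := hp'.1
    have h2 := Ideal.height_add_one_le_of_lt_of_isPrime hlt
    calc p.height + (x :: xs).length = (p.height + 1) + xs.length := by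
          simp only [List.length_cons]; push_cast; ring
      _ ≤ p'.height + xs.length := by gcongr
      _ ≤ _ := h1

theorem exists_extension [IsNoetherianRing R] {Q : Ideal R} (hQ : Q ≠ ⊤) {zs rs : List R}
    (hz : IsWeaklyRegular R zs) (hzQ : ∀ r ∈ zs, r ∈ Q) (hr : IsWeaklyRegular R rs)
    (hrQ : ∀ r ∈ rs, r ∈ Q) {l : ℕ} (hl : l + zs.length = rs.length) :
    ∃ ws : List R, ws.length = l ∧ (∀ r ∈ ws, r ∈ Q) ∧
      IsWeaklyRegular (R ⧸ (Ideal.ofList zs • ⊤ : Submodule R R)) ws := by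
  have hreg : IsRegular R rs := ⟨hr, by
    intro h
    apply hQ
    rw [eq_top_iff]
    calc (⊤ : Ideal R) = Ideal.ofList rs • ⊤ := h
      _ ≤ Q := by
        rw [smul_eq_mul, Ideal.mul_top]
        exact Ideal.span_le.2 hrQ⟩
  have hsupp : Module.support R (R ⧸ Q) = PrimeSpectrum.zeroLocus Q := by
    rw [Module.support_eq_zeroLocus, Ideal.annihilator_quotient]
  have hext := ModuleCat.subsingleton_ext_of_exists_isRegular Q (ModuleCat.of R (R ⧸ Q))
    hsupp.le (ModuleCat.of R R) (by simpa using hQ.lt_top) rs hrQ hreg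
  obtain ⟨M', ⟨e⟩, hM'⟩ := exists_quotient_ext_vanishing (ModuleCat.of R (R ⧸ Q)) l zs
    (ModuleCat.of R R) hz (fun i hi => hext i (by omega))
  have hfin : Module.Finite R M' := Module.Finite.equiv e.symm
  have hlt : Q • (⊤ : Submodule R M') < ⊤ := by
    rw [lt_top_iff_ne_top]
    intro h
    have h1 := congrArg (Submodule.map e.toLinearMap) h
    rw [Submodule.map_smul'', Submodule.map_top, LinearMap.range_eq_top.2 e.surjective] at h1
    have h2 : (Submodule.Quotient.mk (1 : R) : R ⧸ (Ideal.ofList zs • ⊤ : Submodule R R)) ∈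
      Q • (⊤ : Submodule R (R ⧸ (Ideal.ofList zs • ⊤ : Submodule R R))) := h1.ge trivial
    have h3 : ∀ y ∈ Q • (⊤ : Submodule R (R ⧸ (Ideal.ofList zs • ⊤ : Submodule R R))),
        y ∈ Submodule.map (Submodule.mkQ _) (Q : Submodule R R) := by
      intro y hy
      refine Submodule.smul_induction_on hy ?_ (fun _ _ => Submodule.add_mem _)
      intro r hr n _
      obtain ⟨n, rfl⟩ := Submodule.Quotient.mk_surjective _ n
      exact ⟨r * n, Ideal.mul_mem_right _ _ hr, rfl⟩
    obtain ⟨q, hq, hq1⟩ := h3 _ h2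
    rw [Submodule.mkQ_apply, Submodule.Quotient.eq] at hq1
    have h4 : q - 1 ∈ Q := by
      refine (?_ : (Ideal.ofList zs • ⊤ : Submodule R R) ≤ Q) hq1
      rw [smul_eq_mul, Ideal.mul_top]
      exact Ideal.span_le.2 hzQ
    exact hQ ((Ideal.eq_top_iff_one _).2 (by simpa using Q.sub_mem hq h4))
  obtain ⟨ws, hlen, hmem, hws⟩ := ModuleCat.exists_isRegular_of_exists_subsingleton_ext Q l M' hlt
    (ModuleCat.of R (R ⧸ Q)) hsupp hM'
  exact ⟨ws, hlen, hmem, (e.isWeaklyRegular_congr ws).1 hws.1⟩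

theorem ofList_smul_top (zs : List R) :
    (Ideal.ofList zs • ⊤ : Submodule R R) = (Ideal.ofList zs : Ideal R) := by
  rw [smul_eq_mul, Ideal.mul_top]

theorem mem_associatedPrimes_quotient_iff [IsNoetherianRing R] {I p : Ideal R} :
    p ∈ associatedPrimes R (R ⧸ I) ↔ p.IsPrime ∧ ∃ g : R, ∀ r, r ∈ p ↔ r * g ∈ I := by
  rw [mem_associatedPrimes_iff]
  refine and_congr_right fun _ => ?_
  constructor
  · rintro ⟨m, hm⟩
    obtain ⟨g, rfl⟩ := Ideal.Quotient.mk_surjective m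
    exact ⟨g, fun r => (hm r).trans (by
      rw [← Ideal.Quotient.eq_zero_iff_mem, map_mul]; rfl)⟩
  · rintro ⟨g, hg⟩
    exact ⟨Ideal.Quotient.mk I g, fun r => (hg r).trans (by
      rw [← Ideal.Quotient.eq_zero_iff_mem, map_mul]; rfl)⟩

section RegularLocal

variable [IsLocalRing R] {n : ℕ}

theorem RegLocal.height_maximalIdeal (h : RegLocal R n) : (maximalIdeal R).height = n := by
  have h2 := IsLocalRing.maximalIdeal_height_eq_ringKrullDim (R := R)
  rw [h.dim] at h2
  exact_mod_cast h2

/-- The unmixedness theorem (easy half): associated primes of a regular sequence of length `e` have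
height at most `e`. -/
theorem RegLocal.height_le_of_mem_associatedPrimes (h : RegLocal R n) {zs : List R}
    (hz : IsWeaklyRegular R zs) (hzm : ∀ r ∈ zs, r ∈ maximalIdeal R) {p : Ideal R}
    (hp : p ∈ associatedPrimes R (R ⧸ Ideal.ofList zs)) : p.height ≤ zs.length := by
  have := h.noeth
  obtain ⟨rs, hlen, hrm, hr⟩ := exists_isWeaklyRegular_of_regLocal h
  obtain ⟨q, hq⟩ := associatedPrimes.nonempty R R
  have hle : zs.length ≤ n := by
    have h1 := height_add_length_le (Q := maximalIdeal R) zs hzm hz hq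
      (IsLocalRing.le_maximalIdeal hq.1.ne_top)
    rw [h.height_maximalIdeal] at h1
    exact_mod_cast (le_add_self).trans h1
  obtain ⟨ws, hwl, hwm, hw⟩ := exists_extension (Q := maximalIdeal R) Ideal.IsPrime.ne_top' hz hzm
    hr hrm (l := n - zs.length) (by omega)
  have h1 := height_add_length_le (Q := maximalIdeal R) ws hwm hw
    (p := p) (by rwa [ofList_smul_top]) (IsLocalRing.le_maximalIdeal hp.1.ne_top)
  rw [h.height_maximalIdeal, hwl] at h1
  have hpf : p.height ≠ ⊤ := fun hh => by rw [hh] at h1; simp at h1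
  lift p.height to ℕ using hpf with a ha
  norm_cast at h1 ⊢
  omega

end RegularLocal

theorem length_le_height [IsNoetherianRing R] {zs : List R} (hz : IsWeaklyRegular R zs)
    {Q : Ideal R} [Q.IsPrime] (hzQ : ∀ r ∈ zs, r ∈ Q) : (zs.length : ℕ∞) ≤ Q.height := by
  obtain ⟨p, hp, hpQ, -⟩ := exists_associatedPrimes_between (Q := Q) (1 : R) (fun u hu => by
    have : u = 0 := by simpa using hu
    simp [this])
  exact le_add_self.trans (height_add_length_le zs hzQ hz hp hpQ)

end Chains

section CohenMacaulay

variable {R : Type u} [CommRing R]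

theorem isSMulRegular_of_notMem_associatedPrimes [IsNoetherianRing R] {M : Type u} [AddCommGroup M]
    [Module R M] {x : R} (hx : ∀ p ∈ associatedPrimes R M, x ∉ p) : IsSMulRegular M x := by
  rw [isSMulRegular_iff_right_eq_zero_of_smul]
  intro m hm
  by_contra hm0
  have h1 : x ∈ ⋃ p ∈ associatedPrimes R M, (p : Set R) := by
    rw [biUnion_associatedPrimes_eq_zero_divisors]
    exact ⟨m, hm0, hm⟩
  simp only [Set.mem_iUnion] at h1
  obtain ⟨p, hp, hxp⟩ := h1
  exact hx p hp hxp

theorem le_of_mem_associatedPrimes_quotient [IsNoetherianRing R] {I p : Ideal R}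
    (hp : p ∈ associatedPrimes R (R ⧸ I)) : I ≤ p := by
  obtain ⟨-, g, hg⟩ := mem_associatedPrimes_quotient_iff.1 hp
  exact fun r hr => (hg r).2 (Ideal.mul_mem_right _ _ hr)

/-- Prime avoidance for a coset `u + 𝔞` and finitely many incomparable primes. -/
theorem exists_sub_mem_notMem {𝔞 : Ideal R} {s : Set (Ideal R)} (hs : s.Finite)
    (hp : ∀ p ∈ s, p.IsPrime) (hinc : ∀ p ∈ s, ∀ q ∈ s, p ≤ q → p = q) (h𝔞 : ∀ p ∈ s, ¬ 𝔞 ≤ p)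
    (u : R) : ∃ u', u' - u ∈ 𝔞 ∧ ∀ p ∈ s, u' ∉ p := by
  classical
  have hs1 : {p ∈ s | u ∈ p}.Finite := hs.subset (Set.sep_subset _ _)
  have hs2 : {p ∈ s | u ∉ p}.Finite := hs.subset (Set.sep_subset _ _)
  by_cases hne : ∃ p₀ ∈ s, u ∈ p₀
  · obtain ⟨p₀, hp₀, hup₀⟩ := hne
    have key : ∀ p ∈ s, u ∈ p → ¬ 𝔞 * ∏ q ∈ hs2.toFinset, q ≤ p := by
      intro p hps hup hle
      have := hp p hps
      rcases (Ideal.IsPrime.mul_le this).1 hle with h | h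
      · exact h𝔞 p hps h
      · obtain ⟨q, hq, hqp⟩ := (Ideal.IsPrime.prod_le this).1 h
        rw [Set.Finite.mem_toFinset] at hq
        exact hq.2 ((hinc q hq.1 p hps hqp) ▸ hup)
    obtain ⟨a, ha, -, hav⟩ := exists_mem_notMem_of_finite (key p₀ hp₀ hup₀) hs1
      (fun p h => hp p h.1) (fun p h => key p h.1 h.2)
    refine ⟨u + a, by simpa using Ideal.mul_le_left ha, fun p hps hup => ?_⟩
    by_cases hu : u ∈ p
    · exact hav p ⟨hps, hu⟩ ((Ideal.add_mem_iff_right _ hu).1 hup)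
    · have h1 : a ∈ p := by
        have h2 : ∏ q ∈ hs2.toFinset, q ≤ p :=
          (Ideal.IsPrime.prod_le (hp p hps)).2 ⟨p, by simpa using ⟨hps, hu⟩, le_rfl⟩
        exact h2 (Ideal.mul_le_right ha)
      exact hu ((Ideal.add_mem_iff_left _ h1).1 hup)
  · push Not at hne
    exact ⟨u, by simp, hne⟩

variable [IsLocalRing R] {n : ℕ}

theorem exists_isWeaklyRegular_congr (h : RegLocal R n) {I : Ideal R} (hIm : I ≤ maximalIdeal R)
    {d : ℕ} (hI : ∀ Q : Ideal R, Q.IsPrime → I ≤ Q → (d : ℕ∞) ≤ Q.height) (us : List R) :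
    us.length ≤ d → (∀ r ∈ us, r ∈ I) →
    ∃ us' : List R, List.Forall₂ (fun u u' => u' - u ∈ maximalIdeal R * I) us us' ∧
      (∀ r ∈ us', r ∈ I) ∧ IsWeaklyRegular R us' := by
  have := h.noeth
  induction us using List.reverseRecOn with
  | nil => exact fun _ _ => ⟨[], by simp, by simp, by simp⟩
  | append_singleton us u ih =>
    intro hlen hmem
    simp only [List.length_append, List.length_singleton] at hlen
    obtain ⟨us', hus', hmem', hreg'⟩ := ih (by omega) (fun r hr => hmem r (by simp [hr]))
    have hl := hus'.length_eq
    have hht : ∀ p ∈ associatedPrimes R (R ⧸ Ideal.ofList us'), p.height = us'.length := by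
      intro p hp
      have := hp.1
      refine le_antisymm (h.height_le_of_mem_associatedPrimes hreg' (fun r hr => hIm (hmem' r hr))
        hp) (length_le_height hreg' fun r hr => ?_)
      exact le_of_mem_associatedPrimes_quotient hp (Ideal.subset_span hr)
    have hIp : ∀ p ∈ associatedPrimes R (R ⧸ Ideal.ofList us'), ¬ I ≤ p := by
      intro p hp hle
      have h1 := hI p hp.1 hle
      rw [hht p hp] at h1
      norm_cast at h1
      omega
    obtain ⟨u', hu', hu'p⟩ := exists_sub_mem_notMem (𝔞 := maximalIdeal R * I)
      (associatedPrimes.finite R (R ⧸ Ideal.ofList us')) (fun p hp => hp.1) (by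
        intro p hp q hq hpq
        by_contra hne
        have := hp.1
        have := hq.1
        have h1 := Ideal.height_add_one_le_of_lt_of_isPrime (lt_of_le_of_ne hpq hne)
        rw [hht p hp, hht q hq] at h1
        norm_cast at h1
        omega) (by
        intro p hp hle
        rcases (Ideal.IsPrime.mul_le hp.1).1 hle with h1 | h1
        · exact hIp p hp (hIm.trans h1)
        · exact hIp p hp h1) u
    have hmI : u' ∈ I := by
      have h1 := I.add_mem (Ideal.mul_le_right hu') (hmem u (by simp))
      simpa using h1
    refine ⟨us' ++ [u'], List.rel_append hus' (by simpa using hu'), ?_, ?_⟩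
    · intro r hr
      rcases List.mem_append.1 hr with hr | hr
      · exact hmem' r hr
      · rw [List.mem_singleton.1 hr]; exact hmI
    · rw [isWeaklyRegular_append_iff]
      refine ⟨hreg', ?_⟩
      rw [isWeaklyRegular_cons_iff, ofList_smul_top]
      exact ⟨isSMulRegular_of_notMem_associatedPrimes hu'p, by simp⟩

theorem exists_isWeaklyRegular_length_eq_height (h : RegLocal R n) {Q : Ideal R} [Q.IsPrime] {d : ℕ}
    (hd : (d : ℕ∞) ≤ Q.height) :
    ∃ rs : List R, rs.length = d ∧ (∀ r ∈ rs, r ∈ Q) ∧ IsWeaklyRegular R rs := by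
  obtain ⟨us', h1, h2, h3⟩ := exists_isWeaklyRegular_congr h (I := Q)
    (IsLocalRing.le_maximalIdeal Ideal.IsPrime.ne_top') (d := d)
    (fun P _ hP => hd.trans (Ideal.height_mono hP)) (List.replicate d 0) (by simp)
    (fun r hr => by rw [List.eq_of_mem_replicate hr]; exact zero_mem _)
  exact ⟨us', by simpa using h1.length_eq.symm, h2, h3⟩

theorem height_ne_top (h : RegLocal R n) {Q : Ideal R} [Q.IsPrime] : Q.height ≠ ⊤ := by
  have := h.noeth
  exact Ideal.height_ne_top Ideal.IsPrime.ne_top'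

/-- Regular local rings are catenary: a saturated inclusion of primes raises the height by one. -/
theorem height_le_add_one_of_covBy (h : RegLocal R n) {p Q : Ideal R} [p.IsPrime] [Q.IsPrime]
    (hpQ : p ≤ Q) (hcov : ∀ P : Ideal R, P.IsPrime → p < P → P ≤ Q → P = Q) :
    Q.height ≤ p.height + 1 := by
  have := h.noeth
  by_contra! hlt
  obtain ⟨a, ha⟩ := ENat.ne_top_iff_exists.1 (height_ne_top h (Q := p))
  rw [← ha] at hlt
  obtain ⟨zs, hzl, hzp, hz⟩ := exists_isWeaklyRegular_length_eq_height h (Q := p) (d := a) ha.le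
  obtain ⟨rs, hrl, hrQ, hr⟩ := exists_isWeaklyRegular_length_eq_height h (Q := Q) (d := a + 2) (by
    have := Order.add_one_le_of_lt hlt
    rw [add_assoc] at this
    exact_mod_cast this)
  obtain ⟨ws, hwl, hwQ, hw⟩ := exists_extension (Q := Q) Ideal.IsPrime.ne_top' hz
    (fun r hr => hpQ (hzp r hr)) hr hrQ (l := 2) (by omega)
  rw [ofList_smul_top] at hw
  have hpa : p ∈ associatedPrimes R (R ⧸ Ideal.ofList zs) := by
    obtain ⟨p', hp', hp'p, -⟩ := exists_associatedPrimes_between (M := R ⧸ Ideal.ofList zs) (Q := p)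
      (Ideal.Quotient.mk _ 1) (fun u hu => by
        have h1 : Ideal.Quotient.mk (Ideal.ofList zs) (u * 1) = 0 := hu
        rw [mul_one, Ideal.Quotient.eq_zero_iff_mem] at h1
        exact Ideal.span_le.2 hzp h1)
    have := hp'.1
    have h1 := length_le_height hz (Q := p') (fun r hr =>
      le_of_mem_associatedPrimes_quotient hp' (Ideal.subset_span hr))
    rcases hp'p.eq_or_lt with rfl | hlt
    · exact hp'
    · have h2 := Ideal.height_add_one_le_of_lt_of_isPrime hlt
      rw [← ha] at h2
      rw [hzl] at h1
      have h3 : (a : ℕ∞) + 1 ≤ a := (by gcongr : (a : ℕ∞) + 1 ≤ p'.height + 1).trans h2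
      norm_cast at h3
      omega
  obtain ⟨x, y, rfl⟩ : ∃ x y, ws = [x, y] := List.length_eq_two.1 hwl
  rw [isWeaklyRegular_cons_iff] at hw
  obtain ⟨p', hp', hle, hxp', hp'Q⟩ := exists_associatedPrimes_quotSMulTop
    (hwQ x (by simp)) hw.1 hpa hpQ
  have hp'prime := hp'.1
  have hxp : ∀ {M : Type u} [AddCommGroup M] [Module R M] {x : R} {p : Ideal R},
      p ∈ associatedPrimes R M → IsSMulRegular M x → x ∉ p := by
    intro M _ _ x p hp hreg hx
    obtain ⟨hpp, m, hm⟩ := mem_associatedPrimes_iff.1 hp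
    have hm0 : m = 0 := hreg (by simpa using (hm x).1 hx)
    exact hpp.ne_top ((Ideal.eq_top_iff_one _).2 ((hm 1).2 (by simp [hm0])))
  have h1 : p' = Q := hcov p' hp'prime
    (lt_of_le_of_ne hle (by rintro rfl; exact hxp hpa hw.1 hxp')) hp'Q
  exact hxp hp' (isWeaklyRegular_cons_iff _ _ _ |>.1 hw.2).1 (h1 ▸ hwQ y (by simp))

end CohenMacaulay

section FreeDimension

/-- `M` has a resolution of length at most `k` by finite free `R`-modules. -/
def FreeDimLE : ℕ → ∀ (M : Type u) [AddCommGroup M] [Module R M], Prop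
  | 0, M, _, _ => Module.Finite R M ∧ Module.Free R M
  | k + 1, M, _, _ => ∃ (m : ℕ) (f : (Fin m → R) →ₗ[R] M), Function.Surjective f ∧
      FreeDimLE k (LinearMap.ker f)

variable {R}

theorem FreeDimLE.of_equiv {k : ℕ} {M N : Type u} [AddCommGroup M] [Module R M] [AddCommGroup N]
    [Module R N] (e : M ≃ₗ[R] N) (h : FreeDimLE R k M) : FreeDimLE R k N := by
  cases k with
  | zero =>
    have := h.1
    have := h.2
    exact ⟨Module.Finite.equiv e, Module.Free.of_equiv e⟩
  | succ k =>
    obtain ⟨m, f, hf, hk⟩ := h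
    refine ⟨m, e.toLinearMap ∘ₗ f, e.surjective.comp hf, ?_⟩
    rwa [LinearEquiv.ker_comp]

theorem FreeDimLE.succ {k : ℕ} {F M : Type u} [AddCommGroup F] [Module R F] [AddCommGroup M]
    [Module R M] [Module.Free R F] [Module.Finite R F] (f : F →ₗ[R] M)
    (hf : Function.Surjective f) (h : FreeDimLE R k (LinearMap.ker f)) : FreeDimLE R (k + 1) M := by
  let b := (Module.Free.chooseBasis R F).reindex (Fintype.equivFin _)
  refine ⟨_, f ∘ₗ b.equivFun.symm.toLinearMap, hf.comp b.equivFun.symm.surjective, ?_⟩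
  rw [LinearMap.ker_comp]
  exact h.of_equiv (LinearEquiv.ofSubmodule' b.equivFun.symm _).symm

theorem FreeDimLE.finite_free_prod {k : ℕ} {F M : Type u} [AddCommGroup F] [Module R F]
    [AddCommGroup M] [Module R M] [Module.Free R F] [Module.Finite R F] (h : FreeDimLE R k M) :
    FreeDimLE R k (F × M) := by
  cases k with
  | zero =>
    have := h.1
    have := h.2
    exact ⟨inferInstance, inferInstance⟩
  | succ k =>
    obtain ⟨m, f, hf, hk⟩ := h
    refine FreeDimLE.succ (LinearMap.prodMap (LinearMap.id : F →ₗ[R] F) f)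
      (Function.Surjective.prodMap Function.surjective_id hf) (hk.of_equiv ?_)
    refine LinearEquiv.ofBijective
      (LinearMap.codRestrict _ ((LinearMap.inr R F (Fin m → R)).comp (LinearMap.ker f).subtype)
        fun c => ?_) ⟨fun a b hab => ?_, fun ⟨⟨a, b⟩, hab⟩ => ?_⟩
    · rw [LinearMap.mem_ker]
      exact Prod.ext rfl c.2
    · exact Subtype.ext (congrArg (fun t => t.1.2) hab)
    · rw [LinearMap.mem_ker] at hab
      have h1 : a = 0 := congrArg Prod.fst hab
      exact ⟨⟨b, congrArg Prod.snd hab⟩, Subtype.ext (Prod.ext h1.symm rfl)⟩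

theorem FreeDimLE.of_hasProjectiveDimensionLE [IsLocalRing R] [IsNoetherianRing R] {k : ℕ} :
    ∀ {M : Type u} [AddCommGroup M] [Module R M] [Module.Finite R M],
    HasProjectiveDimensionLE (ModuleCat.of R M) k → FreeDimLE R k M := by
  induction k with
  | zero =>
    intro M _ _ _ h
    have h1 := (projective_iff_hasProjectiveDimensionLE_zero _).2 h
    rw [← IsProjective.iff_projective] at h1
    exact ⟨inferInstance, Module.free_of_flat_of_isLocalRing⟩
  | succ k ih =>
    intro M _ _ _ h
    obtain ⟨m, f, hf⟩ := Module.Finite.exists_fin' R M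
    refine ⟨m, f, hf, ih ?_⟩
    have h1 := LinearMap.shortExact_shortComplexKer hf
    exact (h1.hasProjectiveDimensionLT_X₃_iff k (by
      dsimp [LinearMap.shortComplexKer]
      rw [← IsProjective.iff_projective]; infer_instance)).1 h

theorem FreeDimLE.of_quotSMulTop [IsLocalRing R] [IsNoetherianRing R] {r : R}
    (hr : r ∈ maximalIdeal R) (hrR : IsSMulRegular R r) {k : ℕ} :
    ∀ {M : Type u} [AddCommGroup M] [Module R M]
    [Module.Finite R M], IsSMulRegular M r →
    FreeDimLE (R ⧸ span {r}) k (QuotSMulTop r M) → FreeDimLE R k M := by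
  have hjac : r ∈ (⊥ : Ideal R).jacobson := IsLocalRing.maximalIdeal_le_jacobson _ hr
  induction k with
  | zero =>
    intro M _ _ _ hreg h
    have := Module.finitePresentation_of_finite R M
    exact ⟨inferInstance, (Module.free_quotSMulTop_iff_free R M hjac hreg).1 h.2⟩
  | succ k ih =>
    intro M _ _ _ hreg ⟨m, fb, hfb, hk⟩
    choose g hg using fun i : Fin m => Submodule.Quotient.mk_surjective _ (fb (Pi.single i 1))
    let f : (Fin m → R) →ₗ[R] M := Fintype.linearCombination R g
    let π : (Fin m → R) →ₗ[R] (Fin m → R ⧸ span {r}) :=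
      LinearMap.pi fun i => (Algebra.linearMap R (R ⧸ span {r})) ∘ₗ LinearMap.proj i
    have hπ : Function.Surjective π := by
      intro w
      choose v hv using fun i => Ideal.Quotient.mk_surjective (w i)
      exact ⟨v, funext hv⟩
    have hcomm : ∀ v, (Submodule.Quotient.mk (f v) : QuotSMulTop r M) = fb (π v) := by
      have : (Submodule.mkQ (r • (⊤ : Submodule R M))) ∘ₗ f = (fb.restrictScalars R) ∘ₗ π := by
        refine LinearMap.pi_ext' fun i => LinearMap.ext_ring ?_
        have h1 : π (Pi.single i 1) = Pi.single i 1 := by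
          ext j
          by_cases hj : j = i <;> simp [π, hj]
        simp [f, hg, h1, Fintype.linearCombination_apply_single]
      exact fun v => LinearMap.congr_fun this v
    have hf : Function.Surjective f := by
      rw [← LinearMap.range_eq_top, ← top_le_iff]
      refine Submodule.le_of_le_smul_of_le_jacobson_bot (I := span {r}) Module.Finite.fg_top
        (by simpa using hjac) fun y _ => ?_
      obtain ⟨w, hw⟩ := hfb (Submodule.Quotient.mk y)
      obtain ⟨v, rfl⟩ := hπ w
      rw [← hcomm, Submodule.Quotient.eq, ← Submodule.ideal_span_singleton_smul] at hw
      have := Submodule.sub_mem _ (Submodule.mem_sup_left (LinearMap.mem_range_self f v))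
        (Submodule.mem_sup_right (S := LinearMap.range f) hw)
      simpa using this
    let φ : LinearMap.ker f →ₗ[R] LinearMap.ker fb :=
      { toFun := fun v => ⟨π v, by rw [LinearMap.mem_ker, ← hcomm, v.2]; simp⟩
        map_add' := fun a b => Subtype.ext (map_add π _ _)
        map_smul' := fun a b => Subtype.ext (map_smul π _ _) }
    have hφ : Function.Surjective φ := by
      rintro ⟨w, hw⟩
      obtain ⟨v, rfl⟩ := hπ w
      rw [LinearMap.mem_ker, ← hcomm, Submodule.Quotient.mk_eq_zero,
        Submodule.mem_smul_pointwise_iff_exists] at hw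
      obtain ⟨y, -, hy⟩ := hw
      obtain ⟨u, rfl⟩ := hf y
      refine ⟨⟨v - r • u, by simp [← hy]⟩, Subtype.ext ?_⟩
      have h1 : π (r • u) = 0 := by
        ext i
        simp [π, Algebra.smul_def]
      simp [φ, h1]
    have hker : LinearMap.ker φ = r • ⊤ := by
      ext ⟨v, hv⟩
      rw [LinearMap.mem_ker, Submodule.mem_smul_pointwise_iff_exists]
      constructor
      · intro h
        have h1 : ∀ i, ∃ c, r * c = v i := by
          intro i
          have h2 : Ideal.Quotient.mk (span {r}) (v i) = 0 :=
            congrFun (congrArg Subtype.val h) i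
          rw [Ideal.Quotient.eq_zero_iff_mem, Ideal.mem_span_singleton] at h2
          exact h2.imp fun c hc => hc.symm
        choose c hc using h1
        have h3 : v = r • c := funext fun i => (hc i).symm
        refine ⟨⟨c, hreg ?_⟩, trivial, Subtype.ext h3.symm⟩
        rw [LinearMap.mem_ker, h3, map_smul] at hv
        simpa using hv
      · rintro ⟨u, -, hu⟩
        rw [← hu]
        refine Subtype.ext (funext fun i => ?_)
        change Ideal.Quotient.mk (span {r}) (r * u.1 i) = 0
        rw [Ideal.Quotient.eq_zero_iff_mem, Ideal.mem_span_singleton]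
        exact ⟨_, rfl⟩
    let e : QuotSMulTop r (LinearMap.ker f) ≃ₗ[R] LinearMap.ker fb :=
      (Submodule.quotEquivOfEq _ _ hker.symm).trans (φ.quotKerEquivOfSurjective hφ)
    have hregK : IsSMulRegular (LinearMap.ker f) r :=
      (IsSMulRegular.pi fun _ => hrR).submodule _ _
    exact ⟨m, f, hf, ih hregK
      (hk.of_equiv (e.extendScalarsOfSurjective Ideal.Quotient.mk_surjective).symm)⟩

/-- Over a regular local ring of dimension `n` every finite module has a finite free resolution of
length at most `n`. -/
theorem freeDimLE_of_regLocal {n : ℕ} : ∀ (R : Type u) [CommRing R] [IsLocalRing R],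
    RegLocal R n → ∀ (M : Type u) [AddCommGroup M] [Module R M] [Module.Finite R M],
    FreeDimLE R n M := by
  induction n with
  | zero =>
    intro R _ _ h M _ _ _
    have := h.noeth
    obtain ⟨S, hS, hSm⟩ := h.gens
    have h0 : S = ∅ := by simpa using hS
    have hm : maximalIdeal R = ⊥ := by rw [← hSm, h0]; simp
    have hfield := (IsLocalRing.isField_iff_maximalIdeal_eq).2 hm
    let := hfield.toField
    exact ⟨inferInstance, Module.Free.of_divisionRing R M⟩
  | succ n ih =>
    intro R _ _ h M _ _ _
    have := h.noeth
    have := h.isDomain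
    obtain ⟨r, hrm, hr2, hr0⟩ := h.exists_notMem (s := ∅) (by simp) (by simp) (by simp)
    have hr : r ≠ 0 := by rintro rfl; exact hr2 (zero_mem _)
    have hrR : IsSMulRegular R r := by
      rw [isSMulRegular_iff_right_eq_zero_of_smul]
      intro a ha
      simpa [hr] using ha
    have := isLocalRing_quotient (I := span {r}) ((span_singleton_le_iff_mem _).2 hrm)
    obtain ⟨m, f, hf⟩ := Module.Finite.exists_fin' R M
    have : Module.Finite (R ⧸ span {r}) (QuotSMulTop r (LinearMap.ker f)) :=
      Module.Finite.of_restrictScalars_finite R _ _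
    exact ⟨m, f, hf, FreeDimLE.of_quotSMulTop hrm hrR
      ((IsSMulRegular.pi fun _ => hrR).submodule _ _) (ih _ (h.quotient hrm hr2) _)⟩

end FreeDimension

section Resolutions

variable {R : Type u} [CommRing R] {M N X Y E : Type u} [AddCommGroup M] [Module R M]
  [AddCommGroup N] [Module R N] [AddCommGroup X] [Module R X] [AddCommGroup Y] [Module R Y]
  [AddCommGroup E] [Module R E]

/-- All terms of the resolution are finite free. -/
def FinFree (P : ProjRes R M) : Prop :=
  ∀ j, Module.Free R (P.F j) ∧ Module.Finite R (P.F j)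

/-- Prepend a surjection `F → M` to a resolution of its kernel. -/
noncomputable def consRes {F : Type u} [AddCommGroup F] [Module R F] [Module.Projective R F]
    (f : F →ₗ[R] M) (hf : Function.Surjective f) (P : ProjRes R (LinearMap.ker f)) :
    ProjRes R M where
  F := fun n => match n with
    | 0 => ModuleCat.of R F
    | n + 1 => P.F n
  d := fun n => match n with
    | 0 => (LinearMap.ker f).subtype ∘ₗ P.ε
    | n + 1 => P.d n
  ε := f
  projective := fun n => match n with
    | 0 => inferInstanceAs (Module.Projective R F)
    | n + 1 => P.projective n
  surj := hf
  exact0 := by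
    have h := LinearMap.range_comp_of_range_eq_top (f := P.ε) (LinearMap.ker f).subtype
      (LinearMap.range_eq_top.2 P.surj)
    rw [Submodule.range_subtype] at h
    exact h.symm
  exact := fun n => match n with
    | 0 => by
      have h := P.exact0
      rw [← LinearMap.ker_comp_of_ker_eq_bot (g := (LinearMap.ker f).subtype) P.ε
        (Submodule.ker_subtype _)] at h
      exact h
    | n + 1 => P.exact n

/-- Drop the first term of a resolution. -/
noncomputable def tailRes (P : ProjRes R M) : ProjRes R (LinearMap.ker P.ε) where
  F := fun n => P.F (n + 1)
  d := fun n => P.d (n + 1)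
  ε := LinearMap.codRestrict _ (P.d 0) fun v => by rw [P.exact0]; exact ⟨v, rfl⟩
  projective := fun n => P.projective (n + 1)
  surj := by
    rintro ⟨v, hv⟩
    rw [P.exact0] at hv
    obtain ⟨w, rfl⟩ := hv
    exact ⟨w, rfl⟩
  exact0 := by rw [LinearMap.ker_codRestrict]; exact P.exact 0
  exact := fun n => P.exact (n + 1)

/-- The resolution of the cokernel of `d_j` obtained by truncation. -/
noncomputable def shiftRes (P : ProjRes R M) (j : ℕ) :
    ProjRes R (P.F j ⧸ LinearMap.range (P.d j)) where
  F := fun n => P.F (j + n)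
  d := fun n => P.d (j + n)
  ε := (LinearMap.range (P.d j)).mkQ
  projective := fun n => P.projective (j + n)
  surj := Submodule.mkQ_surjective _
  exact0 := by rw [Submodule.ker_mkQ]; rfl
  exact := fun n => P.exact (j + n)

/-- Transport a resolution along an isomorphism. -/
noncomputable def equivRes (P : ProjRes R M) (e : M ≃ₗ[R] N) : ProjRes R N where
  F := P.F
  d := P.d
  ε := e.toLinearMap ∘ₗ P.ε
  projective := P.projective
  surj := e.surjective.comp P.surj
  exact0 := by rw [LinearEquiv.ker_comp]; exact P.exact0
  exact := P.exact

theorem exists_res_of_freeDimLE {k : ℕ} :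
    ∀ {M : Type u} [AddCommGroup M] [Module R M],
    FreeDimLE R k M → ∃ P : ProjRes R M, FinFree P ∧ ∀ j, k < j → Subsingleton (P.F j) := by
  induction k with
  | zero =>
    intro M _ _ h
    have := h.1
    have := h.2
    let Q : ProjRes R (LinearMap.ker (LinearMap.id : M →ₗ[R] M)) :=
      { F := fun _ => ModuleCat.of R PUnit.{u + 1}
        d := fun _ => 0
        ε := 0
        projective := fun _ => inferInstanceAs (Module.Projective R PUnit.{u + 1})
        surj := fun v => ⟨0, Subtype.ext v.2.symm⟩
        exact0 := Subsingleton.elim (α := Submodule R PUnit.{u + 1}) _ _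
        exact := fun _ => Subsingleton.elim (α := Submodule R PUnit.{u + 1}) _ _ }
    refine ⟨consRes LinearMap.id Function.surjective_id Q, fun j => ?_, fun j hj => ?_⟩
    · match j with
      | 0 => exact ⟨inferInstanceAs (Module.Free R M), inferInstanceAs (Module.Finite R M)⟩
      | j + 1 => exact ⟨inferInstanceAs (Module.Free R PUnit.{u + 1}),
          inferInstanceAs (Module.Finite R PUnit.{u + 1})⟩
    · match j with
      | j + 1 => exact inferInstanceAs (Subsingleton PUnit.{u + 1})
  | succ k ih =>
    intro M _ _ ⟨m, f, hf, hk⟩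
    obtain ⟨P, hP, hP'⟩ := ih hk
    refine ⟨consRes f hf P, fun j => ?_, fun j hj => ?_⟩
    · match j with
      | 0 => exact ⟨inferInstanceAs (Module.Free R (Fin m → R)),
          inferInstanceAs (Module.Finite R (Fin m → R))⟩
      | j + 1 => exact hP j
    · match j with
      | j + 1 => exact hP' j (by omega)

variable (R) in
/-- `X` is a `k`-th syzygy of `N` with respect to some resolution by finite free modules. -/
def SyzOf : ℕ → ∀ (N X : Type u) [AddCommGroup N] [Module R N] [AddCommGroup X] [Module R X], Prop
  | 0, N, X, _, _, _, _ => Nonempty (X ≃ₗ[R] N)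
  | k + 1, N, X, _, _, _, _ => ∃ (F : Type u) (_ : AddCommGroup F) (_ : Module R F)
      (f : F →ₗ[R] N), Module.Free R F ∧ Module.Finite R F ∧ Function.Surjective f ∧
      SyzOf k (LinearMap.ker f) X

theorem SyzOf.exists_res {k : ℕ} (Q : ProjRes R X) (hQ : FinFree Q) :
    ∀ {N : Type u} [AddCommGroup N] [Module R N], SyzOf R (k + 1) N X →
    ∃ P : ProjRes R N, FinFree P ∧ Nonempty (X ≃ₗ[R] LinearMap.range (P.d k)) := by
  induction k with
  | zero =>
    intro N _ _ ⟨F, _, _, f, _, _, hf, ⟨e⟩⟩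
    refine ⟨consRes f hf (equivRes Q e), fun j => ?_, ⟨e.trans (LinearEquiv.ofEq _ _ ?_)⟩⟩
    · match j with
      | 0 => exact ⟨inferInstanceAs (Module.Free R F), inferInstanceAs (Module.Finite R F)⟩
      | j + 1 => exact hQ j
    · exact (consRes f hf (equivRes Q e)).exact0
  | succ k ih =>
    intro N _ _ ⟨F, _, _, f, _, _, hf, h⟩
    obtain ⟨P, hP, ⟨e⟩⟩ := ih h
    refine ⟨consRes f hf P, fun j => ?_, ⟨e⟩⟩
    match j with
    | 0 => exact ⟨inferInstanceAs (Module.Free R F), inferInstanceAs (Module.Finite R F)⟩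
    | j + 1 => exact hP j

theorem SyzOf.isSyzygy {k : ℕ} (Q : ProjRes R X) (hQ : FinFree Q) (h : SyzOf R k N X) :
    IsSyzygy R k X := by
  cases k with
  | zero => trivial
  | succ k =>
    obtain ⟨P, hP, e⟩ := h.exists_res Q hQ
    exact ⟨N, _, _, P, hP, e⟩

theorem syzOf_res {k : ℕ} :
    ∀ {M : Type u} [AddCommGroup M] [Module R M] (P : ProjRes R M)
    (_ : FinFree P), SyzOf R k M (P.F k ⧸ LinearMap.range (P.d k)) := by
  induction k with
  | zero =>
    intro M _ _ P hP
    exact ⟨(Submodule.quotEquivOfEq _ _ P.exact0.symm).trans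
      (P.ε.quotKerEquivOfSurjective P.surj)⟩
  | succ k ih =>
    intro M _ _ P hP
    exact ⟨P.F 0, inferInstance, inferInstance, P.ε, (hP 0).1, (hP 0).2, P.surj,
      ih (tailRes P) fun j => hP (j + 1)⟩

theorem SyzOf.succ {d : ℕ} : ∀ {N X E : Type u} [AddCommGroup N] [Module R N]
    [AddCommGroup X] [Module R X] [AddCommGroup E] [Module R E] (i : X →ₗ[R] E) (π : E →ₗ[R] N),
    Function.Injective i → Function.Surjective π → LinearMap.range i = LinearMap.ker π →
    FreeDimLE R d E → SyzOf R d X Y → SyzOf R (d + 1) N Y := by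
  induction d with
  | zero =>
    intro N X E _ _ _ _ _ _ i π hi hπ hex hE ⟨e⟩
    exact ⟨E, _, _, π, hE.2, hE.1, hπ, ⟨e.trans ((LinearEquiv.ofInjective i hi).trans
      (LinearEquiv.ofEq _ _ hex))⟩⟩
  | succ d ih =>
    intro N X E _ _ _ _ _ _ i π hi hπ hex ⟨m, g, hg, hE⟩ ⟨F, _, _, f, _, _, hf, hX⟩
    obtain ⟨h, hh⟩ := Module.projective_lifting_property g (i ∘ₗ f) hg
    have hh' : ∀ a, g (h a) = i (f a) := LinearMap.congr_fun hh
    have hπi : ∀ a, π (i a) = 0 := fun a => by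
      rw [← LinearMap.mem_ker, ← hex]; exact ⟨a, rfl⟩
    refine ⟨Fin m → R, _, _, π ∘ₗ g, inferInstance, inferInstance, hπ.comp hg, ?_⟩
    let q : (F × LinearMap.ker g) →ₗ[R] LinearMap.ker (π ∘ₗ g) :=
      LinearMap.codRestrict _ (LinearMap.coprod h (LinearMap.ker g).subtype) fun c => by
        have := c.2.2
        rw [LinearMap.mem_ker] at this
        simp [hh', hπi, this]
    let j : LinearMap.ker f →ₗ[R] (F × LinearMap.ker g) :=
      LinearMap.prod (LinearMap.ker f).subtype (LinearMap.codRestrict _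
        (-(h ∘ₗ (LinearMap.ker f).subtype)) fun c => by
          have := c.2
          rw [LinearMap.mem_ker] at this
          simp [hh', this])
    refine ih j q (fun a b hab => Subtype.ext (congrArg Prod.fst hab)) ?_ ?_
      hE.finite_free_prod hX
    · rintro ⟨y, hy⟩
      have hy' : g y ∈ LinearMap.range i := by rw [hex]; exact hy
      obtain ⟨x, hx⟩ := hy'
      obtain ⟨a, rfl⟩ := hf x
      refine ⟨⟨a, ⟨y - h a, by simp [hh', hx]⟩⟩, Subtype.ext ?_⟩
      change h a + (y - h a) = y
      abel
    · ext ⟨a, b⟩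
      constructor
      · rintro ⟨c, hc⟩
        rw [← hc]
        refine Subtype.ext ?_
        change h c.1 + -h c.1 = 0
        abel
      · intro hab
        have h1 : h a + b = 0 := congrArg Subtype.val hab
        have h2 : f a = 0 := by
          apply hi
          rw [← hh', eq_neg_of_add_eq_zero_left h1, map_neg, b.2, map_zero, neg_zero]
        exact ⟨⟨a, h2⟩, Prod.ext rfl (Subtype.ext (neg_eq_of_add_eq_zero_right h1))⟩

theorem hasFiniteFreeResolution_quotient_range {P : ProjRes R M} (hP : FinFree P) {l : ℕ}
    (hl : ∀ j, l ≤ j → Subsingleton (P.F j)) (j : ℕ) :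
    HasFiniteFreeResolution R (P.F j ⧸ LinearMap.range (P.d j)) :=
  ⟨shiftRes P j, l, fun i => hP (j + i), fun i hi => hl (j + i) (by omega)⟩

theorem freeDimLE_quotient_ofList [IsLocalRing R] [IsNoetherianRing R] {zs : List R}
    (hz : IsWeaklyRegular R zs) (hzm : ∀ r ∈ zs, r ∈ maximalIdeal R) (t : ℕ) :
    FreeDimLE R zs.length 
      ((Fin (t + 1) → R) ⧸ Ideal.ofList zs • (⊤ : Submodule R (Fin (t + 1) → R))) := by
  apply FreeDimLE.of_hasProjectiveDimensionLE
  have h1 : IsWeaklyRegular (Fin (t + 1) → R) zs := by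
    have := hz.isWeaklyRegular_lTensor (M₂ := Fin (t + 1) → R)
    exact (LinearEquiv.isWeaklyRegular_congr (TensorProduct.rid R _) zs).1 this
  have h2 := ModuleCat.projectiveDimension_quotient_eq_add_length_of_isWeaklyRegular
    (ModuleCat.of R (Fin (t + 1) → R)) zs h1 hzm
  have : Projective (ModuleCat.of R (Fin (t + 1) → R)) := by
    rw [← IsProjective.iff_projective]; infer_instance
  have : Nontrivial (ModuleCat.of R (Fin (t + 1) → R)) :=
    inferInstanceAs (Nontrivial (Fin (t + 1) → R))
  rw [ModuleCat.projectiveDimension_eq_zero_of_projective (ModuleCat.of R (Fin (t + 1) → R)),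
    zero_add] at h2
  rw [← projectiveDimension_le_iff]
  exact h2.le

end Resolutions

section Homotopies

variable {R : Type u} [CommRing R] {M : Type u} [AddCommGroup M] [Module R M]

/-- A null-homotopy of multiplication by `u` on a resolution. -/
structure Htpy (P : ProjRes R M) (u : R) where
  h : ∀ n, P.F n →ₗ[R] P.F (n + 1)
  zero : ∀ v, P.d 0 (h 0 v) = u • v
  succ : ∀ n v, P.d (n + 1) (h (n + 1) v) + h n (P.d n v) = u • v

variable {P : ProjRes R M}

theorem exists_lift_of_range_le {F G H : Type u} [AddCommGroup F] [Module R F] [AddCommGroup G]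
    [Module R G] [AddCommGroup H] [Module R H] [Module.Projective R F] (f : G →ₗ[R] H)
    (φ : F →ₗ[R] H) (h : ∀ v, φ v ∈ LinearMap.range f) : ∃ ψ : F →ₗ[R] G, ∀ v, f (ψ v) = φ v := by
  obtain ⟨ψ, hψ⟩ := Module.projective_lifting_property f.rangeRestrict (φ.codRestrict _ h)
    f.surjective_rangeRestrict
  exact ⟨ψ, fun v => congrArg Subtype.val (LinearMap.congr_fun hψ v)⟩

theorem d_d (P : ProjRes R M) (n : ℕ) (v : P.F (n + 2)) : P.d n (P.d (n + 1) v) = 0 := by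
  rw [← LinearMap.mem_ker, P.exact n]; exact ⟨v, rfl⟩

theorem exists_htpy (P : ProjRes R M) {u : R} (hu : ∀ m : M, u • m = 0) : Nonempty (Htpy P u) := by
  have := P.projective
  obtain ⟨h0, hh0⟩ := exists_lift_of_range_le (P.d 0) (u • LinearMap.id : P.F 0 →ₗ[R] P.F 0)
    fun v => by rw [← P.exact0, LinearMap.mem_ker]; simp [hu]
  have hh0' : ∀ v, P.d 0 (h0 v) = u • v := hh0
  have step : ∀ n (h : {h : P.F n →ₗ[R] P.F (n + 1) // ∀ v, P.d n (h (P.d n v)) = u • P.d n v}),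
      ∃ h' : {h : P.F (n + 1) →ₗ[R] P.F (n + 2) //
        ∀ v, P.d (n + 1) (h (P.d (n + 1) v)) = u • P.d (n + 1) v},
        ∀ v, P.d (n + 1) (h'.1 v) + h.1 (P.d n v) = u • v := by
    rintro n ⟨h, hh⟩
    obtain ⟨h', hh'⟩ := exists_lift_of_range_le (P.d (n + 1))
      (u • LinearMap.id - h ∘ₗ P.d n : P.F (n + 1) →ₗ[R] P.F (n + 1))
      fun v => by rw [← P.exact, LinearMap.mem_ker]; simp [hh]
    have hh'' : ∀ v, P.d (n + 1) (h' v) = u • v - h (P.d n v) := hh'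
    exact ⟨⟨h', fun v => by rw [hh'', d_d, map_zero, sub_zero]⟩, fun v => by
      rw [hh'']; abel⟩
  choose st hst using step
  let s : ∀ n, {h : P.F n →ₗ[R] P.F (n + 1) // ∀ v, P.d n (h (P.d n v)) = u • P.d n v} :=
    fun n => Nat.rec ⟨h0, fun v => hh0' _⟩ (fun n h => st n h) n
  exact ⟨⟨fun n => (s n).1, hh0', fun n v => hst n (s n) v⟩⟩

/-- The sum of two null-homotopies. -/
def Htpy.add {u u' : R} (H : Htpy P u) (H' : Htpy P u') {w : R}
    (hw : u + u' = w) : Htpy P w where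
  h := fun n => H.h n + H'.h n
  zero := fun v => by simp [H.zero, H'.zero, ← hw, add_smul]
  succ := fun n v => by
    rw [← hw, add_smul, ← H.succ, ← H'.succ]
    simp only [LinearMap.add_apply, map_add]
    abel

/-- A multiple of a null-homotopy. -/
def Htpy.smul {u : R} (a : R) (H : Htpy P u) : Htpy P (a * u) where
  h := fun n => a • H.h n
  zero := fun v => by simp [H.zero, mul_smul]
  succ := fun n v => by
    rw [mul_smul, ← H.succ]
    simp

theorem exists_htpy_mem_smul (P : ProjRes R M) {𝔞 I : Ideal R} (hI : ∀ u ∈ I, ∀ m : M, u • m = 0)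
    {u : R} (hu : u ∈ 𝔞 * I) :
    ∃ H : Htpy P u, ∀ n v, H.h n v ∈ 𝔞 • (⊤ : Submodule R (P.F (n + 1))) := by
  refine Submodule.mul_induction_on hu (fun a ha b hb => ?_) ?_
  · obtain ⟨H⟩ := exists_htpy P (hI b hb)
    exact ⟨H.smul a, fun n v => Submodule.smul_mem_smul ha trivial⟩
  · rintro a b ⟨H, hH⟩ ⟨H', hH'⟩
    exact ⟨H.add H' rfl, fun n v => add_mem (hH n v) (hH' n v)⟩

/-- Elements obtained from degree zero by applying null-homotopies of the scalars in a list. -/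
inductive HIter (P : ProjRes R M) : ∀ n : ℕ, List R → P.F n → Prop
  | base (f : P.F 0) : HIter P 0 [] f
  | step {n : ℕ} {us : List R} {f : P.F n} {u : R} (H : Htpy P u) (hf : HIter P n us f) :
      HIter P (n + 1) (u :: us) (H.h n f)

theorem HIter.length_eq {n : ℕ} {us : List R} {y : P.F n} (h : HIter P n us y) :
    us.length = n := by
  induction h with
  | base f => rfl
  | step H hf ih => simp [ih]

theorem map_mem_smul_top {F G : Type*} [AddCommGroup F] [Module R F] [AddCommGroup G] [Module R G]
    (f : F →ₗ[R] G) {J : Ideal R} {v : F} (hv : v ∈ J • (⊤ : Submodule R F)) :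
    f v ∈ J • (⊤ : Submodule R G) := by
  have := Submodule.mem_map_of_mem (f := f) hv
  rw [Submodule.map_smul''] at this
  exact Submodule.smul_mono le_rfl le_top this

theorem HIter.d_mem {n : ℕ} {us : List R} {y : P.F n} (h : HIter P n us y) :
    match n, y with
    | 0, _ => True
    | n + 1, y => P.d n y ∈ Ideal.ofList us • (⊤ : Submodule R (P.F n)) := by
  induction h with
  | base f => trivial
  | @step n us f u H hf ih =>
    change P.d n (H.h n f) ∈ _
    rw [Ideal.ofList_cons, Submodule.sup_smul]
    have hu : u • f ∈ span {u} • (⊤ : Submodule R (P.F n)) :=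
      Submodule.smul_mem_smul (Ideal.mem_span_singleton_self u) trivial
    match n, f, hf, ih with
    | 0, f, hf, ih =>
      rw [H.zero]
      exact Submodule.mem_sup_left hu
    | n + 1, f, hf, ih =>
      rw [eq_sub_of_add_eq (H.succ n f)]
      exact Submodule.sub_mem _ (Submodule.mem_sup_left hu)
        (Submodule.mem_sup_right (map_mem_smul_top _ ih))

theorem HIter.smul_mem {n : ℕ} {us : List R} {y : P.F n} (h : HIter P n us y) {z : R}
    (hz : ∀ m : M, z • m = 0) :
    z • y ∈ LinearMap.range (P.d n) ⊔ Ideal.ofList us • (⊤ : Submodule R (P.F n)) := by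
  obtain ⟨H⟩ := exists_htpy P hz
  match n, y, h with
  | 0, y, h => exact Submodule.mem_sup_left ⟨_, H.zero y⟩
  | n + 1, y, h =>
    rw [← H.succ]
    exact Submodule.add_mem_sup ⟨_, rfl⟩ (map_mem_smul_top _ h.d_mem)

theorem HIter.exists_congr {𝔞 I : Ideal R} (hI : ∀ u ∈ I, ∀ m : M, u • m = 0) {n : ℕ}
    {us : List R} {y : P.F n} (h : HIter P n us y) :
    ∀ {us' : List R}, List.Forall₂ (fun u u' => u' - u ∈ 𝔞 * I) us us' →
    ∃ y', HIter P n us' y' ∧ y' - y ∈ 𝔞 • (⊤ : Submodule R (P.F n)) := by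
  induction h with
  | base f =>
    intro us' h
    cases h
    exact ⟨f, .base f, by simp⟩
  | @step n us f u H hf ih =>
    intro us' h
    cases h with
    | @cons _ u' _ us' hu hus =>
      obtain ⟨f', hf', hff'⟩ := ih hus
      obtain ⟨H'', hH''⟩ := exists_htpy_mem_smul P hI hu
      have hu' : u + (u' - u) = u' := by ring
      obtain ⟨H', hH'⟩ : ∃ H' : Htpy P u', ∀ n v, H'.h n v = H.h n v + H''.h n v :=
        ⟨H.add H'' hu', fun n v => rfl⟩
      refine ⟨_, .step H' hf', ?_⟩
      have : H'.h n f' - H.h n f = H.h n (f' - f) + H''.h n f' := by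
        rw [hH', map_sub]; abel
      rw [this]
      exact add_mem (map_mem_smul_top _ hff') (hH'' _ _)

theorem isSMulRegular_quotient_of_append {F : Type u} [AddCommGroup F] [Module R F]
    [Module.Free R F] [Module.Finite R F] {zs : List R} {z : R} (hz : IsWeaklyRegular R (zs ++ [z]))
    {v : F} (hv : z • v ∈ Ideal.ofList zs • (⊤ : Submodule R F)) :
    v ∈ Ideal.ofList zs • (⊤ : Submodule R F) := by
  have h1 : IsWeaklyRegular F (zs ++ [z]) :=
    (LinearEquiv.isWeaklyRegular_congr (TensorProduct.rid R _) _).1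
      (hz.isWeaklyRegular_lTensor (M₂ := F))
  rw [isWeaklyRegular_append_iff, isWeaklyRegular_cons_iff] at h1
  have h2 := h1.2.1.right_eq_zero_of_smul (x := Submodule.Quotient.mk v)
    (by rwa [← Submodule.Quotient.mk_smul, Submodule.Quotient.mk_eq_zero])
  rwa [Submodule.Quotient.mk_eq_zero] at h2

theorem ofList_append_singleton_smul_top {F : Type u} [AddCommGroup F] [Module R F] (zs : List R)
    (z : R) : Ideal.ofList (zs ++ [z]) • (⊤ : Submodule R F) =
      Ideal.ofList zs • ⊤ ⊔ z • ⊤ := by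
  rw [Ideal.ofList_append, Submodule.sup_smul, Ideal.ofList_singleton,
    Submodule.ideal_span_singleton_smul]

/-- Reduction modulo a regular sequence preserves exactness in high degrees. -/
theorem mem_range_sup_of_d_mem (hP : FinFree P) {zs : List R} (hz : IsWeaklyRegular R zs) :
    ∀ {j : ℕ}, zs.length ≤ j → ∀ {v : P.F (j + 1)},
    P.d j v ∈ Ideal.ofList zs • (⊤ : Submodule R (P.F j)) →
    v ∈ LinearMap.range (P.d (j + 1)) ⊔ Ideal.ofList zs • (⊤ : Submodule R (P.F (j + 1))) := by
  induction zs using List.reverseRecOn with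
  | nil =>
    intro j _ v hv
    refine Submodule.mem_sup_left ?_
    rw [← P.exact]
    simpa using hv
  | append_singleton zs z ih =>
    intro j hj v hv
    have hz' := ((isWeaklyRegular_append_iff _ _ _).1 hz).1
    simp only [List.length_append, List.length_singleton] at hj
    rw [ofList_append_singleton_smul_top] at hv ⊢
    obtain ⟨b, hb, zw, hzw, hv⟩ := Submodule.mem_sup.1 hv
    obtain ⟨w, -, rfl⟩ := (Submodule.mem_smul_pointwise_iff_exists _ _ _).1 hzw
    obtain ⟨j, rfl⟩ : ∃ k, j = k + 1 := ⟨j - 1, by omega⟩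
    have := (hP j).1
    have := (hP j).2
    have h1 : z • P.d j w ∈ Ideal.ofList zs • (⊤ : Submodule R (P.F j)) := by
      have h2 : P.d j b + z • P.d j w = 0 := by rw [← map_smul, ← map_add, hv, d_d]
      rw [eq_neg_of_add_eq_zero_right h2]
      exact neg_mem (map_mem_smul_top _ hb)
    obtain ⟨_, ⟨w', rfl⟩, b', hb', hw⟩ := Submodule.mem_sup.1
      (ih hz' (by omega) (isSMulRegular_quotient_of_append hz h1))
    have h3 := ih hz' (j := j + 1) (by omega) (v := v - z • w') (by
      rw [map_sub, ← hv, ← hw, map_smul]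
      have : b + z • (P.d (j + 1) w' + b') - z • P.d (j + 1) w' = b + z • b' := by
        rw [smul_add]; abel
      rw [this]
      exact add_mem hb (Submodule.smul_mem _ _ hb'))
    have h4 : v = (v - z • w') + z • w' := by abel
    rw [h4, ← sup_assoc]
    exact Submodule.add_mem_sup h3 (Submodule.smul_mem_pointwise_smul _ _ _ trivial)

/-- A generator of the annihilator of `I` detected in the `e`-th syzygy modulo a regular sequence of
length `e` inside `I`. -/
theorem exists_forall_smul_mem_iff {I : Ideal R} {P : ProjRes R (R ⧸ I)} (hP : FinFree P)
    {zs : List R} (hz : IsWeaklyRegular R zs) : (∀ r ∈ zs, r ∈ I) →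
    ∃ f : P.F zs.length, ∀ a : R, a • f ∈ LinearMap.range (P.d zs.length) ⊔
      Ideal.ofList zs • (⊤ : Submodule R (P.F zs.length)) ↔ a ∈ I := by
  suffices H : ∀ e, zs.length = e → (∀ r ∈ zs, r ∈ I) →
      ∃ f : P.F e, ∀ a : R, a • f ∈ LinearMap.range (P.d e) ⊔
        Ideal.ofList zs • (⊤ : Submodule R (P.F e)) ↔ a ∈ I from H _ rfl
  induction zs using List.reverseRecOn with
  | nil =>
    rintro e rfl -
    obtain ⟨f, hf⟩ := P.surj (Ideal.Quotient.mk I 1)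
    refine ⟨f, fun a => ?_⟩
    change a • f ∈ LinearMap.range (P.d 0) ⊔ Ideal.ofList [] • (⊤ : Submodule R (P.F 0)) ↔ _
    rw [Ideal.ofList_nil, Submodule.bot_smul, sup_bot_eq, ← P.exact0, LinearMap.mem_ker, map_smul,
      hf, ← Ideal.Quotient.eq_zero_iff_mem]
    change Ideal.Quotient.mk I (a * 1) = 0 ↔ _
    rw [mul_one]
  | append_singleton zs z ih =>
    intro e he hI
    obtain ⟨e, rfl⟩ : ∃ k, e = k + 1 := ⟨e - 1, by simp at he; omega⟩
    have hel : zs.length = e := by simpa using he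
    have hz' := ((isWeaklyRegular_append_iff _ _ _).1 hz).1
    obtain ⟨f, hf⟩ := ih hz' e hel fun r hr => hI r (by simp [hr])
    have := (hP e).1
    have := (hP e).2
    obtain ⟨_, ⟨f', rfl⟩, b, hb, hzf⟩ := Submodule.mem_sup.1 ((hf z).2 (hI z (by simp)))
    refine ⟨f', fun a => ?_⟩
    rw [ofList_append_singleton_smul_top, ← sup_assoc]
    constructor
    · intro h
      obtain ⟨x, hx, zw, hzw, hv⟩ := Submodule.mem_sup.1 h
      obtain ⟨_, ⟨w, rfl⟩, b', hb', rfl⟩ := Submodule.mem_sup.1 hx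
      obtain ⟨w', -, rfl⟩ := (Submodule.mem_smul_pointwise_iff_exists _ _ _).1 hzw
      have h1 := congrArg (P.d e) hv
      simp only [map_add, map_smul, d_d, zero_add] at h1
      have h2 : z • (a • f - P.d e w') = P.d e b' + a • b := by
        rw [smul_sub, smul_comm z a, ← hzf, smul_add, ← h1]
        abel
      have h3 := isSMulRegular_quotient_of_append hz (v := a • f - P.d e w')
        (h2 ▸ add_mem (map_mem_smul_top _ hb') (Submodule.smul_mem _ _ hb))
      refine (hf a).1 ?_
      have h4 : a • f = P.d e w' + (a • f - P.d e w') := by abel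
      rw [h4]
      exact Submodule.add_mem_sup ⟨_, rfl⟩ h3
    · intro ha
      obtain ⟨_, ⟨w, rfl⟩, b', hb', hw⟩ := Submodule.mem_sup.1 ((hf a).2 ha)
      have h1 := mem_range_sup_of_d_mem hP hz' hel.le (v := a • f' - z • w) (by
        have h2 : P.d e (a • f' - z • w) = z • b' - a • b := by
          rw [map_sub, map_smul, map_smul, eq_sub_of_add_eq hzf, eq_sub_of_add_eq hw, smul_sub,
            smul_sub, smul_comm z a]
          abel
        rw [h2]
        exact sub_mem (Submodule.smul_mem _ _ hb') (Submodule.smul_mem _ _ hb))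
      have h4 : a • f' = (a • f' - z • w) + z • w := by abel
      rw [h4]
      exact Submodule.add_mem_sup h1 (Submodule.smul_mem_pointwise_smul _ _ _ trivial)

end Homotopies

section LocallyFree

variable {R : Type u} [CommRing R] {M : Type u} [AddCommGroup M] [Module R M]

theorem apply_mem_of_mem_smul_top {F : Type*} [AddCommGroup F] [Module R F] (f : F →ₗ[R] R)
    {J : Ideal R} {v : F} (hv : v ∈ J • (⊤ : Submodule R F)) : f v ∈ J := by
  simpa using map_mem_smul_top f hv

theorem mem_sup_smul_top_of_mkQ_mem {F : Type*} [AddCommGroup F] [Module R F] {J : Ideal R}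
    {N : Submodule R F} {v : F} (h : N.mkQ v ∈ J • (⊤ : Submodule R (F ⧸ N))) :
    v ∈ N ⊔ J • (⊤ : Submodule R F) := by
  rw [← N.range_mkQ, ← Submodule.map_top, ← Submodule.map_smul''] at h
  obtain ⟨w, hw, hwv⟩ := h
  refine Submodule.mem_sup.2 ⟨v - w, ?_, w, hw, by abel⟩
  rw [← N.ker_mkQ, LinearMap.mem_ker, map_sub, hwv, sub_self]

theorem mem_smul_top_of_forall_apply_mem {F : Type*} [AddCommGroup F] [Module R F]
    [Module.Free R F] {J : Ideal R} {v : F} (h : ∀ f : F →ₗ[R] R, f v ∈ J) :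
    v ∈ J • (⊤ : Submodule R F) := by
  let b := Module.Free.chooseBasis R F
  rw [← b.linearCombination_repr v, Finsupp.linearCombination_apply]
  exact Submodule.sum_mem _ fun i _ => Submodule.smul_mem_smul (h (b.coord i)) trivial

theorem exists_retraction [IsLocalRing R] {S F : Type u} [AddCommGroup S] [Module R S]
    [AddCommGroup F] [Module R F] [Module.Finite R S] [Module.Finite R F] [Module.Free R F]
    (ι : S →ₗ[R] F) (h : ∀ v, ι v ∈ maximalIdeal R • (⊤ : Submodule R F) →
      v ∈ maximalIdeal R • (⊤ : Submodule R S)) : ∃ ρ : F →ₗ[R] S, ρ ∘ₗ ι = LinearMap.id := by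
  rw [IsLocalRing.split_injective_iff_lTensor_residueField_injective, injective_iff_map_eq_zero]
  intro x hx
  let eS := TensorProduct.quotTensorEquivQuotSMul S (maximalIdeal R)
  let eF := TensorProduct.quotTensorEquivQuotSMul F (maximalIdeal R)
  obtain ⟨y, rfl⟩ := eS.symm.surjective x
  obtain ⟨v, rfl⟩ := Submodule.Quotient.mk_surjective _ y
  have h1 : eS.symm (Submodule.Quotient.mk v) = (1 : R ⧸ maximalIdeal R) ⊗ₜ[R] v := rfl
  have h2 : eF ((1 : R ⧸ maximalIdeal R) ⊗ₜ[R] ι v) = 0 := by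
    have h3 : (1 : R ⧸ maximalIdeal R) ⊗ₜ[R] ι v = 0 := hx
    rw [h3, map_zero]
  have h4 : (1 : R ⧸ maximalIdeal R) ⊗ₜ[R] ι v = eF.symm (Submodule.Quotient.mk (ι v)) := rfl
  rw [h4, LinearEquiv.apply_symm_apply, Submodule.Quotient.mk_eq_zero] at h2
  rw [(Submodule.Quotient.mk_eq_zero _).2 (h v h2)]
  exact map_zero eS.symm

theorem free_quotient_range_of_retraction [IsLocalRing R] {S F : Type u} [AddCommGroup S]
    [Module R S] [AddCommGroup F] [Module R F] [Module.Finite R F] [Module.Free R F]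
    (ι : S →ₗ[R] F) (h : ∃ ρ : F →ₗ[R] S, ρ ∘ₗ ι = LinearMap.id) :
    Module.Free R (F ⧸ LinearMap.range ι) := by
  obtain ⟨ρ, hρ⟩ := h
  have hρ' : ∀ v, ρ (ι v) = v := LinearMap.congr_fun hρ
  have : Module.Projective R (F ⧸ LinearMap.range ι) := by
    refine Module.Projective.of_split ((LinearMap.range ι).liftQ (LinearMap.id - ι ∘ₗ ρ) ?_)
      (LinearMap.range ι).mkQ ?_
    · rintro _ ⟨v, rfl⟩
      simp [hρ']
    · refine Submodule.linearMap_qext _ (LinearMap.ext fun v => ?_)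
      simp
  exact Module.free_of_flat_of_isLocalRing

theorem free_quotient_range [IsLocalRing R] {P : ProjRes R M} (hP : FinFree P)
    {l : ℕ} (hl : ∀ j, l ≤ j → Subsingleton (P.F j)) {zs : List R} (hz : IsWeaklyRegular R zs)
    {g : R} (hg : ∀ r, r ∈ maximalIdeal R ↔ r * g ∈ Ideal.ofList zs) {i : ℕ}
    (hi : zs.length ≤ i) : Module.Free R (P.F i ⧸ LinearMap.range (P.d i)) := by
  obtain ⟨k, hk⟩ : ∃ k, l ≤ i + k := ⟨l, by omega⟩
  induction k generalizing i with
  | zero =>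
    have := hl i (by omega)
    infer_instance
  | succ k ih =>
    have hfree := ih (i := i + 1) (by omega) (by omega)
    have := (hP i).1
    have := (hP i).2
    have := (hP (i + 1)).2
    let ι := (LinearMap.range (P.d (i + 1))).liftQ (P.d i) (by rw [← P.exact])
    have hι : LinearMap.range ι = LinearMap.range (P.d i) := Submodule.range_liftQ _ _ _
    rw [← hι]
    refine free_quotient_range_of_retraction ι (exists_retraction ι fun v hv => ?_)
    obtain ⟨w, rfl⟩ := Submodule.Quotient.mk_surjective _ v
    have h1 : P.d i (g • w) ∈ Ideal.ofList zs • (⊤ : Submodule R (P.F i)) := by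
      rw [map_smul]
      refine Submodule.smul_induction_on hv (fun r hr x _ => ?_) (fun x y hx hy => ?_)
      · rw [smul_smul, mul_comm]
        exact Submodule.smul_mem_smul ((hg r).1 hr) trivial
      · rw [smul_add]
        exact add_mem hx hy
    obtain ⟨_, ⟨x, rfl⟩, b, hb, hxb⟩ := Submodule.mem_sup.1 (mem_range_sup_of_d_mem hP hz hi h1)
    refine mem_smul_top_of_forall_apply_mem fun f => (hg _).2 ?_
    have h2 : (Submodule.Quotient.mk (g • w) : P.F (i + 1) ⧸ LinearMap.range (P.d (i + 1))) =
        Submodule.Quotient.mk b := by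
      rw [Submodule.Quotient.eq, ← hxb]
      exact ⟨x, by abel⟩
    have h3 : f (Submodule.Quotient.mk b) ∈ Ideal.ofList zs :=
      apply_mem_of_mem_smul_top (f ∘ₗ (LinearMap.range (P.d (i + 1))).mkQ) hb
    rwa [← h2, Submodule.Quotient.mk_smul, map_smul, smul_eq_mul, mul_comm] at h3

/-- The localization of a resolution at a prime ideal. -/
noncomputable def locRes (P : ProjRes R M) (p : Ideal R) [p.IsPrime] (hP : FinFree P) :
    ProjRes (Localization.AtPrime p) (LocalizedModule p.primeCompl (P.F 0) ⧸
      LinearMap.range (LocalizedModule.map p.primeCompl (P.d 0))) where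
  F := fun n => ModuleCat.of _ (LocalizedModule p.primeCompl (P.F n))
  d := fun n => LocalizedModule.map p.primeCompl (P.d n)
  ε := Submodule.mkQ _
  projective := fun n => by
    have := (hP n).1
    have := (hP n).2
    exact inferInstanceAs (Module.Projective _ (LocalizedModule p.primeCompl (P.F n)))
  surj := Submodule.mkQ_surjective _
  exact0 := Submodule.ker_mkQ _
  exact := fun n => by
    have h := LocalizedModule.map_exact p.primeCompl (P.d (n + 1)) (P.d n)
      (LinearMap.exact_iff.2 (P.exact n))
    exact LinearMap.exact_iff.1 h

theorem mk'_mem_ofList_map_iff {p : Ideal R} [p.IsPrime] {zs : List R} (r : R)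
    (s : p.primeCompl) : IsLocalization.mk' (Localization.AtPrime p) r s ∈
      Ideal.ofList (zs.map (algebraMap R (Localization.AtPrime p))) ↔
        ∃ u ∉ p, u * r ∈ Ideal.ofList zs := by
  rw [← Ideal.map_ofList, IsLocalization.mk'_mem_map_algebraMap_iff p.primeCompl]
  simp [Ideal.mem_primeCompl_iff]

theorem mem_maximalIdeal_iff_mul_mem {p : Ideal R} [p.IsPrime] {zs : List R} {g : R}
    (hg : ∀ r, r ∈ p ↔ r * g ∈ Ideal.ofList zs) (r : Localization.AtPrime p) :
    r ∈ maximalIdeal (Localization.AtPrime p) ↔ r * algebraMap R (Localization.AtPrime p) g ∈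
      Ideal.ofList (zs.map (algebraMap R (Localization.AtPrime p))) := by
  obtain ⟨r, s, rfl⟩ := IsLocalization.exists_mk'_eq p.primeCompl r
  rw [IsLocalization.AtPrime.mk'_mem_maximal_iff _ p]
  have h1 : IsLocalization.mk' (Localization.AtPrime p) r s * algebraMap R _ g =
      IsLocalization.mk' (Localization.AtPrime p) (r * g) s := by
    rw [mul_comm, IsLocalization.mul_mk'_eq_mk'_of_mul, mul_comm]
  rw [h1, mk'_mem_ofList_map_iff]
  constructor
  · intro h
    exact ⟨1, (Ideal.ne_top_iff_one p).1 Ideal.IsPrime.ne_top', by simpa using (hg r).1 h⟩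
  · rintro ⟨u, hu, h⟩
    rw [← mul_assoc, ← hg] at h
    exact (Ideal.IsPrime.mem_or_mem ‹p.IsPrime› h).resolve_left hu

theorem exists_functional [IsDomain R] {P : ProjRes R M} (hP : FinFree P)
    {l : ℕ} (hl : ∀ j, l ≤ j → Subsingleton (P.F j)) {zs : List R} (hz : IsWeaklyRegular R zs)
    {p : Ideal R} [p.IsPrime] {g : R} (hg : ∀ r, r ∈ p ↔ r * g ∈ Ideal.ofList zs)
    {z : P.F zs.length} (hzu : ∀ u, u ∉ p → u • z ∉ LinearMap.range (P.d zs.length) ⊔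
      Ideal.ofList zs • (⊤ : Submodule R (P.F zs.length))) :
    ∃ θ : P.F zs.length →ₗ[R] R, (∀ v, θ (P.d zs.length v) = 0) ∧ θ z ∉ Ideal.ofList zs := by
  let A := Localization.AtPrime p
  let P' := locRes P p hP
  have hP' : FinFree P' := fun j => by
    have := (hP j).1
    have := (hP j).2
    have h1 : Module.Free A (LocalizedModule p.primeCompl (P.F j)) :=
      Module.free_of_isLocalizedModule p.primeCompl
        (LocalizedModule.mkLinearMap p.primeCompl (P.F j))
    exact ⟨h1,
      inferInstanceAs (Module.Finite (Localization _) (LocalizedModule p.primeCompl (P.F j)))⟩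
  have hl' : ∀ j, l ≤ j → Subsingleton (P'.F j) := fun j hj => by
    have := hl j hj
    exact inferInstanceAs (Subsingleton (LocalizedModule p.primeCompl (P.F j)))
  have hz' : IsWeaklyRegular A (zs.map (algebraMap R A)) := hz.of_flat
  have hmem := fun (r : R) (s : p.primeCompl) => mk'_mem_ofList_map_iff (zs := zs) r s
  have hg' := mem_maximalIdeal_iff_mul_mem hg
  have hfree := free_quotient_range hP' hl' hz' hg' (i := zs.length) (by simp)
  let loc := LocalizedModule.mkLinearMap p.primeCompl (P.F zs.length)
  let mk' := (LinearMap.range (P'.d zs.length)).mkQ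
  have hz1 : mk' (loc z) ∉ Ideal.ofList (zs.map (algebraMap R A)) •
      (⊤ : Submodule A (P'.F zs.length ⧸ LinearMap.range (P'.d zs.length))) := by
    have h1 : LinearMap.range (P'.d zs.length) ⊔ Ideal.ofList (zs.map (algebraMap R A)) •
        (⊤ : Submodule A (P'.F zs.length)) ≤ (LinearMap.range (P.d zs.length) ⊔
          Ideal.ofList zs • (⊤ : Submodule R (P.F zs.length))).localized p.primeCompl := by
      refine sup_le ?_ (Submodule.smul_le.2 fun r hr v _ => ?_)
      · rintro _ ⟨v, rfl⟩
        induction v using LocalizedModule.induction_on with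
        | h v t =>
          refine ⟨P.d zs.length v, Submodule.mem_sup_left ⟨v, rfl⟩, t, ?_⟩
          rw [← IsLocalizedModule.mk_eq_mk']
          exact (LocalizedModule.map_mk p.primeCompl (P.d zs.length) v t).symm
      · obtain ⟨a, t, rfl⟩ := IsLocalization.exists_mk'_eq p.primeCompl r
        obtain ⟨u, hu, hua⟩ := (hmem a t).1 hr
        clear hr
        induction v using LocalizedModule.induction_on with
        | h v t' =>
          refine ⟨(u * a) • v, Submodule.mem_sup_right (Submodule.smul_mem_smul hua trivial),
            ⟨u, hu⟩ * (t * t'), ?_⟩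
          rw [← IsLocalizedModule.mk_eq_mk', mul_smul]
          refine (LocalizedModule.mk_cancel_common_left ⟨u, hu⟩ (t * t') (a • v)).trans ?_
          rw [← Localization.mk_eq_mk']
          exact (LocalizedModule.mk_smul_mk a v t t').symm
    intro h
    obtain ⟨w, hw, t, hwt⟩ := h1 (mem_sup_smul_top_of_mkQ_mem h)
    rw [← IsLocalizedModule.mk_eq_mk'] at hwt
    obtain ⟨c, hc⟩ := LocalizedModule.mk_eq.1 (hwt.trans (LocalizedModule.mkLinearMap_apply _ _ z))
    refine hzu (c * t) (c * t).2 ?_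
    have h3 : ((c : R) * t) • z = (c : R) • w := by
      have h4 : c • (1 : p.primeCompl) • w = c • t • z := hc
      rw [one_smul] at h4
      rw [mul_smul]
      exact h4.symm
    rw [h3]
    exact Submodule.smul_mem _ _ hw
  obtain ⟨θ', hθ'⟩ : ∃ θ' : (P'.F zs.length ⧸ LinearMap.range (P'.d zs.length)) →ₗ[A] A,
      θ' (mk' (loc z)) ∉ Ideal.ofList (zs.map (algebraMap R A)) := by
    by_contra! h
    exact hz1 (mem_smul_top_of_forall_apply_mem h)
  let θ'' : LocalizedModule p.primeCompl (P.F zs.length) →ₗ[A] A := θ' ∘ₗ mk'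
  let φ : P.F zs.length →ₗ[R] A := θ''.restrictScalars R ∘ₗ loc
  have hφ : ∀ v, φ (P.d zs.length v) = 0 := by
    intro v
    have : mk' (loc (P.d zs.length v)) = 0 := by
      refine (Submodule.Quotient.mk_eq_zero _).2 ⟨LocalizedModule.mk v 1, ?_⟩
      exact LocalizedModule.map_mk p.primeCompl _ v 1
    change θ' (mk' (loc (P.d zs.length v))) = 0
    rw [this, map_zero]
  have := (hP zs.length).1
  have := (hP zs.length).2
  let b := Module.Free.chooseBasis R (P.F zs.length)
  obtain ⟨u, hu⟩ := IsLocalization.exist_integer_multiples_of_finite p.primeCompl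
    (fun i => φ (b i))
  choose c hc using hu
  let θ : P.F zs.length →ₗ[R] R := b.constr R c
  have hθ : ∀ v, algebraMap R A (θ v) = (u : R) • φ v := by
    have : Algebra.linearMap R A ∘ₗ θ = (u : R) • φ :=
      b.ext fun i => by simp [θ, hc]
    exact LinearMap.congr_fun this
  refine ⟨θ, fun v => ?_, fun h => ?_⟩
  · apply IsLocalization.injective A p.primeCompl_le_nonZeroDivisors
    rw [hθ, hφ, smul_zero, map_zero]
  · apply hθ'
    have h1 : (u : R) • φ z ∈ Ideal.ofList (zs.map (algebraMap R A)) := by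
      rw [← hθ, ← Ideal.map_ofList]
      exact Ideal.mem_map_of_mem _ h
    rw [Algebra.smul_def] at h1
    exact (Ideal.unit_mul_mem_iff_mem _ (IsLocalization.map_units A u)).1 h1

end LocallyFree

section Unmixed

variable {R : Type u} [CommRing R]

theorem mem_associatedPrimes_of_height_eq [IsNoetherianRing R] {zs : List R}
    (hz : IsWeaklyRegular R zs) {p : Ideal R} [p.IsPrime] (hzp : ∀ r ∈ zs, r ∈ p)
    (hp : p.height = zs.length) : p ∈ associatedPrimes R (R ⧸ Ideal.ofList zs) := by
  obtain ⟨p', hp', hp'p, -⟩ := exists_associatedPrimes_between (M := R ⧸ Ideal.ofList zs) (Q := p)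
    (Ideal.Quotient.mk _ 1) (fun u hu => by
      have h1 : Ideal.Quotient.mk (Ideal.ofList zs) (u * 1) = 0 := hu
      rw [mul_one, Ideal.Quotient.eq_zero_iff_mem] at h1
      exact Ideal.span_le.2 hzp h1)
  have := hp'.1
  have h1 := length_le_height hz (Q := p') (fun r hr =>
    le_of_mem_associatedPrimes_quotient hp' (Ideal.subset_span hr))
  rcases hp'p.eq_or_lt with rfl | hlt
  · exact hp'
  · have h2 := Ideal.height_add_one_le_of_lt_of_isPrime hlt
    rw [hp] at h2
    have h3 : (zs.length : ℕ∞) + 1 ≤ zs.length :=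
      (by gcongr : (zs.length : ℕ∞) + 1 ≤ p'.height + 1).trans h2
    norm_cast at h3
    omega

variable {I : Ideal R} {zs : List R}

theorem le_length_of_gradeGE_orderIdeal [IsNoetherianRing R] {M : Type u} [AddCommGroup M]
    [Module R M] {P : ProjRes R M} (hz : IsWeaklyRegular R zs) {g : R} (hg : g ∉ Ideal.ofList zs)
    {j k : ℕ} {y : P.F j} (hy : g • y ∈ LinearMap.range (P.d j) ⊔
      Ideal.ofList zs • (⊤ : Submodule R (P.F j)))
    (hk : GradeGE R (orderIdeal R ((LinearMap.range (P.d j)).mkQ y)) k) : k ≤ zs.length := by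
  have hmem : ∀ a ∈ orderIdeal R ((LinearMap.range (P.d j)).mkQ y), a * g ∈ Ideal.ofList zs := by
    rintro _ ⟨f, rfl⟩
    obtain ⟨_, ⟨v, rfl⟩, b, hb, hvb⟩ := Submodule.mem_sup.1 hy
    have h1 : (LinearMap.range (P.d j)).mkQ (g • y) = (LinearMap.range (P.d j)).mkQ b := by
      rw [← hvb, map_add, add_eq_right]
      exact (Submodule.Quotient.mk_eq_zero _).2 ⟨v, rfl⟩
    have h2 := apply_mem_of_mem_smul_top (f ∘ₗ (LinearMap.range (P.d j)).mkQ) hb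
    rw [LinearMap.comp_apply, ← h1, map_smul, map_smul, smul_eq_mul, mul_comm] at h2
    exact h2
  rcases hk with htop | ⟨rs, rfl, hrs, hr⟩
  · exact absurd (by simpa using hmem 1 (htop ▸ trivial)) hg
  · exact length_le_of_smul_mem hz hg hmem hrs hr

theorem le_height_of_unmixed [IsNoetherianRing R] {d : ℕ}
    (hunm : ∀ p ∈ associatedPrimes R (R ⧸ I), p.height = d) {Q : Ideal R} [Q.IsPrime]
    (hQ : I ≤ Q) : (d : ℕ∞) ≤ Q.height := by
  obtain ⟨p, hp, hpQ, -⟩ := exists_associatedPrimes_between (M := R ⧸ I) (Q := Q)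
    (Ideal.Quotient.mk _ 1) (fun u hu => by
      have h1 : Ideal.Quotient.mk I (u * 1) = 0 := hu
      rw [mul_one, Ideal.Quotient.eq_zero_iff_mem] at h1
      exact hQ h1)
  rw [← hunm p hp]
  exact Ideal.height_mono hpQ

variable [IsLocalRing R] {n l : ℕ} {P : ProjRes R (R ⧸ I)}

theorem exists_associatedPrimes_quotient_between [IsNoetherianRing R] {c : R} (hc : c ∉ I) :
    ∃ p ∈ associatedPrimes R (R ⧸ I), ∀ b, b * c ∈ I → b ∈ p := by
  have hc' : ∀ b, b • Ideal.Quotient.mk I c = 0 ↔ b * c ∈ I := fun b => by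
    rw [← Ideal.Quotient.eq_zero_iff_mem]; rfl
  obtain ⟨p, hp, -, hpc⟩ := exists_associatedPrimes_between (M := R ⧸ I) (Q := maximalIdeal R)
    (Ideal.Quotient.mk I c) (fun u hu => by
      rw [hc'] at hu
      by_contra hu'
      have : IsUnit u := by simpa using hu'
      exact hc ((Ideal.unit_mul_mem_iff_mem I this).1 hu))
  exact ⟨p, hp, fun b hb => hpc b ((hc' b).2 hb)⟩

/-- If `R ⧸ I` is unmixed of codimension the length of `zs`, then `I` is linked to itself twice
by `zs`. -/
theorem mem_of_forall_mul_mem (h : RegLocal R n) (hP : FinFree P)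
    (hl : ∀ j, l ≤ j → Subsingleton (P.F j)) (hz : IsWeaklyRegular R zs)
    (hzI : ∀ r ∈ zs, r ∈ I)
    (hunm : ∀ p ∈ associatedPrimes R (R ⧸ I), p.height = zs.length) {c : R}
    (hc : ∀ b, (∀ a ∈ I, a * b ∈ Ideal.ofList zs) → c * b ∈ Ideal.ofList zs) : c ∈ I := by
  have := h.noeth
  have := h.isDomain
  by_contra hcI
  obtain ⟨p, hp, hpc⟩ := exists_associatedPrimes_quotient_between hcI
  have := hp.1
  have hpJ := mem_associatedPrimes_of_height_eq hz (p := p)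
    (fun r hr => le_of_mem_associatedPrimes_quotient hp (hzI r hr)) (hunm p hp)
  obtain ⟨-, g, hg⟩ := mem_associatedPrimes_quotient_iff.1 hpJ
  obtain ⟨f, hf⟩ := exists_forall_smul_mem_iff hP hz hzI
  obtain ⟨θ, hθ, hθz⟩ := exists_functional hP hl hz hg (z := c • f) (fun u hu h1 => by
    rw [smul_smul, hf] at h1
    exact hu (hpc u h1))
  refine hθz ?_
  rw [map_smul, smul_eq_mul]
  refine hc _ fun a ha => ?_
  obtain ⟨_, ⟨v, rfl⟩, b, hb, hvb⟩ := Submodule.mem_sup.1 ((hf a).2 ha)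
  rw [← smul_eq_mul, ← map_smul, ← hvb, map_add, hθ, zero_add]
  exact apply_mem_of_mem_smul_top θ hb

theorem isSyzygy_of_unmixed (h : RegLocal R n) (hP : FinFree P)
    (hl : ∀ j, l ≤ j → Subsingleton (P.F j)) (hz : IsWeaklyRegular R zs)
    (hzI : ∀ r ∈ zs, r ∈ I) (hIm : I ≤ maximalIdeal R)
    (hunm : ∀ p ∈ associatedPrimes R (R ⧸ I), p.height = zs.length) :
    IsSyzygy R (zs.length + 1) (P.F zs.length ⧸ LinearMap.range (P.d zs.length)) := by
  have := h.noeth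
  let L : Ideal R :=
    { carrier := {b | ∀ a ∈ I, a * b ∈ Ideal.ofList zs}
      zero_mem' := fun a _ => by simp
      add_mem' := fun {x y} hx hy a ha => by
        rw [mul_add]; exact add_mem (hx a ha) (hy a ha)
      smul_mem' := fun r x hx a ha => by
        rw [smul_eq_mul, mul_left_comm]; exact Ideal.mul_mem_left _ _ (hx a ha) }
  have hL : ∀ b, b ∈ L ↔ ∀ a ∈ I, a * b ∈ Ideal.ofList zs := fun b => Iff.rfl
  obtain ⟨t, a, ha⟩ : ∃ (t : ℕ) (a : Fin (t + 1) → R), Ideal.span (Set.range a) = L := by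
    obtain ⟨t, a, ha⟩ := Submodule.fg_iff_exists_fin_generating_family.1
      ((isNoetherianRing_iff_ideal_fg R).1 this L)
    refine ⟨t, Fin.cons 0 a, ?_⟩
    rw [Fin.range_cons, Ideal.span_insert_zero]
    exact ha
  let E := (Fin (t + 1) → R) ⧸ Ideal.ofList zs • (⊤ : Submodule R (Fin (t + 1) → R))
  have hE : ∀ c : R, (Submodule.Quotient.mk (c • a) : E) = 0 ↔ c ∈ I := by
    intro c
    rw [Submodule.Quotient.mk_eq_zero]
    constructor
    · intro hc
      refine mem_of_forall_mul_mem h hP hl hz hzI hunm fun b hb => ?_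
      rw [← hL, ← ha] at hb
      induction hb using Submodule.span_induction with
      | mem x hx =>
        obtain ⟨k, rfl⟩ := hx
        exact apply_mem_of_mem_smul_top (LinearMap.proj k) hc
      | zero => simp
      | add x y _ _ hx hy => rw [mul_add]; exact add_mem hx hy
      | smul r x _ hx =>
        rw [smul_eq_mul, mul_left_comm]; exact Ideal.mul_mem_left _ _ hx
    · intro hc
      refine mem_smul_top_of_forall_apply_mem fun f => ?_
      rw [map_smul, smul_eq_mul]
      refine (hL _).1 ?_ c hc
      rw [LinearMap.pi_apply_eq_sum_univ f a]
      refine sum_mem fun k _ => ?_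
      rw [smul_eq_mul]
      exact Ideal.mul_mem_right _ _ (ha ▸ Ideal.subset_span ⟨k, rfl⟩)
  let i : (R ⧸ I) →ₗ[R] E := Submodule.liftQ I (LinearMap.toSpanSingleton R E
    (Submodule.Quotient.mk a)) fun c hc => by
      rw [LinearMap.mem_ker]
      exact (hE c).2 hc
  have hi : Function.Injective i := by
    rw [← LinearMap.ker_eq_bot, LinearMap.ker_eq_bot']
    intro x hx
    obtain ⟨c, rfl⟩ := Ideal.Quotient.mk_surjective x
    exact Ideal.Quotient.eq_zero_iff_mem.2 ((hE c).1 hx)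
  have hsyz := SyzOf.succ i (LinearMap.range i).mkQ hi (Submodule.mkQ_surjective _)
    (Submodule.ker_mkQ _).symm
    (freeDimLE_quotient_ofList hz (fun r hr => hIm (hzI r hr)) t) (syzOf_res P hP)
  exact hsyz.isSyzygy (shiftRes P zs.length) (fun j => hP _)

theorem exists_isWeaklyRegular_of_le_height (h : RegLocal R n) (hIm : I ≤ maximalIdeal R) {d : ℕ}
    (hI : ∀ Q : Ideal R, Q.IsPrime → I ≤ Q → (d : ℕ∞) ≤ Q.height) :
    ∃ zs : List R, zs.length = d ∧ (∀ r ∈ zs, r ∈ I) ∧ IsWeaklyRegular R zs := by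
  obtain ⟨zs, h1, h2, h3⟩ := exists_isWeaklyRegular_congr h hIm hI (List.replicate d 0) (by simp)
    (fun r hr => by simp [List.eq_of_mem_replicate hr])
  exact ⟨zs, by simpa using h1.length_eq.symm, h2, h3⟩

/-- Over a regular local ring satisfying the order ideal conjecture, iterated null-homotopies
of elements of an unmixed ideal `I` that is not generated by `height I` elements vanish modulo
the maximal ideal in degrees at least `height I`. -/
theorem HIter.mem_of_orderIdealConjecture (h : RegLocal R n) (hOIC : OrderIdealConjecture R)
    (hP : FinFree P) (hl : ∀ j, l ≤ j → Subsingleton (P.F j)) (hIm : I ≤ maximalIdeal R) {d : ℕ}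
    (hunm : ∀ p ∈ associatedPrimes R (R ⧸ I), p.height = d)
    (hgen : ∀ us : List R, us.length = d → Ideal.ofList us ≠ I) {j : ℕ} (hj : d ≤ j)
    {us : List R} (hus : ∀ u ∈ us, u ∈ I) {y : P.F j} (hy : HIter P j us y) :
    y ∈ LinearMap.range (P.d j) ⊔ maximalIdeal R • (⊤ : Submodule R (P.F j)) := by
  have := h.noeth
  have hheight : ∀ Q : Ideal R, Q.IsPrime → I ≤ Q → (d : ℕ∞) ≤ Q.height := fun Q _ hQ =>
    le_height_of_unmixed hunm hQ
  obtain ⟨zs, rfl, hzI, hz⟩ := exists_isWeaklyRegular_of_le_height h hIm hheight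
  have hgrade : ∀ (w : P.F j) (k : ℕ),
      IsSyzygy R k (P.F j ⧸ LinearMap.range (P.d j)) →
      w ∉ LinearMap.range (P.d j) ⊔ maximalIdeal R • (⊤ : Submodule R (P.F j)) →
      GradeGE R (orderIdeal R ((LinearMap.range (P.d j)).mkQ w)) k := by
    intro w k hk hw
    have := (hP j).2
    exact hOIC _ _ _ inferInstance (hasFiniteFreeResolution_quotient_range hP hl j) k hk _
      fun hw' => hw (mem_sup_smul_top_of_mkQ_mem hw')
  have hann : ∀ u ∈ I, ∀ m : R ⧸ I, u • m = 0 := by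
    intro u hu m
    obtain ⟨r, rfl⟩ := Ideal.Quotient.mk_surjective m
    exact Ideal.Quotient.eq_zero_iff_mem.2 (I.mul_mem_right r hu)
  by_contra hyn
  rcases hj.eq_or_lt with rfl | hlt
  · obtain ⟨us', hus', hus'I, hus'r⟩ := exists_isWeaklyRegular_congr h hIm hheight us
      hy.length_eq.le hus
    obtain ⟨y', hy', hyy'⟩ := hy.exists_congr hann hus'
    have hy'n : y' ∉ LinearMap.range (P.d zs.length) ⊔
        maximalIdeal R • (⊤ : Submodule R (P.F zs.length)) := fun h1 => hyn <| by
      simpa using sub_mem h1 (Submodule.mem_sup_right hyy')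
    obtain ⟨b, hbI, hb⟩ := SetLike.exists_of_lt
      ((Ideal.span_le.2 hus'I : Ideal.ofList us' ≤ I).lt_of_ne (hgen us' hy'.length_eq))
    have := le_length_of_gradeGE_orderIdeal hus'r hb (hy'.smul_mem (hann b hbI))
      (hgrade y' _ (isSyzygy_of_unmixed h hP hl hz hzI hIm hunm) hy'n)
    rw [hy'.length_eq] at this
    omega
  · obtain ⟨i, rfl⟩ : ∃ i, j = i + 1 := ⟨j - 1, by omega⟩
    obtain ⟨p, hp, -⟩ := exists_associatedPrimes_quotient_between (I := I) (c := 1)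
      (fun h1 => (maximalIdeal.isMaximal R).ne_top ((Ideal.eq_top_iff_one _).2 (hIm h1)))
    have := hp.1
    have hpJ := mem_associatedPrimes_of_height_eq hz (p := p)
      (fun r hr => le_of_mem_associatedPrimes_quotient hp (hzI r hr)) (hunm p hp)
    obtain ⟨hpp, g, hg⟩ := mem_associatedPrimes_quotient_iff.1 hpJ
    have hgz : g ∉ Ideal.ofList zs := fun h1 => hpp.ne_top ((Ideal.eq_top_iff_one _).2
      ((hg 1).2 (by simpa using h1)))
    have hdy : P.d i (g • y) ∈ Ideal.ofList zs • (⊤ : Submodule R (P.F i)) := by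
      rw [map_smul]
      refine Submodule.smul_induction_on hy.d_mem (fun r hr x _ => ?_) (fun x y hx hy => ?_)
      · rw [smul_smul, mul_comm]
        have hrI : r ∈ I := Ideal.span_le.2 hus hr
        exact Submodule.smul_mem_smul
          ((hg r).1 (le_of_mem_associatedPrimes_quotient hp hrI)) trivial
      · rw [smul_add]
        exact add_mem hx hy
    have := le_length_of_gradeGE_orderIdeal hz hgz
      (mem_range_sup_of_d_mem hP hz (by omega) hdy) (hgrade y _ ((syzOf_res P hP).isSyzygy
        (shiftRes P (i + 1)) (fun j => hP _)) hyn)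
    omega

end Unmixed

section Serre

theorem SerreS.height_le {A : Type u} [CommRing A] [IsNoetherianRing A] {k : ℕ}
    (hS : SerreS A k) {zs : List A} (hz : IsWeaklyRegular A zs) (hk : zs.length < k)
    {p : Ideal A} [hp : p.IsPrime] {g : A} (hg : ∀ r, r ∈ p ↔ r * g ∈ Ideal.ofList zs) :
    p.height ≤ zs.length := by
  by_contra! hlt
  obtain ⟨rs, hrl, hrm, hr⟩ := hS p hp (zs.length + 1) hk (by
    rw [IsLocalization.AtPrime.ringKrullDim_eq_height p (Localization.AtPrime p)]
    have := Order.add_one_le_of_lt hlt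
    exact_mod_cast this)
  have hz' : IsWeaklyRegular (Localization.AtPrime p)
    (zs.map (algebraMap A (Localization.AtPrime p))) := hz.of_flat
  have h1 := length_le_of_smul_mem hz' (g := algebraMap A _ g) (fun h1 => ?_)
    (fun r hr => (mem_maximalIdeal_iff_mul_mem hg r).1 hr) hrm hr
  · rw [List.length_map] at h1
    omega
  · have h2 := (mem_maximalIdeal_iff_mul_mem hg 1).2 (by rwa [one_mul])
    exact (maximalIdeal.isMaximal _).ne_top ((Ideal.eq_top_iff_one _).2 h2)

variable {R : Type u} [CommRing R] {I : Ideal R}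

theorem mk_mem_map_mk {J : Ideal R} {a : R} :
    Ideal.Quotient.mk I a ∈ J.map (Ideal.Quotient.mk I) ↔ a ∈ I ⊔ J := by
  rw [← Ideal.mem_comap, Ideal.comap_map_of_surjective _ Ideal.Quotient.mk_surjective,
    ← RingHom.ker_eq_comap_bot, Ideal.mk_ker, sup_comm]

theorem mk_mem_map_mk_of_le {J : Ideal R} (hJ : I ≤ J) {a : R} :
    Ideal.Quotient.mk I a ∈ J.map (Ideal.Quotient.mk I) ↔ a ∈ J := by
  rw [mk_mem_map_mk, sup_eq_right.2 hJ]

theorem isPrime_map_mk {p : Ideal R} [p.IsPrime] (hp : I ≤ p) :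
    (p.map (Ideal.Quotient.mk I)).IsPrime :=
  Ideal.map_isPrime_of_surjective Ideal.Quotient.mk_surjective (by rwa [Ideal.mk_ker])

theorem map_mk_lt_map_mk {p q : Ideal R} (hp : I ≤ p) (hpq : p < q) :
    p.map (Ideal.Quotient.mk I) < q.map (Ideal.Quotient.mk I) := by
  obtain ⟨a, haq, hap⟩ := SetLike.exists_of_lt hpq
  refine lt_of_le_of_ne (Ideal.map_mono hpq.le) fun h => hap ?_
  rw [← mk_mem_map_mk_of_le hp, h]
  exact Ideal.mem_map_of_mem _ haq

theorem mem_minimalPrimes_of_serreS [IsNoetherianRing R] (hS : SerreS (R ⧸ I) 2) {p : Ideal R}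
    (hp : p ∈ associatedPrimes R (R ⧸ I)) : p ∈ I.minimalPrimes := by
  have := hp.1
  have hIp := le_of_mem_associatedPrimes_quotient hp
  have := isPrime_map_mk hIp
  obtain ⟨-, g, hg⟩ := mem_associatedPrimes_quotient_iff.1 hp
  have h1 := SerreS.height_le hS (zs := []) (IsWeaklyRegular.nil _ _) (by simp)
    (p := p.map (Ideal.Quotient.mk I)) (g := Ideal.Quotient.mk I g) (fun r => by
      obtain ⟨r, rfl⟩ := Ideal.Quotient.mk_surjective r
      rw [mk_mem_map_mk_of_le hIp, hg, ← map_mul, Ideal.ofList_nil, Submodule.mem_bot,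
        Ideal.Quotient.eq_zero_iff_mem])
  obtain ⟨q, hq, hqp⟩ := Ideal.exists_minimalPrimes_le hIp
  rcases hqp.eq_or_lt with rfl | hlt
  · exact hq
  · have := hq.1.1
    have := isPrime_map_mk hq.1.2
    have h2 := Ideal.height_add_one_le_of_lt_of_isPrime (map_mk_lt_map_mk hq.1.2 hlt)
    have h3 := h2.trans h1
    simp at h3

theorem not_lt_of_serreS [IsNoetherianRing R] (hS : SerreS (R ⧸ I) 2) {x : R}
    (hx : IsSMulRegular (R ⧸ I) x) {p : Ideal R}
    (hp : p ∈ associatedPrimes R (R ⧸ (I ⊔ span {x}))) {p₀ p₁ : Ideal R} [p₀.IsPrime]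
    [p₁.IsPrime] (h0 : I ≤ p₀) (h01 : p₀ < p₁) : ¬ p₁ < p := by
  intro h12
  have := hp.1
  have hIp := le_of_mem_associatedPrimes_quotient hp
  have := isPrime_map_mk (le_sup_left.trans hIp)
  have := isPrime_map_mk h0
  have := isPrime_map_mk (h0.trans h01.le)
  obtain ⟨-, g, hg⟩ := mem_associatedPrimes_quotient_iff.1 hp
  have h1 := SerreS.height_le hS (zs := [Ideal.Quotient.mk I x]) (by
      rw [isWeaklyRegular_singleton_iff]
      intro a b hab
      refine hx (?_ : x • a = x • b)
      rw [Algebra.smul_def, Algebra.smul_def]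
      exact hab) (by simp)
    (p := p.map (Ideal.Quotient.mk I)) (g := Ideal.Quotient.mk I g) (fun r => by
      obtain ⟨r, rfl⟩ := Ideal.Quotient.mk_surjective r
      rw [mk_mem_map_mk_of_le (le_sup_left.trans hIp), hg, ← map_mul, ← mk_mem_map_mk,
        Ideal.map_span, Set.image_singleton, Ideal.ofList_singleton])
  have h2 := Ideal.height_add_one_le_of_lt_of_isPrime (map_mk_lt_map_mk h0 h01)
  have h3 := Ideal.height_add_one_le_of_lt_of_isPrime
    (map_mk_lt_map_mk (h0.trans h01.le) h12)
  have h4 : ((0 : ℕ) : ℕ∞) + 1 + 1 ≤ (1 : ℕ) := calc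
    ((0 : ℕ) : ℕ∞) + 1 + 1 ≤ (p₀.map (Ideal.Quotient.mk I)).height + 1 + 1 := by
      gcongr
      exact zero_le
    _ ≤ (p₁.map (Ideal.Quotient.mk I)).height + 1 := by gcongr
    _ ≤ (p.map (Ideal.Quotient.mk I)).height := h3
    _ ≤ (1 : ℕ) := h1
  norm_cast at h4

theorem mem_associatedPrimes_of_mem_minimalPrimes [IsNoetherianRing R] {q : Ideal R}
    (hq : q ∈ I.minimalPrimes) : q ∈ associatedPrimes R (R ⧸ I) := by
  have := hq.1.1
  obtain ⟨p, hp, hpq, -⟩ := exists_associatedPrimes_between (M := R ⧸ I) (Q := q)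
    (Ideal.Quotient.mk _ 1) (fun u hu => by
      have h1 : Ideal.Quotient.mk I (u * 1) = 0 := hu
      rw [mul_one, Ideal.Quotient.eq_zero_iff_mem] at h1
      exact hq.1.2 h1)
  rwa [le_antisymm hpq (hq.2 ⟨hp.1, le_of_mem_associatedPrimes_quotient hp⟩ hpq)] at hp

theorem exists_le_of_sInf_le {s : Set (Ideal R)} (hs : s.Finite) {Q : Ideal R} [hQ : Q.IsPrime]
    (h : sInf s ≤ Q) : ∃ p ∈ s, p ≤ Q := by
  have h1 : hs.toFinset.inf id ≤ Q := by
    refine le_trans (le_sInf fun p hp => ?_) h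
    exact Finset.inf_le (f := id) (hs.mem_toFinset.2 hp)
  obtain ⟨p, hp, hpQ⟩ := (IsPrime.inf_le' hQ).1 h1
  exact ⟨p, hs.mem_toFinset.1 hp, hpQ⟩

variable [IsLocalRing R] {n : ℕ}

theorem height_eq_add_one_of_serreS (h : RegLocal R n) (hS : SerreS (R ⧸ I) 2) {x : R}
    (hx : IsSMulRegular (R ⧸ I) x) {Q : Ideal R}
    (hQ : Q ∈ associatedPrimes R (R ⧸ (I ⊔ span {x}))) {p : Ideal R} [p.IsPrime]
    (hp : I ≤ p) (hpQ : p < Q) : Q.height = p.height + 1 := by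
  have := h.noeth
  have := hQ.1
  refine le_antisymm (height_le_add_one_of_covBy h hpQ.le fun P hP hpP hPQ => ?_)
    (Ideal.height_add_one_le_of_lt_of_isPrime hpQ)
  by_contra hne
  exact not_lt_of_serreS hS hx hQ hp hpP (lt_of_le_of_ne hPQ hne)

theorem height_eq_height_of_serreS (h : RegLocal R n)
    (hS : SerreS (R ⧸ I) 2) {p₀ q₀ : Ideal R} (hp₀ : p₀ ∈ I.minimalPrimes)
    (hq₀ : q₀ ∈ I.minimalPrimes) : q₀.height = p₀.height := by
  have := h.noeth
  by_contra hne
  have hfin : I.minimalPrimes.Finite := Ideal.finite_minimalPrimes_of_isNoetherianRing R I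
  let 𝒰 := {p ∈ I.minimalPrimes | p.height = p₀.height}
  let 𝒱 := {p ∈ I.minimalPrimes | p.height ≠ p₀.height}
  have h𝒰 : 𝒰.Finite := hfin.subset fun p hp => hp.1
  have h𝒱 : 𝒱.Finite := hfin.subset fun p hp => hp.1
  obtain ⟨k, hk⟩ := Ideal.exists_radical_pow_le_of_fg I (IsNoetherian.noetherian _)
  let U := sInf 𝒰 ^ (k + 1)
  let V := sInf 𝒱 ^ (k + 1)
  have hUV : ∀ u ∈ U, ∀ v ∈ V, u * v ∈ I := by
    intro u hu v hv
    have h1 : sInf 𝒰 * sInf 𝒱 ≤ I.radical := by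
      rw [← Ideal.sInf_minimalPrimes]
      refine le_sInf fun p hp => ?_
      by_cases hph : p.height = p₀.height
      · exact Ideal.mul_le_left.trans (sInf_le ⟨hp, hph⟩)
      · exact Ideal.mul_le_right.trans (sInf_le ⟨hp, hph⟩)
    have h2 : U * V ≤ I := by
      rw [← mul_pow]
      exact (Ideal.pow_right_mono h1 _).trans ((Ideal.pow_le_pow_right (Nat.le_succ k)).trans hk)
    exact h2 (Ideal.mul_mem_mul hu hv)
  have hUp : ∀ p ∈ 𝒰, U ≤ p := fun p hp => (Ideal.pow_le_self (by simp)).trans (sInf_le hp)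
  have hVp : ∀ p ∈ 𝒱, V ≤ p := fun p hp => (Ideal.pow_le_self (by simp)).trans (sInf_le hp)
  have hle : ∀ Q : Ideal R, Q.IsPrime → U ⊔ V ≤ Q → (∃ p ∈ 𝒰, p ≤ Q) ∧ ∃ p ∈ 𝒱, p ≤ Q := by
    intro Q hQ hUVQ
    exact ⟨exists_le_of_sInf_le h𝒰 (Ideal.IsPrime.le_of_pow_le (le_sup_left.trans hUVQ)),
      exists_le_of_sInf_le h𝒱 (Ideal.IsPrime.le_of_pow_le (le_sup_right.trans hUVQ))⟩
  have hmin : ∀ p ∈ I.minimalPrimes, ∀ q ∈ I.minimalPrimes, p ≤ q → p = q := fun p hp q hq hpq =>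
    le_antisymm hpq (hq.2 hp.1 hpq)
  have hnot : ∀ p ∈ I.minimalPrimes, ¬ U ⊔ V ≤ p := by
    intro p hp hUVp
    obtain ⟨⟨p₁, hp₁, hp₁p⟩, q₁, hq₁, hq₁p⟩ := hle p hp.1.1 hUVp
    rw [hmin _ hp₁.1 _ hp hp₁p] at hp₁
    rw [hmin _ hq₁.1 _ hp hq₁p] at hq₁
    exact hq₁.2 hp₁.2
  have hm : U ⊔ V ≤ maximalIdeal R := by
    refine sup_le ((hUp p₀ ⟨hp₀, rfl⟩).trans ?_) ((hVp q₀ ⟨hq₀, hne⟩).trans ?_)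
    · exact IsLocalRing.le_maximalIdeal hp₀.1.1.ne_top
    · exact IsLocalRing.le_maximalIdeal hq₀.1.1.ne_top
  obtain ⟨Q, hQ, -⟩ := Ideal.exists_minimalPrimes_le hm
  have := hQ.1.1
  obtain ⟨⟨p₁, hp₁, hp₁Q⟩, q₁, hq₁, hq₁Q⟩ := hle Q hQ.1.1 hQ.1.2
  have := hp₁.1.1.1
  have := hq₁.1.1.1
  obtain ⟨a, haUV, -, ha⟩ := exists_mem_notMem_of_finite
    (J := p₀) (hnot p₀ hp₀) hfin (fun p hp => hp.1.1) hnot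
  have hareg : IsSMulRegular (R ⧸ I) a := isSMulRegular_of_notMem_associatedPrimes fun p hp =>
    ha p (mem_minimalPrimes_of_serreS hS hp)
  have hareg' : ∀ c, a * c ∈ I → c ∈ I := by
    intro c hc
    rw [← Ideal.Quotient.eq_zero_iff_mem] at hc ⊢
    refine hareg (?_ : a • _ = a • _)
    rw [smul_zero]
    exact hc
  obtain ⟨u, hu, v, hv, rfl⟩ := Submodule.mem_sup.1 haUV
  have hmem : ∀ t, t • Ideal.Quotient.mk (I ⊔ span {u + v}) u = 0 ↔
      ∃ c, t * u - c * (u + v) ∈ I := by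
    intro t
    have h1 : t • Ideal.Quotient.mk (I ⊔ span {u + v}) u = Ideal.Quotient.mk _ (t * u) := rfl
    rw [h1, Ideal.Quotient.eq_zero_iff_mem, sup_comm, Ideal.mem_span_singleton_sup]
    constructor
    · rintro ⟨c, b, hb, h2⟩
      exact ⟨c, by rwa [← h2, add_sub_cancel_left]⟩
    · rintro ⟨c, hc⟩
      exact ⟨c, _, hc, by ring⟩
  have hup₁ : u ∈ p₁ := hUp p₁ hp₁ hu
  have hvq₁ : v ∈ q₁ := hVp q₁ hq₁ hv
  have hvp₁ : v ∉ p₁ := fun hv' => ha p₁ hp₁.1 (add_mem hup₁ hv')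
  have huq₁ : u ∉ q₁ := fun hu' => ha q₁ hq₁.1 (add_mem hu' hvq₁)
  obtain ⟨P, hP, hPQ, hPann⟩ := exists_associatedPrimes_between (M := R ⧸ (I ⊔ span {u + v}))
    (Q := Q) (Ideal.Quotient.mk _ u) (fun t ht => by
      obtain ⟨c, hc⟩ := (hmem t).1 ht
      have huv := hUV u hu v hv
      have h1 : c * v ∈ I := hareg' _ (by
        have : (u + v) * (c * v) = t * (u * v) - v * (t * u - c * (u + v)) := by ring
        rw [this]
        exact sub_mem (I.mul_mem_left _ huv) (I.mul_mem_left _ hc))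
      have h2 : (t - c) * u ∈ I := by
        have : (t - c) * u = (t * u - c * (u + v)) + c * v := by ring
        rw [this]
        exact add_mem hc h1
      have h3 : c ∈ Q := hp₁Q (((hp₁.1.1.1.mem_or_mem (hp₁.1.1.2 h1))).resolve_right hvp₁)
      have h4 : t - c ∈ Q := hq₁Q (((hq₁.1.1.1.mem_or_mem (hq₁.1.1.2 h2))).resolve_right huq₁)
      simpa using add_mem h4 h3)
  have hUVP : U ⊔ V ≤ P := by
    refine sup_le (fun w hw => hPann w ((hmem w).2 ⟨w, ?_⟩))
      (fun w hw => hPann w ((hmem w).2 ⟨0, ?_⟩))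
    · have : w * u - w * (u + v) = -(w * v) := by ring
      rw [this]
      exact neg_mem (hUV w hw v hv)
    · rw [zero_mul, sub_zero, mul_comm]
      exact hUV u hu w hw
  obtain rfl : P = Q := le_antisymm hPQ (hQ.2 ⟨hP.1, hUVP⟩ hPQ)
  have hlt : ∀ p ∈ I.minimalPrimes, p ≤ P → p < P := fun p hp hpP =>
    lt_of_le_of_ne hpP (by rintro rfl; exact hnot _ hp hUVP)
  have h1 := height_eq_add_one_of_serreS h hS hareg hP hp₁.1.1.2 (hlt p₁ hp₁.1 hp₁Q)
  have h2 := height_eq_add_one_of_serreS h hS hareg hP hq₁.1.1.2 (hlt q₁ hq₁.1 hq₁Q)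
  rw [h1, hp₁.2] at h2
  have := hp₀.1.1
  refine hq₁.2 ?_
  have h3 := height_ne_top h (Q := q₁)
  have h4 := height_ne_top h (Q := p₀)
  lift q₁.height to ℕ using h3 with a
  lift p₀.height to ℕ using h4 with b
  norm_cast at h2 ⊢
  omega

theorem height_eq_of_serreS (h : RegLocal R n)
    (hS : SerreS (R ⧸ I) 2) {d : ℕ} (hI : ∀ Q : Ideal R, Q.IsPrime → I ≤ Q → (d : ℕ∞) ≤ Q.height)
    {Q : Ideal R} [Q.IsPrime] (hQ : I ≤ Q) (hd : Q.height = d) {p : Ideal R}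
    (hp : p ∈ associatedPrimes R (R ⧸ I)) : p.height = d := by
  have := h.noeth
  obtain ⟨q, hq, hqQ⟩ := Ideal.exists_minimalPrimes_le hQ
  rw [height_eq_height_of_serreS h hS hq (mem_minimalPrimes_of_serreS hS hp)]
  exact le_antisymm ((Ideal.height_mono hqQ).trans hd.le) (hI q hq.1.1 hq.1.2)

theorem height_eq_of_quotient (h : RegLocal R (n + 1)) (hS : SerreS (R ⧸ I) 2)
    {d : ℕ} (hunm : ∀ p ∈ associatedPrimes R (R ⧸ I), p.height = d) {r : R}
    (hrm : r ∈ maximalIdeal R) (hr2 : r ∉ maximalIdeal R ^ 2)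
    (hr : ∀ p ∈ associatedPrimes R (R ⧸ I), r ∉ p) {p : Ideal (R ⧸ span {r})}
    (hp : p ∈ associatedPrimes (R ⧸ span {r})
      ((R ⧸ span {r}) ⧸ I.map (Ideal.Quotient.mk (span {r})))) : p.height = d := by
  have := h.noeth
  have := h.isDomain
  have hr0 : r ≠ 0 := by rintro rfl; simp at hr2
  have := isLocalRing_quotient (I := span {r}) (by simpa [Ideal.span_le] using hrm)
  have h' := h.quotient hrm hr2
  have := hp.1
  let P := p.comap (Ideal.Quotient.mk (span {r}))
  have hrP : r ∈ P := by
    rw [Ideal.mem_comap, Ideal.Quotient.eq_zero_iff_mem.2 (Ideal.mem_span_singleton_self r)]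
    exact zero_mem _
  have hP : P ∈ associatedPrimes R (R ⧸ (I ⊔ span {r})) := by
    obtain ⟨-, g, hg⟩ := mem_associatedPrimes_quotient_iff.1 hp
    obtain ⟨g, rfl⟩ := Ideal.Quotient.mk_surjective g
    refine mem_associatedPrimes_quotient_iff.2 ⟨inferInstance, g, fun a => ?_⟩
    rw [Ideal.mem_comap, hg, ← map_mul, mk_mem_map_mk, sup_comm]
  obtain ⟨q, hq, hqP⟩ := Ideal.exists_minimalPrimes_le
    (le_sup_left.trans (le_of_mem_associatedPrimes_quotient hP))
  have := hq.1.1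
  have hqa := mem_associatedPrimes_of_mem_minimalPrimes hq
  have hPh : P.height = d + 1 := by
    rw [height_eq_add_one_of_serreS h hS (isSMulRegular_of_notMem_associatedPrimes hr) hP hq.1.2
      (lt_of_le_of_ne hqP (by rintro rfl; exact hr _ hqa hrP)), hunm q hqa]
  have hmap : P.map (Ideal.Quotient.mk (span {r})) = p :=
    Ideal.map_comap_of_surjective _ Ideal.Quotient.mk_surjective p
  have h1 := Ideal.height_le_height_add_one_of_mem hrP
  rw [hmap, hPh] at h1
  have h2 := height_ne_top h' (Q := p)
  obtain ⟨a, ha⟩ := ENat.ne_top_iff_exists.1 h2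
  obtain ⟨rs, hrl, hrsp, hrs⟩ := exists_isWeaklyRegular_length_eq_height h' ha.le
  obtain ⟨ts, rfl⟩ : ∃ ts : List R, ts.map (Ideal.Quotient.mk (span {r})) = rs :=
    List.map_surjective_iff.2 Ideal.Quotient.mk_surjective rs
  have h3 := length_le_height (isWeaklyRegular_cons_of_map
    (fun a b hab => mul_left_cancel₀ hr0 hab) hrs) (Q := P) (by
      intro t ht
      rcases List.mem_cons.1 ht with rfl | ht
      · exact hrP
      · exact hrsp _ (List.mem_map_of_mem ht))
  rw [hPh] at h3
  rw [← ha] at h1 ⊢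
  simp only [List.length_cons, List.length_map] at h3 hrl
  norm_cast at h1 h3 ⊢
  omega

end Serre

section Koszul

variable {R : Type u} [CommRing R] {s : ℕ}

variable (R) in
/-- The basis element of `KMod R s n` indexed by `T`, or zero if `T` has the wrong size. -/
noncomputable def koszulBasis (n : ℕ) (T : Finset (Fin s)) : KMod R s n :=
  if h : T.card = n then Finsupp.single ⟨T, h⟩ 1 else 0

/-- The coefficient of `e_{T∖{j}}` in the Koszul differential of `e_T`. -/
def koszulCoeff (x : Fin s → R) (T : Finset (Fin s)) (j : Fin s) : R :=
  (-1 : R) ^ (T.filter (fun i => i < j)).card * x j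

theorem koszulBasis_coe {n : ℕ} (T : KIdx s n) :
    koszulBasis R n T.1 = Finsupp.single T 1 := by
  rw [koszulBasis, dif_pos T.2]

theorem koszulMod_hom_ext {n : ℕ} {N : Type*} [AddCommGroup N] [Module R N]
    {f g : KMod R s n →ₗ[R] N}
    (h : ∀ T : Finset (Fin s), T.card = n → f (koszulBasis R n T) = g (koszulBasis R n T)) :
    f = g := by
  refine Finsupp.lhom_ext' fun T => LinearMap.ext_ring ?_
  have := h T.1 T.2
  rwa [koszulBasis_coe] at this

theorem koszulD_basis (x : Fin s → R) {n : ℕ} {T : Finset (Fin s)} (hT : T.card = n + 1) :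
    koszulD R x n (koszulBasis R (n + 1) T) =
      ∑ j ∈ T, koszulCoeff x T j • koszulBasis R n (T.erase j) := by
  rw [koszulBasis, dif_pos hT, koszulD, Finsupp.lsum_single,
    LinearMap.toSpanSingleton_apply, one_smul, ← Finset.sum_attach T]
  refine Finset.sum_congr rfl fun j _ => ?_
  rw [koszulCoeff, koszulBasis, dif_pos]

theorem koszulCoeff_mul_add (x : Fin s → R) {T : Finset (Fin s)} {i j : Fin s} (hi : i ∈ T)
    (hij : i < j) : koszulCoeff x T j * koszulCoeff x (T.erase j) i +
      koszulCoeff x T i * koszulCoeff x (T.erase i) j = 0 := by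
  have h1 : (T.erase j).filter (fun k => k < i) = T.filter (fun k => k < i) := by
    ext k
    simp only [Finset.mem_filter, Finset.mem_erase]
    exact ⟨fun h => ⟨h.1.2, h.2⟩, fun h => ⟨⟨(h.2.trans hij).ne, h.1⟩, h.2⟩⟩
  have h2 : ((T.erase i).filter (fun k => k < j)).card + 1 =
      (T.filter (fun k => k < j)).card := by
    rw [Finset.filter_erase]
    exact Finset.card_erase_add_one (by simp [hi, hij])
  rw [koszulCoeff, koszulCoeff, koszulCoeff, koszulCoeff, h1, ← h2, pow_succ]
  ring

theorem koszulD_koszulD (x : Fin s → R) (n : ℕ) (v : KMod R s (n + 2)) :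
    koszulD R x n (koszulD R x (n + 1) v) = 0 := by
  suffices h : koszulD R x n ∘ₗ koszulD R x (n + 1) = 0 from LinearMap.congr_fun h v
  refine koszulMod_hom_ext fun T hT => ?_
  rw [LinearMap.comp_apply, koszulD_basis x hT, map_sum, LinearMap.zero_apply]
  have h1 : ∀ j ∈ T, koszulD R x n (koszulCoeff x T j • koszulBasis R (n + 1) (T.erase j)) =
      ∑ i ∈ T.erase j, (koszulCoeff x T j * koszulCoeff x (T.erase j) i) •
        koszulBasis R n ((T.erase j).erase i) := by
    intro j hj
    rw [map_smul, koszulD_basis x (by rw [Finset.card_erase_of_mem hj]; omega), Finset.smul_sum]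
    simp only [smul_smul]
  rw [Finset.sum_congr rfl h1, Finset.sum_sigma']
  refine Finset.sum_involution (fun a _ => ⟨a.2, a.1⟩) ?_ ?_ ?_ ?_
  · rintro ⟨j, i⟩ h
    simp only [Finset.mem_sigma, Finset.mem_erase] at h
    change _ • koszulBasis R n ((T.erase j).erase i) + _ • koszulBasis R n ((T.erase i).erase j) = 0
    rw [Finset.erase_right_comm, ← add_smul]
    rcases lt_or_gt_of_ne h.2.1 with hij | hij
    · rw [koszulCoeff_mul_add x h.2.2 hij, zero_smul]
    · rw [add_comm, koszulCoeff_mul_add x h.1 hij, zero_smul]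
  · rintro ⟨j, i⟩ h - heq
    simp only [Finset.mem_sigma, Finset.mem_erase] at h
    exact h.2.1 (congrArg Sigma.fst heq)
  · rintro ⟨j, i⟩ h
    simp only [Finset.mem_sigma, Finset.mem_erase] at h ⊢
    exact ⟨h.2.2, h.2.1.symm, h.1⟩
  · rintro ⟨j, i⟩ h
    rfl

variable {M : Type u} [AddCommGroup M] [Module R M] {P : ProjRes R M} {x : Fin s → R}

/-- The iterated null-homotopies indexed by finite sets. -/
noncomputable def koszulIter (H : ∀ i, Htpy P (x i)) (f : P.F 0) :
    ∀ n : ℕ, Finset (Fin s) → P.F n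
  | 0, _ => f
  | n + 1, T => if h : T.Nonempty then
      (H (T.min' h)).h n (koszulIter H f n (T.erase (T.min' h))) else 0

variable {H : ∀ i, Htpy P (x i)} {f : P.F 0}

theorem koszulIter_succ {n : ℕ} {T : Finset (Fin s)} {j : Fin s} (hj : j ∈ T)
    (hT : ∀ i ∈ T, j ≤ i) :
    koszulIter H f (n + 1) T = (H j).h n (koszulIter H f n (T.erase j)) := by
  have h1 : T.Nonempty := ⟨j, hj⟩
  obtain rfl : T.min' h1 = j := le_antisymm (Finset.min'_le _ _ hj) (hT _ (Finset.min'_mem _ _))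
  rw [koszulIter, dif_pos h1]

theorem hIter_koszulIter {n : ℕ} {T : Finset (Fin s)} (hT : T.card = n) :
    ∃ us : List R, (∀ u ∈ us, u ∈ Set.range x) ∧ HIter P n us (koszulIter H f n T) := by
  induction n generalizing T with
  | zero => exact ⟨[], by simp, HIter.base f⟩
  | succ n ih =>
    have h1 : T.Nonempty := Finset.card_pos.1 (by omega)
    obtain ⟨us, hus, hy⟩ := ih (T := T.erase (T.min' h1))
      (by rw [Finset.card_erase_of_mem (Finset.min'_mem _ _)]; omega)
    refine ⟨x (T.min' h1) :: us, ?_, ?_⟩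
    · simpa using hus
    · rw [koszulIter_succ (Finset.min'_mem _ h1) (fun i hi => Finset.min'_le _ _ hi)]
      exact HIter.step _ hy

theorem d_koszulIter {n : ℕ} {T : Finset (Fin s)} (hT : T.card = n + 1) :
    P.d n (koszulIter H f (n + 1) T) =
      ∑ j ∈ T, koszulCoeff x T j • koszulIter H f n (T.erase j) := by
  induction n generalizing T with
  | zero =>
    obtain ⟨j, rfl⟩ := Finset.card_eq_one.1 hT
    rw [koszulIter_succ (Finset.mem_singleton_self j) (by simp), (H j).zero,
      Finset.sum_singleton, koszulCoeff]
    simp [Finset.filter_singleton]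
  | succ n ih =>
    have h1 : T.Nonempty := Finset.card_pos.1 (by omega)
    obtain ⟨j, hj, hjT⟩ : ∃ j ∈ T, ∀ i ∈ T, j ≤ i :=
      ⟨T.min' h1, Finset.min'_mem _ _, fun i hi => Finset.min'_le _ _ hi⟩
    rw [koszulIter_succ hj hjT, eq_sub_of_add_eq ((H j).succ n _),
      ih (by rw [Finset.card_erase_of_mem hj]; omega), ← Finset.add_sum_erase _ _ hj,
      sub_eq_add_neg, map_sum, ← Finset.sum_neg_distrib]
    congr 1
    · have : T.filter (fun i => i < j) = ∅ := by
        ext i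
        simpa using fun hi => hjT i hi
      rw [koszulCoeff, this, Finset.card_empty, pow_zero, one_mul]
    · refine Finset.sum_congr rfl fun l hl => ?_
      obtain ⟨hlj, hlT⟩ := Finset.mem_erase.1 hl
      rw [koszulIter_succ (T := T.erase l) (Finset.mem_erase.2 ⟨hlj.symm, hj⟩)
        (fun i hi => hjT i (Finset.mem_of_mem_erase hi)), Finset.erase_right_comm, map_smul,
        ← neg_smul]
      congr 1
      have h2 : ((T.erase j).filter (fun k => k < l)).card + 1 =
          (T.filter (fun k => k < l)).card := by
        rw [Finset.filter_erase]
        exact Finset.card_erase_add_one (by simp [hj, lt_of_le_of_ne (hjT l hlT) hlj.symm])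
      rw [koszulCoeff, koszulCoeff, ← h2, pow_succ]
      ring

/-- The chain map from the Koszul complex given by iterated null-homotopies. -/
noncomputable def koszulMap (H : ∀ i, Htpy P (x i)) (f : P.F 0) (n : ℕ) : KMod R s n →ₗ[R] P.F n :=
  Finsupp.linearCombination R fun T : KIdx s n => koszulIter H f n T.1

theorem koszulMap_basis {n : ℕ} {T : Finset (Fin s)} (hT : T.card = n) :
    koszulMap H f n (koszulBasis R n T) = koszulIter H f n T := by
  rw [koszulBasis, dif_pos hT, koszulMap, Finsupp.linearCombination_single, one_smul]

theorem koszulMap_koszulD (n : ℕ) (v : KMod R s (n + 1)) :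
    koszulMap H f n (koszulD R x n v) = P.d n (koszulMap H f (n + 1) v) := by
  suffices h : koszulMap H f n ∘ₗ koszulD R x n = P.d n ∘ₗ koszulMap H f (n + 1) from
    LinearMap.congr_fun h v
  refine koszulMod_hom_ext fun T hT => ?_
  rw [LinearMap.comp_apply, LinearMap.comp_apply, koszulMap_basis hT, d_koszulIter hT,
    koszulD_basis x hT, map_sum]
  refine Finset.sum_congr rfl fun j hj => ?_
  rw [map_smul, koszulMap_basis (by rw [Finset.card_erase_of_mem hj]; omega)]

theorem koszulD_mem {𝔞 : Ideal R} (hx : ∀ i, x i ∈ 𝔞) (n : ℕ) (v : KMod R s (n + 1)) :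
    koszulD R x n v ∈ 𝔞 • (⊤ : Submodule R (KMod R s n)) := by
  induction v using Finsupp.induction_linear with
  | zero => simp
  | add v w hv hw => rw [map_add]; exact add_mem hv hw
  | single T a =>
    have h1 : Finsupp.single T a = a • koszulBasis R (n + 1) T.1 := by
      rw [koszulBasis_coe, Finsupp.smul_single, smul_eq_mul, mul_one]
    rw [h1, map_smul, koszulD_basis x T.2]
    refine Submodule.smul_mem _ _ (sum_mem fun j _ => ?_)
    exact Submodule.smul_mem_smul (Ideal.mul_mem_left _ _ (hx j)) trivial

/-- A chain map from the Koszul complex to a resolution inducing zero on augmentations is zero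
up to boundaries and the ideal containing the sequence. -/
theorem mem_of_koszul_chainMap {𝔞 : Ideal R} (hx : ∀ i, x i ∈ 𝔞)
    (a : ∀ n, KMod R s n →ₗ[R] P.F n)
    (ha : ∀ n v, a n (koszulD R x n v) = P.d n (a (n + 1) v)) (ha0 : ∀ v, P.ε (a 0 v) = 0)
    (n : ℕ) (v : KMod R s n) :
    a n v ∈ LinearMap.range (P.d n) ⊔ 𝔞 • (⊤ : Submodule R (P.F n)) := by
  obtain ⟨h0, hh0⟩ := exists_lift_of_range_le (P.d 0) (a 0) fun v => by
    rw [← P.exact0, LinearMap.mem_ker, ha0]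
  have key : ∀ n, ∃ h : KMod R s n →ₗ[R] P.F (n + 1), (∀ v : KMod R s (n + 1),
      P.d n (h (koszulD R x n v)) = a n (koszulD R x n v)) ∧
      ∀ v, a n v ∈ LinearMap.range (P.d n) ⊔ 𝔞 • (⊤ : Submodule R (P.F n)) := by
    intro n
    induction n with
    | zero => exact ⟨h0, fun v => hh0 _, fun v => Submodule.mem_sup_left ⟨h0 v, hh0 v⟩⟩
    | succ n ih =>
      obtain ⟨h, hh, -⟩ := ih
      obtain ⟨h', hh'⟩ := exists_lift_of_range_le (P.d (n + 1))
        (a (n + 1) - h ∘ₗ koszulD R x n) fun v => by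
          rw [← P.exact, LinearMap.mem_ker, LinearMap.sub_apply, LinearMap.comp_apply, map_sub, hh,
            ha, sub_self]
      have hh'' : ∀ v, P.d (n + 1) (h' v) = a (n + 1) v - h (koszulD R x n v) := hh'
      refine ⟨h', fun v => ?_, fun v => ?_⟩
      · rw [hh'', koszulD_koszulD, map_zero, sub_zero]
      · rw [← sub_add_cancel (a (n + 1) v) (h (koszulD R x n v)), ← hh'']
        exact add_mem (Submodule.mem_sup_left ⟨_, rfl⟩)
          (Submodule.mem_sup_right (map_mem_smul_top h (koszulD_mem hx n v)))
  exact (key n).choose_spec.2 v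

theorem exists_resolution_map (Q : ProjRes R M) (P : ProjRes R M) :
    ∃ η : ∀ n, Q.F n →ₗ[R] P.F n, (∀ v, P.ε (η 0 v) = Q.ε v) ∧
      ∀ n v, P.d n (η (n + 1) v) = η n (Q.d n v) := by
  have := Q.projective
  obtain ⟨η0, h0⟩ := exists_lift_of_range_le (F := Q.F 0) P.ε Q.ε fun v => P.surj _
  have hex : ∀ v, ∃ w, P.d 0 w = η0 (Q.d 0 v) := fun v => by
    change _ ∈ LinearMap.range (P.d 0)
    rw [← P.exact0, LinearMap.mem_ker, h0, ← LinearMap.mem_ker, Q.exact0]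
    exact ⟨v, rfl⟩
  have step : ∀ n (η : {η : Q.F n →ₗ[R] P.F n // ∀ v, η (Q.d n v) ∈ LinearMap.range (P.d n)}),
      ∃ η' : {η : Q.F (n + 1) →ₗ[R] P.F (n + 1) //
        ∀ v, η (Q.d (n + 1) v) ∈ LinearMap.range (P.d (n + 1))},
        ∀ v, P.d n (η'.1 v) = η.1 (Q.d n v) := by
    rintro n ⟨η, hη⟩
    obtain ⟨η', hη'⟩ := exists_lift_of_range_le (P.d n) (η ∘ₗ Q.d n) hη
    exact ⟨⟨η', fun v => by
      rw [← P.exact, LinearMap.mem_ker, hη', LinearMap.comp_apply, d_d, map_zero]⟩, hη'⟩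
  choose st hst using step
  let t : ∀ n, {η : Q.F n →ₗ[R] P.F n // ∀ v, η (Q.d n v) ∈ LinearMap.range (P.d n)} :=
    fun n => Nat.rec ⟨η0, hex⟩ (fun n h => st n h) n
  exact ⟨fun n => (t n).1, h0, fun n v => hst n (t n) v⟩

theorem koszulTorMapZero_of_forall_hIter [IsLocalRing R] {I : Ideal R} (hx : ∀ i, x i ∈ I)
    (hIm : I ≤ maximalIdeal R) (Q : ProjRes R (R ⧸ I)) {j : ℕ}
    (hQ : ∀ (us : List R) (y : Q.F j), (∀ u ∈ us, u ∈ I) → HIter Q j us y →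
      y ∈ LinearMap.range (Q.d j) ⊔ maximalIdeal R • (⊤ : Submodule R (Q.F j))) :
    KoszulTorMapZero R x I j := by
  intro P L v
  obtain ⟨η, hη0, hη⟩ := exists_resolution_map Q P
  have hann : ∀ u ∈ I, ∀ m : R ⧸ I, u • m = 0 := by
    intro u hu m
    obtain ⟨r, rfl⟩ := Ideal.Quotient.mk_surjective m
    exact Ideal.Quotient.eq_zero_iff_mem.2 (I.mul_mem_right r hu)
  have hH : ∀ i, Nonempty (Htpy Q (x i)) := fun i => exists_htpy Q (hann _ (hx i))
  let H : ∀ i, Htpy Q (x i) := fun i => (hH i).some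
  obtain ⟨f, hf⟩ := Q.surj (Ideal.Quotient.mk I 1)
  have h1 := mem_of_koszul_chainMap (P := P) (fun i => hIm (hx i))
    (fun n => L.ψ n - η n ∘ₗ koszulMap H f n)
    (fun n v => by
      have h2 : L.ψ n (koszulD R x n v) = P.d n (L.ψ (n + 1) v) := LinearMap.congr_fun (L.comm n) v
      simp only [LinearMap.sub_apply, LinearMap.comp_apply, map_sub, hη, h2, koszulMap_koszulD])
    (fun v => by
      simp only [LinearMap.sub_apply, LinearMap.comp_apply, map_sub, hη0, L.aug]
      suffices h : Q.ε ∘ₗ koszulMap H f 0 =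
          Submodule.mkQ I ∘ₗ Finsupp.lapply (⟨∅, rfl⟩ : KIdx s 0) by
        rw [sub_eq_zero]
        exact (LinearMap.congr_fun h v).symm
      refine koszulMod_hom_ext fun T hT => ?_
      obtain rfl := Finset.card_eq_zero.1 hT
      rw [LinearMap.comp_apply, koszulMap_basis hT, LinearMap.comp_apply, koszulBasis, dif_pos hT,
        Finsupp.lapply_apply, Finsupp.single_eq_same]
      exact hf) j v
  have h2 : koszulMap H f j v ∈
      LinearMap.range (Q.d j) ⊔ maximalIdeal R • (⊤ : Submodule R (Q.F j)) := by
    rw [koszulMap, Finsupp.linearCombination_apply]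
    refine sum_mem fun T _ => Submodule.smul_mem _ _ ?_
    obtain ⟨us, hus, hy⟩ := hIter_koszulIter (H := H) (f := f) T.2
    refine hQ us _ (fun u hu => ?_) hy
    obtain ⟨i, rfl⟩ := hus u hu
    exact hx i
  obtain ⟨_, ⟨w, rfl⟩, b, hb, hwb⟩ := Submodule.mem_sup.1 h2
  have h3 : L.ψ j v = (L.ψ j - η j ∘ₗ koszulMap H f j) v + (P.d j (η (j + 1) w) + η j b) := by
    rw [hη, ← map_add, hwb, LinearMap.sub_apply, LinearMap.comp_apply, sub_add_cancel]
  rw [h3]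
  exact add_mem h1 (Submodule.add_mem_sup ⟨_, rfl⟩ (map_mem_smul_top _ hb))

end Koszul

section Reduction

variable {R : Type u} [CommRing R]

/-- The reduction of a linear map modulo an element. -/
noncomputable def redMap (r : R) {F G : Type*} [AddCommGroup F] [Module R F] [AddCommGroup G]
    [Module R G] (f : F →ₗ[R] G) : QuotSMulTop r F →ₗ[R ⧸ span {r}] QuotSMulTop r G :=
  (QuotSMulTop.map r f).extendScalarsOfSurjective Ideal.Quotient.mk_surjective

theorem redMap_mk (r : R) {F G : Type*} [AddCommGroup F] [Module R F] [AddCommGroup G]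
    [Module R G] (f : F →ₗ[R] G) (v : F) :
    redMap r f (Submodule.Quotient.mk v) = Submodule.Quotient.mk (f v) := rfl

theorem quotSMulTop_mk_eq_zero {r : R} {F : Type*} [AddCommGroup F] [Module R F] {v : F} :
    (Submodule.Quotient.mk v : QuotSMulTop r F) = 0 ↔ ∃ w, v = r • w := by
  rw [Submodule.Quotient.mk_eq_zero, Submodule.mem_smul_pointwise_iff_exists]
  exact ⟨fun ⟨w, _, h⟩ => ⟨w, h.symm⟩, fun ⟨w, h⟩ => ⟨w, trivial, h.symm⟩⟩

theorem exists_list_map_mk {I J : Ideal R} {us' : List (R ⧸ J)}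
    (h : ∀ u ∈ us', u ∈ I.map (Ideal.Quotient.mk J)) :
    ∃ us : List R, (∀ u ∈ us, u ∈ I) ∧ us.map (Ideal.Quotient.mk J) = us' := by
  induction us' with
  | nil => exact ⟨[], by simp⟩
  | cons a as ih =>
    obtain ⟨us, h1, rfl⟩ := ih fun u hu => h u (by simp [hu])
    obtain ⟨b, hb, rfl⟩ := (Ideal.mem_map_iff_of_surjective _ Ideal.Quotient.mk_surjective).1
      (h a (by simp))
    exact ⟨b :: us, by simpa using ⟨hb, h1⟩, rfl⟩

variable {M : Type u} [AddCommGroup M] [Module R M] {r : R}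

theorem isSMulRegular_of_free {F : Type*} [AddCommGroup F] [Module R F] [Module.Free R F]
    (hr : IsSMulRegular R r) : IsSMulRegular F r := by
  let b := Module.Free.chooseBasis R F
  intro v w h
  refine b.ext_elem fun i => hr ?_
  have := congrArg (fun v => b.repr v i) h
  simpa using this

theorem exists_eq_d_add_smul (P : ProjRes R M) (hP : FinFree P) (hr : IsSMulRegular R r)
    (hrM : IsSMulRegular M r) (n : ℕ) {v : P.F (n + 1)} {w : P.F n} (h : P.d n v = r • w) :
    ∃ u w', v = P.d (n + 1) u + r • w' := by
  obtain ⟨w', rfl⟩ : w ∈ LinearMap.range (P.d n) := by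
    match n, v, w, h with
    | 0, v, w, h =>
      rw [← P.exact0, LinearMap.mem_ker]
      refine hrM.right_eq_zero_of_smul ?_
      rw [← map_smul, ← h, ← LinearMap.mem_ker, P.exact0]
      exact ⟨v, rfl⟩
    | n + 1, v, w, h =>
      have := (hP n).1
      rw [← P.exact, LinearMap.mem_ker]
      refine (isSMulRegular_of_free (F := P.F n) hr).right_eq_zero_of_smul ?_
      rw [← map_smul, ← h, d_d]
  obtain ⟨u, hu⟩ : v - r • w' ∈ LinearMap.range (P.d (n + 1)) := by
    rw [← P.exact, LinearMap.mem_ker, map_sub, map_smul, h, sub_self]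
  exact ⟨u, w', by rw [hu, sub_add_cancel]⟩

variable {N : Type u} [AddCommGroup N] [Module R N] [Module (R ⧸ span {r}) N]
  [IsScalarTower R (R ⧸ span {r}) N]

/-- The map out of the reduction induced by a map killing multiples of `r`. -/
noncomputable def redAug {F : Type*} [AddCommGroup F] [Module R F] (f : F →ₗ[R] N)
    (hf : ∀ v, f (r • v) = 0) : QuotSMulTop r F →ₗ[R ⧸ span {r}] N :=
  (Submodule.liftQ (r • ⊤) f (by rintro _ ⟨v, -, rfl⟩; exact hf v)).extendScalarsOfSurjective
    Ideal.Quotient.mk_surjective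

/-- The reduction of a finite free resolution modulo a regular element. -/
noncomputable def redRes (P : ProjRes R M) (hP : FinFree P) (hr : IsSMulRegular R r)
    (hrM : IsSMulRegular M r) (π : M →ₗ[R] N) (hπ : Function.Surjective π)
    (hker : ∀ m, π m = 0 ↔ ∃ m', m = r • m') : ProjRes (R ⧸ span {r}) N where
  F := fun n => ModuleCat.of _ (QuotSMulTop r (P.F n))
  d := fun n => redMap r (P.d n)
  ε := redAug (π ∘ₗ P.ε) fun v => (hker _).2 ⟨P.ε v, map_smul _ _ _⟩
  projective := fun n => by
    have := (hP n).1
    change Module.Projective (R ⧸ span {r}) (QuotSMulTop r (P.F n))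
    infer_instance
  surj := fun m => by
    obtain ⟨m, rfl⟩ := hπ m
    obtain ⟨v, rfl⟩ := P.surj m
    exact ⟨Submodule.Quotient.mk v, rfl⟩
  exact0 := by
    ext v
    obtain ⟨v, rfl⟩ := Submodule.Quotient.mk_surjective _ v
    constructor
    · intro h
      obtain ⟨m, hm⟩ := (hker _).1 (show π (P.ε v) = 0 from h)
      obtain ⟨w, rfl⟩ := P.surj m
      obtain ⟨u, hu⟩ : v - r • w ∈ LinearMap.range (P.d 0) := by
        rw [← P.exact0, LinearMap.mem_ker, map_sub, hm, map_smul, sub_self]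
      refine ⟨Submodule.Quotient.mk u, ?_⟩
      rw [redMap_mk, hu, Submodule.Quotient.eq]
      simpa using Submodule.smul_mem_pointwise_smul w r ⊤ trivial
    · rintro ⟨u, hu⟩
      obtain ⟨u, rfl⟩ := Submodule.Quotient.mk_surjective _ u
      rw [← hu]
      change π (P.ε (P.d 0 u)) = 0
      have : P.d 0 u ∈ LinearMap.ker P.ε := P.exact0 ▸ ⟨u, rfl⟩
      rw [LinearMap.mem_ker.1 this, map_zero]
  exact := fun n => by
    ext v
    obtain ⟨v, rfl⟩ := Submodule.Quotient.mk_surjective _ v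
    constructor
    · intro h
      obtain ⟨w, hw⟩ := quotSMulTop_mk_eq_zero.1
        (show (Submodule.Quotient.mk (P.d n v) : QuotSMulTop r (P.F n)) = 0 from h)
      obtain ⟨u, w', rfl⟩ := exists_eq_d_add_smul P hP hr hrM n hw
      refine ⟨Submodule.Quotient.mk u, ?_⟩
      rw [redMap_mk, Submodule.Quotient.eq]
      simpa using Submodule.smul_mem_pointwise_smul w' r ⊤ trivial
    · rintro ⟨u, hu⟩
      obtain ⟨u, rfl⟩ := Submodule.Quotient.mk_surjective _ u
      rw [← hu]
      change (Submodule.Quotient.mk (P.d n (P.d (n + 1) u)) : QuotSMulTop r (P.F n)) = 0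
      rw [d_d, Submodule.Quotient.mk_zero]

variable {P : ProjRes R M} {hP : FinFree P} {hr : IsSMulRegular R r} {hrM : IsSMulRegular M r}
  {π : M →ₗ[R] N} {hπ : Function.Surjective π} {hker : ∀ m, π m = 0 ↔ ∃ m', m = r • m'}

theorem finFree_redRes : FinFree (redRes P hP hr hrM π hπ hker) := fun n => by
  have := (hP n).1
  have := (hP n).2
  change Module.Free (R ⧸ span {r}) (QuotSMulTop r (P.F n)) ∧
    Module.Finite (R ⧸ span {r}) (QuotSMulTop r (P.F n))
  exact ⟨inferInstance, Module.Finite.of_restrictScalars_finite R _ _⟩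

/-- The reduction of a null-homotopy. -/
noncomputable def Htpy.red {u : R} (H : Htpy P u) :
    Htpy (redRes P hP hr hrM π hπ hker) (Ideal.Quotient.mk (span {r}) u) where
  h := fun n => redMap r (H.h n)
  zero := fun v => by
    obtain ⟨v, rfl⟩ := Submodule.Quotient.mk_surjective _ v
    change (Submodule.Quotient.mk (P.d 0 (H.h 0 v)) : QuotSMulTop r (P.F 0)) =
      Submodule.Quotient.mk (u • v)
    rw [H.zero]
  succ := fun n v => by
    obtain ⟨v, rfl⟩ := Submodule.Quotient.mk_surjective _ v
    change (Submodule.Quotient.mk (P.d (n + 1) (H.h (n + 1) v) + H.h n (P.d n v)) :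
      QuotSMulTop r (P.F (n + 1))) = Submodule.Quotient.mk (u • v)
    rw [H.succ]

theorem HIter.red {n : ℕ} {us : List R} {y : P.F n} (h : HIter P n us y) :
    HIter (redRes P hP hr hrM π hπ hker) n (us.map (Ideal.Quotient.mk (span {r})))
      (Submodule.Quotient.mk y : QuotSMulTop r (P.F n)) := by
  induction h with
  | base f => exact HIter.base _
  | step H hf ih => exact HIter.step H.red ih

theorem mem_of_redMap_mem {J : Ideal R} (hrJ : r ∈ J) {n : ℕ} {y : P.F n}
    (h : (Submodule.Quotient.mk y : QuotSMulTop r (P.F n)) ∈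
      LinearMap.range (redMap r (P.d n)) ⊔ J.map (Ideal.Quotient.mk (span {r})) •
        (⊤ : Submodule (R ⧸ span {r}) (QuotSMulTop r (P.F n)))) :
    y ∈ LinearMap.range (P.d n) ⊔ J • (⊤ : Submodule R (P.F n)) := by
  have key : ∀ z ∈ J.map (Ideal.Quotient.mk (span {r})) •
      (⊤ : Submodule (R ⧸ span {r}) (QuotSMulTop r (P.F n))),
      ∃ b ∈ J • (⊤ : Submodule R (P.F n)), Submodule.Quotient.mk b = z := by
    intro z hz
    refine Submodule.smul_induction_on hz (fun a ha m _ => ?_) ?_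
    · obtain ⟨m, rfl⟩ := Submodule.Quotient.mk_surjective _ m
      obtain ⟨a, haJ, rfl⟩ := (Ideal.mem_map_iff_of_surjective _ Ideal.Quotient.mk_surjective).1 ha
      exact ⟨a • m, Submodule.smul_mem_smul haJ trivial, rfl⟩
    · rintro _ _ ⟨b, hb, rfl⟩ ⟨b', hb', rfl⟩
      exact ⟨b + b', add_mem hb hb', rfl⟩
  have h0 : ∃ a ∈ LinearMap.range (redMap r (P.d n)), ∃ z ∈ J.map (Ideal.Quotient.mk (span {r})) •
      (⊤ : Submodule (R ⧸ span {r}) (QuotSMulTop r (P.F n))), a + z = Submodule.Quotient.mk y :=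
    Submodule.mem_sup.1 h
  obtain ⟨_, ⟨u, rfl⟩, z, hz, huz⟩ := h0
  obtain ⟨u, rfl⟩ := Submodule.Quotient.mk_surjective _ u
  obtain ⟨b, hb, rfl⟩ := key z hz
  have h1 : (Submodule.Quotient.mk (P.d n u + b) : QuotSMulTop r (P.F n)) =
    Submodule.Quotient.mk y := huz
  obtain ⟨w, -, hw⟩ := (Submodule.mem_smul_pointwise_iff_exists _ _ _).1
    ((Submodule.Quotient.eq _).1 h1.symm)
  have h2 : y = P.d n u + (b + r • w) := by
    have hw' : r • w = y - (P.d n u + b) := hw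
    rw [hw']
    abel
  rw [h2]
  exact Submodule.add_mem_sup ⟨u, rfl⟩ (add_mem hb (Submodule.smul_mem_smul hrJ trivial))

end Reduction

section Generators

variable {R : Type u} [CommRing R] [IsLocalRing R]

theorem ofList_ne_of_minimalGenerators {s : ℕ} {x : Fin s → R} {I : Ideal R}
    (hmin : MinimalGenerators R x I) {us : List R} (hus : us.length < s) :
    Ideal.ofList us ≠ I := by
  obtain ⟨rfl, hmin⟩ := hmin
  intro h
  have hx : ∀ i, ∃ a : Fin us.length → R, ∑ j, a j • us.get j = x i := fun i => by
    rw [← Submodule.mem_span_range_iff_exists_fun, Set.range_list_get]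
    change x i ∈ Ideal.ofList us
    rw [h]
    exact Ideal.subset_span ⟨i, rfl⟩
  choose A hA using hx
  have hdep : ¬ LinearIndependent (ResidueField R) fun i j => residue R (A i j) := fun hli => by
    have := hli.fintype_card_le_finrank
    simp at this
    omega
  obtain ⟨g, hg, i, hi⟩ := Fintype.not_linearIndependent_iff.1 hdep
  choose c hc using fun i => residue_surjective (g i)
  have hci : IsUnit (c i) := by
    by_contra hci
    refine hi ?_
    rw [← hc, residue_eq_zero_iff]
    exact hci
  have hsum : ∑ i, c i * x i ∈ maximalIdeal R • span (Set.range x) := by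
    have h1 : ∑ i, c i * x i = ∑ j, (∑ i, c i * A i j) * us.get j := by
      simp only [← hA, Finset.mul_sum, Finset.sum_mul, smul_eq_mul, mul_assoc]
      exact Finset.sum_comm
    rw [h1]
    refine sum_mem fun j _ => Submodule.smul_mem_smul ?_ ?_
    · rw [← residue_eq_zero_iff, map_sum]
      simpa [hc] using congrFun hg j
    · rw [← h]
      exact Ideal.subset_span (List.get_mem _ _)
  refine hmin i (Submodule.le_of_le_smul_of_le_jacobson_bot (I := maximalIdeal R)
    (N := span (x '' {i}ᶜ)) (N' := span (Set.range x)) (Submodule.fg_span (Set.finite_range x))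
    (IsLocalRing.maximalIdeal_le_jacobson _) ?_ (Ideal.subset_span ⟨i, rfl⟩))
  rw [Ideal.span_le]
  rintro _ ⟨j, rfl⟩
  have hj : ∀ j ≠ i, x j ∈ span (x '' {i}ᶜ) := fun j hj => Ideal.subset_span ⟨j, hj, rfl⟩
  by_cases hji : j = i
  · subst hji
    rw [SetLike.mem_coe, ← Ideal.unit_mul_mem_iff_mem _ hci, ← sub_sub_cancel (∑ i, c i * x i)
      (c j * x j)]
    refine sub_mem (Submodule.mem_sup_right hsum) (Submodule.mem_sup_left ?_)
    rw [← Finset.add_sum_erase _ _ (Finset.mem_univ j), add_sub_cancel_left]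
    exact sum_mem fun l hl => Ideal.mul_mem_left _ _ (hj l (Finset.ne_of_mem_erase hl))
  · exact Submodule.mem_sup_left (hj j hji)

/-- Generators of `I` modulo an element that is regular modulo `I` lift to generators of `I`. -/
theorem exists_ofList_eq_of_map_eq [IsNoetherianRing R] {I : Ideal R} {r : R}
    (hrm : r ∈ maximalIdeal R) (hr : IsSMulRegular (R ⧸ I) r) {us' : List (R ⧸ span {r})}
    (h : Ideal.ofList us' = I.map (Ideal.Quotient.mk (span {r}))) :
    ∃ us : List R, us.length = us'.length ∧ Ideal.ofList us = I := by
  obtain ⟨us, hus, rfl⟩ := exists_list_map_mk (I := I) (us' := us')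
    fun u hu => h ▸ Ideal.subset_span hu
  have hle : Ideal.ofList us ≤ I := Ideal.span_le.2 hus
  refine ⟨us, (List.length_map _).symm, le_antisymm hle ?_⟩
  refine Submodule.le_of_le_smul_of_le_jacobson_bot (I := maximalIdeal R)
    (IsNoetherian.noetherian _) (IsLocalRing.maximalIdeal_le_jacobson _) fun a ha => ?_
  have h1 : a ∈ span {r} ⊔ Ideal.ofList us := by
    rw [← mk_mem_map_mk, Ideal.map_ofList, h]
    exact Ideal.mem_map_of_mem _ ha
  obtain ⟨c, b, hb, rfl⟩ := Ideal.mem_span_singleton_sup.1 h1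
  have hc : c ∈ I := by
    rw [← Ideal.Quotient.eq_zero_iff_mem]
    refine hr.right_eq_zero_of_smul ?_
    change Ideal.Quotient.mk I (r * c) = 0
    rw [Ideal.Quotient.eq_zero_iff_mem, mul_comm]
    simpa using sub_mem ha (hle hb)
  rw [add_comm, mul_comm]
  exact Submodule.add_mem_sup hb (Submodule.smul_mem_smul hrm hc)

end Generators

section Assembly

variable {R : Type u} [CommRing R] [IsLocalRing R] {n d : ℕ} {I : Ideal R}

/-- In the top degree of a resolution, a nonzero iterated homotopy class forces `I` to be
generated by the scalars used. -/
theorem HIter.mem_of_subsingleton {P : ProjRes R (R ⧸ I)} (hP : FinFree P)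
    (hl : Subsingleton (P.F (d + 1)))
    (hgen : ∀ us : List R, us.length = d → Ideal.ofList us ≠ I) {us : List R}
    (hus : ∀ u ∈ us, u ∈ I) {y : P.F d} (hy : HIter P d us y) :
    y ∈ LinearMap.range (P.d d) ⊔ maximalIdeal R • (⊤ : Submodule R (P.F d)) := by
  have := (hP d).1
  refine Submodule.mem_sup_right (mem_smul_top_of_forall_apply_mem fun f => ?_)
  by_contra hf
  have hu : IsUnit (f y) := by simpa using hf
  refine hgen us hy.length_eq (le_antisymm (Ideal.span_le.2 hus) fun b hb => ?_)
  have h1 := hy.smul_mem (z := b) fun m => by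
    obtain ⟨a, rfl⟩ := Ideal.Quotient.mk_surjective m
    exact Ideal.Quotient.eq_zero_iff_mem.2 (I.mul_mem_right a hb)
  have h0 : LinearMap.range (P.d d) = ⊥ := by
    rw [LinearMap.range_eq_bot]
    ext v
    rw [Subsingleton.elim v 0, map_zero, map_zero]
  rw [h0, bot_sup_eq] at h1
  have h2 := apply_mem_of_mem_smul_top f h1
  rw [map_smul, smul_eq_mul] at h2
  exact (Ideal.mul_unit_mem_iff_mem _ hu).1 h2

theorem HIter.mem_of_quotient (h : RegLocal R (n + 1))
    (hOIC : ∀ (R' : Type u) [CommRing R'] [IsLocalRing R'],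
      IsRegularLocal R' → ringKrullDim R' = n → OrderIdealConjecture R')
    (hS : SerreS (R ⧸ I) 2) (hIm : I ≤ maximalIdeal R) (hdn : d ≤ n)
    (hunm : ∀ p ∈ associatedPrimes R (R ⧸ I), p.height = d)
    (hgen : ∀ us : List R, us.length = d → Ideal.ofList us ≠ I)
    {P : ProjRes R (R ⧸ I)} (hP : FinFree P) {l : ℕ} (hl : ∀ j, l ≤ j → Subsingleton (P.F j))
    {j : ℕ} (hj : d ≤ j) {us : List R} (hus : ∀ u ∈ us, u ∈ I) {y : P.F j} (hy : HIter P j us y) :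
    y ∈ LinearMap.range (P.d j) ⊔ maximalIdeal R • (⊤ : Submodule R (P.F j)) := by
  have := h.noeth
  have := h.isDomain
  obtain ⟨r, hrm, hr2, hr⟩ := h.exists_notMem (associatedPrimes.finite R (R ⧸ I))
    (fun p hp => hp.1) fun p hp hpm => by
      have h1 := hunm p hp
      rw [hpm, h.height_maximalIdeal] at h1
      have : n + 1 = d := by exact_mod_cast h1
      omega
  have hr0 : r ≠ 0 := by rintro rfl; simp at hr2
  have hrR : IsSMulRegular R r := IsSMulRegular.of_ne_zero hr0
  have hrI : IsSMulRegular (R ⧸ I) r := isSMulRegular_of_notMem_associatedPrimes hr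
  have hle : span {r} ≤ maximalIdeal R := by simpa [Ideal.span_le] using hrm
  have := isLocalRing_quotient hle
  have h' := h.quotient hrm hr2
  have hmax : (maximalIdeal R).map (Ideal.Quotient.mk (span {r})) =
      maximalIdeal (R ⧸ span {r}) :=
    IsLocalRing.map_maximalIdeal_of_surjective _ Ideal.Quotient.mk_surjective
  let I' := I.map (Ideal.Quotient.mk (span {r}))
  let π : (R ⧸ I) →ₗ[R] (R ⧸ span {r}) ⧸ I' :=
    Submodule.liftQ I (Algebra.linearMap R _) fun a ha =>
      Ideal.Quotient.eq_zero_iff_mem.2 (Ideal.mem_map_of_mem _ ha)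
  have hπ : Function.Surjective π := fun m => by
    obtain ⟨m, rfl⟩ := Ideal.Quotient.mk_surjective m
    obtain ⟨a, rfl⟩ := Ideal.Quotient.mk_surjective m
    exact ⟨Ideal.Quotient.mk I a, rfl⟩
  have hker : ∀ m, π m = 0 ↔ ∃ m', m = r • m' := fun m => by
    obtain ⟨a, rfl⟩ := Ideal.Quotient.mk_surjective m
    change Ideal.Quotient.mk I' (Ideal.Quotient.mk (span {r}) a) = 0 ↔ _
    rw [Ideal.Quotient.eq_zero_iff_mem, mk_mem_map_mk, Ideal.mem_span_singleton_sup]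
    constructor
    · rintro ⟨c, b, hb, rfl⟩
      refine ⟨Ideal.Quotient.mk I c, ?_⟩
      change _ = Ideal.Quotient.mk I (r * c)
      rw [Ideal.Quotient.eq, mul_comm, add_sub_cancel_left]
      exact hb
    · rintro ⟨m', hm'⟩
      obtain ⟨c, rfl⟩ := Ideal.Quotient.mk_surjective m'
      change _ = Ideal.Quotient.mk I (r * c) at hm'
      rw [Ideal.Quotient.eq] at hm'
      exact ⟨c, _, hm', by ring⟩
  refine mem_of_redMap_mem hrm ?_
  rw [hmax]
  refine HIter.mem_of_orderIdealConjecture (P := redRes P hP hrR hrI π hπ hker) (l := l) (d := d) h'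
    (hOIC _ h'.isRegularLocal h'.dim) finFree_redRes (fun j hj => ?_) ?_
    (fun p hp => height_eq_of_quotient h hS hunm hrm hr2 hr hp) ?_ hj (us := us.map _) ?_ hy.red
  · have := hl j hj
    change Subsingleton (QuotSMulTop r (P.F j))
    infer_instance
  · rw [← hmax]
    exact Ideal.map_mono hIm
  · intro us' hlen hus'
    obtain ⟨us, hlen', rfl⟩ := exists_ofList_eq_of_map_eq hrm hrI hus'
    exact hgen us (hlen'.trans hlen) rfl
  · intro u hu
    obtain ⟨u, hu', rfl⟩ := List.mem_map.1 hu
    exact Ideal.mem_map_of_mem _ (hus u hu')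

theorem koszulTorMapZero_of_regLocal (h : RegLocal R n)
    (hOIC : ∀ (R' : Type u) [CommRing R'] [IsLocalRing R'],
      IsRegularLocal R' → ringKrullDim R' = (n - 1 : ℕ) → OrderIdealConjecture R')
    (hht : HeightEq R I d) {s : ℕ} (hs : d < s) {x : Fin s → R} (hmin : MinimalGenerators R x I)
    (hS : SerreS (R ⧸ I) 2) {j : ℕ} (hj : d ≤ j) : KoszulTorMapZero R x I j := by
  have := h.noeth
  obtain ⟨⟨Q, hQ, hIQ, hQd⟩, hall⟩ := hht
  have hIm : I ≤ maximalIdeal R := hIQ.trans (IsLocalRing.le_maximalIdeal hQ.ne_top)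
  have hQd' : Q.height = d := by
    rw [IsLocalization.AtPrime.ringKrullDim_eq_height Q] at hQd
    exact_mod_cast hQd
  have hdn : d ≤ n := by
    have h1 := Ideal.height_mono (IsLocalRing.le_maximalIdeal hQ.ne_top)
    rw [hQd', h.height_maximalIdeal] at h1
    exact_mod_cast h1
  have hunm : ∀ p ∈ associatedPrimes R (R ⧸ I), p.height = d := fun p hp =>
    height_eq_of_serreS h hS (fun Q' hQ' hIQ' => by
      have h1 := hall Q' hQ' hIQ'
      rw [IsLocalization.AtPrime.ringKrullDim_eq_height Q'] at h1
      exact_mod_cast h1) hIQ hQd' hp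
  have hgen : ∀ us : List R, us.length = d → Ideal.ofList us ≠ I := fun us hus =>
    ofList_ne_of_minimalGenerators hmin (by omega)
  obtain ⟨P, hP, hl⟩ := exists_res_of_freeDimLE (freeDimLE_of_regLocal R h (R ⧸ I))
  refine koszulTorMapZero_of_forall_hIter
    (fun i => hmin.1 ▸ Ideal.subset_span ⟨i, rfl⟩) hIm P fun us y hus hy => ?_
  rcases hdn.eq_or_lt with rfl | hdn
  · rcases hj.eq_or_lt with rfl | hj
    · exact hy.mem_of_subsingleton hP (hl _ d.lt_succ_self) hgen hus
    · have := hl j hj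
      rw [Subsingleton.elim y 0]
      exact zero_mem _
  · obtain ⟨n, rfl⟩ : ∃ k, n = k + 1 := ⟨n - 1, by omega⟩
    exact hy.mem_of_quotient h hOIC hS hIm (by omega) hunm hgen hP (l := n + 2)
      (fun j hj => hl j (by omega)) hj hus

end Assembly

end KoszulTor

/-- Let `(R,m,k)` be a regular local ring of dimension `n` and
assume that the order ideal conjecture holds for every regular local ring of
dimension `n − 1`.  Let `I` be an ideal of height `d` with minimal set of
generators `x₁,…,x_s`, where `s > d`, and suppose `R/I` satisfies Serre's
condition `S_2`.  If `I` contains an element of `m ∖ m²`, or if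
`depth R/I > 0`, then for every `i ≥ 0` the natural map
`K_{d+i}(x;R) ⊗_R k → Tor_{d+i}^R(R/I, k)` is the zero map. -/
theorem statement6
    (R : Type u) [CommRing R] [IsLocalRing R] (hreg : IsRegularLocal R)
    (n : ℕ) (hdim : ringKrullDim R = n)
    (hOIC : ∀ (R' : Type u) [CommRing R'] [IsLocalRing R'],
      IsRegularLocal R' → ringKrullDim R' = (n - 1 : ℕ) → OrderIdealConjecture R')
    (I : Ideal R) (d : ℕ) (hht : HeightEq R I d)
    {s : ℕ} (hs : d < s) (x : Fin s → R) (hmin : MinimalGenerators R x I)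
    (hS2 : SerreS (R ⧸ I) 2)
    (hcase : (∃ w ∈ I, w ∈ maximalIdeal R ∧ w ∉ (maximalIdeal R) ^ 2) ∨
      (∃ r ∈ maximalIdeal R, IsSMulRegular (R ⧸ I) r))
    (i : ℕ) :
    KoszulTorMapZero R x I (d + i) := by
  exact KoszulTor.koszulTorMapZero_of_regLocal (.of_isRegularLocal hreg hdim) hOIC hht hs hmin hS2
    (Nat.le_add_right d i)
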